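/- The following two statements are equivalent: (i) for every Noetherian complete local ring (R, m) and every I ∈ 𝓘(R), one has mAss_R R = 𝔄(I,R) ∪ 𝔅(I,R) ∪ 𝔇(I,R); (ii) for every Noetherian complete local domain (R, m) of dimension 4 and every ideal I of R with height I = 2, one has I ∉ 𝓘(R). -/

import Mathlib

universe u

open CategoryTheory

/-- An `R`-module `L` is `I`-cofinite if `Supp L ⊆ V(I)` and `Ext^i_R(R/I, L)` is a finitely
generated `R`-module for all `i ≥ 0`. -/
def IsCofinite {R : Type u} [CommRing R] (I : Ideal R) (L : ModuleCat.{u} R) : Prop :=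
  Module.support R L ⊆ PrimeSpectrum.zeroLocus (I : Set R) ∧
    ∀ i : ℕ, Module.Finite R
      (((Ext R (ModuleCat.{u} R) i).obj (Opposite.op (ModuleCat.of R (R ⧸ I)))).obj L)

/-- `I ∈ 𝓘(R)`: for every finitely generated `R`-module `M`, the local cohomology modules
`H^i_I(M)` are `I`-cofinite for all `i ≥ 0`. -/
def MemCofiniteClass (R : Type u) [CommRing R] (I : Ideal R) : Prop :=
  ∀ M : ModuleCat.{u} R, Module.Finite R M →
    ∀ i : ℕ, IsCofinite I ((localCohomology I i).obj M)

/-- The cohomological dimension `cd(I, M)`: the supremum (in `WithBot ℕ∞`, so that the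
supremum of the empty set is `⊥ = -∞`) of the set of indices `i` with `H^i_I(M) ≠ 0`. -/
noncomputable def cohomologicalDim {R : Type u} [CommRing R] (I : Ideal R)
    (M : ModuleCat.{u} R) : WithBot ℕ∞ :=
  sSup ((fun i : ℕ => ((i : ℕ∞) : WithBot ℕ∞)) ''
    {i : ℕ | Nontrivial ((localCohomology I i).obj M)})

/-- `mAss_R R`: the set of minimal elements of `Ass_R R` with respect to inclusion. -/
def minimalAssociatedPrimes (R : Type u) [CommRing R] : Set (Ideal R) :=
  {p ∈ associatedPrimes R R | ∀ q ∈ associatedPrimes R R, q ≤ p → q = p}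

/-- `𝔄(I,R) = { p ∈ mAss_R R : I + p = R or p ⊇ I }`. -/
def frakA {R : Type u} [CommRing R] (I : Ideal R) : Set (Ideal R) :=
  {p ∈ minimalAssociatedPrimes R | I + p = ⊤ ∨ I ≤ p}

/-- `𝔅(I,R) = { p ∈ mAss_R R : cd(I, R/p) = 1 }`. -/
noncomputable def frakB {R : Type u} [CommRing R] (I : Ideal R) : Set (Ideal R) :=
  {p ∈ minimalAssociatedPrimes R | cohomologicalDim I (ModuleCat.of R (R ⧸ p)) = 1}

/-- `𝔇(I,R) = { p ∈ mAss_R R : 0 ≤ dim R/(I + p) ≤ 1 }`. -/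
def frakD {R : Type u} [CommRing R] (I : Ideal R) : Set (Ideal R) :=
  {p ∈ minimalAssociatedPrimes R |
    0 ≤ ringKrullDim (R ⧸ (I + p)) ∧ ringKrullDim (R ⧸ (I + p)) ≤ 1}

/-- The height of an ideal `I`: the infimum of the heights of the prime ideals containing `I`. -/
noncomputable def idealHeight {R : Type*} [CommRing R] (I : Ideal R) : ℕ∞ :=
  ⨅ p ∈ {p : PrimeSpectrum R | I ≤ p.asIdeal}, Order.height p

section
open CategoryTheory
namespace LCoh

/-- A linear map defined by a correspondence. -/
theorem exists_desc {R Z A B : Type*} [CommRing R] [AddCommGroup Z] [Module R Z]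
    [AddCommGroup A] [Module R A] [AddCommGroup B] [Module R B] (p : Z →ₗ[R] A) (q : Z →ₗ[R] B)
    (hp : Function.Surjective p) (h : ∀ z, p z = 0 → q z = 0) :
    ∃ δ : A →ₗ[R] B, ∀ z, δ (p z) = q z := by
  refine ⟨((LinearMap.ker p).liftQ q (fun z hz => h z hz)) ∘ₗ
    (p.quotKerEquivOfSurjective hp).symm.toLinearMap, fun z => ?_⟩
  have : (p.quotKerEquivOfSurjective hp).symm (p z) = Submodule.Quotient.mk z := by
    rw [LinearEquiv.symm_apply_eq]; rfl
  rw [LinearMap.comp_apply, LinearEquiv.coe_coe, this]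
  exact Submodule.liftQ_apply _ _ _

/-- A homemade notion of cochain complex. -/
structure Cx (R : Type u) [CommRing R] where
  X : ℤ → Type u
  [grp : ∀ i, AddCommGroup (X i)]
  [mod : ∀ i, Module R (X i)]
  d : ∀ i, X i →ₗ[R] X (i+1)
  dd : ∀ i x, d (i+1) (d i x) = 0

attribute [instance] Cx.grp Cx.mod

variable {R : Type u} [CommRing R]

@[ext]
structure Cx.Hom (C D : Cx R) where
  f : ∀ i, C.X i →ₗ[R] D.X i
  comm : ∀ i x, f (i+1) (C.d i x) = D.d i (f i x)

namespace Cx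

abbrev Z (C : Cx R) (n : ℤ) : Submodule R (C.X (n+1)) := LinearMap.ker (C.d (n+1))

abbrev B (C : Cx R) (n : ℤ) : Submodule R (C.Z n) := (LinearMap.range (C.d n)).submoduleOf _

abbrev h (C : Cx R) (n : ℤ) : Type u := C.Z n ⧸ C.B n

def cls (C : Cx R) (n : ℤ) : C.Z n →ₗ[R] C.h n := (C.B n).mkQ

lemma cls_surj (C : Cx R) (n : ℤ) : Function.Surjective (C.cls n) := Submodule.mkQ_surjective _

lemma cls_eq_zero (C : Cx R) (n : ℤ) (z : C.Z n) :
    C.cls n z = 0 ↔ ∃ y, C.d n y = z := by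
  rw [cls, Submodule.mkQ_apply, Submodule.Quotient.mk_eq_zero]
  exact Iff.rfl

lemma cls_eq (C : Cx R) (n : ℤ) (z w : C.Z n) :
    C.cls n z = C.cls n w ↔ ∃ y, (z : C.X (n+1)) = w + C.d n y := by
  rw [← sub_eq_zero, ← map_sub, cls_eq_zero]
  constructor
  · rintro ⟨y, hy⟩; exact ⟨y, by rw [hy]; simp⟩
  · rintro ⟨y, hy⟩; exact ⟨y, by simp [hy]⟩

def Hom.z {C D : Cx R} (f : Hom C D) (n : ℤ) : C.Z n →ₗ[R] D.Z n :=
  LinearMap.restrict (f.f (n+1)) (fun x hx => by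
    simp only [LinearMap.mem_ker] at hx ⊢
    rw [← f.comm, hx, map_zero])

@[simp] lemma Hom.z_coe {C D : Cx R} (f : Hom C D) (n : ℤ) (x : C.Z n) :
    (f.z n x : D.X (n+1)) = f.f (n+1) x := rfl

def Hom.h {C D : Cx R} (f : Hom C D) (n : ℤ) : C.h n →ₗ[R] D.h n :=
  Submodule.mapQ _ _ (f.z n) (by
    rintro x ⟨y, hy⟩
    exact ⟨f.f n y, by rw [← f.comm, hy]; rfl⟩)

@[simp] lemma Hom.h_cls {C D : Cx R} (f : Hom C D) (n : ℤ) (x : C.Z n) :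
    f.h n (C.cls n x) = D.cls n (f.z n x) := rfl

def Hom.id (C : Cx R) : Hom C C := ⟨fun _ => LinearMap.id, fun _ _ => rfl⟩

def Hom.comp {C D E : Cx R} (g : Hom D E) (f : Hom C D) : Hom C E :=
  ⟨fun i => g.f i ∘ₗ f.f i, fun i x => by simp [f.comm, g.comm]⟩

lemma Hom.h_id (C : Cx R) (n : ℤ) : (Hom.id C).h n = LinearMap.id := by
  ext x; rfl

lemma Hom.h_comp {C D E : Cx R} (g : Hom D E) (f : Hom C D) (n : ℤ) :
    (g.comp f).h n = g.h n ∘ₗ f.h n := by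
  ext x; rfl

/-- degreewise short exact -/
structure SES {C D E : Cx R} (f : Hom C D) (g : Hom D E) : Prop where
  inj : ∀ i, Function.Injective (f.f i)
  exact : ∀ i, Function.Exact (f.f i) (g.f i)
  surj : ∀ i, Function.Surjective (g.f i)

namespace SES
variable {C D E : Cx R} {f : Hom C D} {g : Hom D E}

lemma gf (s : SES f g) (i : ℤ) (x : C.X i) : g.f i (f.f i x) = 0 := (s.exact i).apply_apply_eq_zero x

lemma exact_mid (s : SES f g) (n : ℤ) : Function.Exact (f.h n) (g.h n) := by
  intro y
  obtain ⟨y, rfl⟩ := D.cls_surj n y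
  constructor
  · intro hy
    rw [Hom.h_cls, cls_eq_zero] at hy
    obtain ⟨e, he⟩ := hy
    obtain ⟨w, rfl⟩ := s.surj n e
    rw [← g.comm] at he
    have : g.f (n+1) (y - D.d n w) = 0 := by rw [map_sub, he]; simp
    obtain ⟨c, hc⟩ := (s.exact _ _).1 this
    have hcz : c ∈ C.Z n := by
      apply s.inj
      rw [f.comm, hc, map_sub, D.dd, map_zero, sub_zero]; exact y.2
    refine ⟨C.cls n ⟨c, hcz⟩, ?_⟩
    rw [Hom.h_cls, cls_eq]
    exact ⟨-w, by simp [hc, sub_eq_add_neg]⟩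
  · rintro ⟨x, hx⟩
    obtain ⟨x, rfl⟩ := C.cls_surj n x
    rw [← hx, Hom.h_cls, Hom.h_cls]
    have : g.z n (f.z n x) = 0 := Subtype.ext (s.gf _ _)
    rw [this, map_zero]

theorem exists_delta (s : SES f g) (n : ℤ) : ∃ δ : E.h n →ₗ[R] C.h (n+1),
    Function.Exact (g.h n) δ ∧ Function.Exact δ (f.h (n+1)) := by
  let T : Submodule R (D.X (n+1) × C.X (n+1+1)) :=
    LinearMap.ker ((D.d (n+1)) ∘ₗ LinearMap.fst R _ _ - (f.f (n+1+1)) ∘ₗ LinearMap.snd R _ _)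
  have hT : ∀ t : T, D.d (n+1) t.1.1 = f.f (n+1+1) t.1.2 := fun t => sub_eq_zero.1 t.2
  have hT1 : ∀ t : T, g.f (n+1) t.1.1 ∈ E.Z n := fun t => by
    change E.d (n+1) (g.f (n+1) t.1.1) = 0
    rw [← g.comm, hT, s.gf]
  have hT2 : ∀ t : T, t.1.2 ∈ C.Z (n+1) := fun t => by
    change C.d (n+1+1) t.1.2 = 0
    apply s.inj
    rw [f.comm, ← hT, D.dd, map_zero]
  let p : T →ₗ[R] E.h n := E.cls n ∘ₗ
    LinearMap.codRestrict _ ((g.f (n+1)) ∘ₗ LinearMap.fst R _ _ ∘ₗ T.subtype) hT1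
  let q : T →ₗ[R] C.h (n+1) := C.cls (n+1) ∘ₗ
    LinearMap.codRestrict _ (LinearMap.snd R _ _ ∘ₗ T.subtype) hT2
  have lift : ∀ e : E.Z n, ∃ t : T, g.f (n+1) t.1.1 = e := by
    intro e
    obtain ⟨y, hy⟩ := s.surj (n+1) e.1
    have : g.f (n+1+1) (D.d (n+1) y) = 0 := by rw [g.comm, hy]; exact e.2
    obtain ⟨x, hx⟩ := (s.exact _ _).1 this
    exact ⟨⟨(y, x), sub_eq_zero.2 hx.symm⟩, hy⟩
  have hpz : ∀ t : T, p t = 0 ↔ ∃ e, E.d n e = g.f (n+1) t.1.1 := fun t => E.cls_eq_zero n _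
  have hqz : ∀ t : T, q t = 0 ↔ ∃ c, C.d (n+1) c = t.1.2 := fun t => C.cls_eq_zero (n+1) _
  obtain ⟨δ, hδ⟩ := exists_desc p q (by
    intro e
    obtain ⟨e, rfl⟩ := E.cls_surj n e
    obtain ⟨t, ht⟩ := lift e
    exact ⟨t, congrArg (E.cls n) (Subtype.ext ht)⟩) (by
    intro t ht
    rw [hpz] at ht
    rw [hqz]
    obtain ⟨e, he⟩ := ht
    obtain ⟨w, rfl⟩ := s.surj n e
    rw [← g.comm] at he
    have : g.f (n+1) (t.1.1 - D.d n w) = 0 := by rw [map_sub, he]; simp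
    obtain ⟨c, hc⟩ := (s.exact _ _).1 this
    refine ⟨c, s.inj _ ?_⟩
    rw [f.comm, hc, map_sub, D.dd, sub_zero, hT])
  refine ⟨δ, ?_, ?_⟩
  · intro e
    obtain ⟨e, rfl⟩ := E.cls_surj n e
    obtain ⟨t, ht⟩ := lift e
    have hpt : p t = E.cls n e := congrArg (E.cls n) (Subtype.ext ht)
    rw [← hpt, hδ, hqz]
    constructor
    · rintro ⟨c, hc⟩
      have hz : t.1.1 - f.f (n+1) c ∈ D.Z n := by
        change D.d (n+1) _ = 0
        rw [map_sub, hT, ← f.comm, hc, sub_self]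
      refine ⟨D.cls n ⟨_, hz⟩, ?_⟩
      rw [hpt, Hom.h_cls]
      congr 1
      apply Subtype.ext
      simp [s.gf, ht]
    · rintro ⟨y, hy⟩
      obtain ⟨y, rfl⟩ := D.cls_surj n y
      rw [hpt, Hom.h_cls, cls_eq] at hy
      obtain ⟨e', he'⟩ := hy
      obtain ⟨w, rfl⟩ := s.surj n e'
      rw [← g.comm] at he'
      have : g.f (n+1) (t.1.1 - y + D.d n w) = 0 := by
        rw [map_add, map_sub, ht]
        simp only [Hom.z_coe] at he'
        rw [he']; abel
      obtain ⟨c, hc⟩ := (s.exact _ _).1 this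
      refine ⟨c, s.inj _ ?_⟩
      have hy0 : D.d (n+1) (y : D.X (n+1)) = 0 := y.2
      rw [f.comm, hc, map_add, D.dd, add_zero, map_sub, hy0, sub_zero, hT]
  · intro x
    obtain ⟨x, rfl⟩ := C.cls_surj _ x
    rw [Hom.h_cls, cls_eq_zero]
    constructor
    · rintro ⟨y, hy⟩
      let t : T := ⟨(y, x.1), sub_eq_zero.2 hy⟩
      exact ⟨p t, by rw [hδ]; rfl⟩
    · rintro ⟨e, he⟩
      obtain ⟨e, rfl⟩ := E.cls_surj n e
      obtain ⟨t, ht⟩ := lift e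
      have hpt : p t = E.cls n e := congrArg (E.cls n) (Subtype.ext ht)
      rw [← hpt, hδ] at he
      have he' : C.cls (n+1) ⟨t.1.2, hT2 t⟩ = C.cls (n+1) x := he
      rw [cls_eq] at he'
      obtain ⟨c, hc⟩ := he'
      refine ⟨t.1.1 - f.f (n+1) c, ?_⟩
      have hc' : t.1.2 = x.1 + C.d (n+1) c := hc
      rw [map_sub, hT, hc', map_add, f.comm]
      simp

end SES

/-- mapping cone -/
def cone {C D : Cx R} (φ : Hom C D) : Cx R where
  X i := C.X (i+1) × D.X i
  d i := LinearMap.prod (-(C.d (i+1)) ∘ₗ LinearMap.fst R _ _)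
    (φ.f (i+1) ∘ₗ LinearMap.fst R _ _ + D.d i ∘ₗ LinearMap.snd R _ _)
  dd i x := by
    ext
    · simp [C.dd]
    · simp [D.dd, φ.comm]

section cone
variable {C D : Cx R} (φ : Hom C D)

def cfst (i : ℤ) : (cone φ).X i →ₗ[R] C.X (i+1) := LinearMap.fst R (C.X (i+1)) (D.X i)
def csnd (i : ℤ) : (cone φ).X i →ₗ[R] D.X i := LinearMap.snd R (C.X (i+1)) (D.X i)
def cmk (i : ℤ) (c : C.X (i+1)) (e : D.X i) : (cone φ).X i := (c, e)

@[simp] lemma cfst_cmk (i : ℤ) (c : C.X (i+1)) (e : D.X i) : cfst φ i (cmk φ i c e) = c := rfl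
@[simp] lemma csnd_cmk (i : ℤ) (c : C.X (i+1)) (e : D.X i) : csnd φ i (cmk φ i c e) = e := rfl
lemma cext {i : ℤ} {x y : (cone φ).X i} (h1 : cfst φ i x = cfst φ i y)
    (h2 : csnd φ i x = csnd φ i y) : x = y := Prod.ext h1 h2
@[simp] lemma cfst_d (i : ℤ) (x : (cone φ).X i) :
    cfst φ (i+1) ((cone φ).d i x) = -(C.d (i+1) (cfst φ i x)) := rfl
@[simp] lemma csnd_d (i : ℤ) (x : (cone φ).X i) :
    csnd φ (i+1) ((cone φ).d i x) = φ.f (i+1) (cfst φ i x) + D.d i (csnd φ i x) := rfl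

def coneInr : Hom D (cone φ) where
  f i := LinearMap.inr R (C.X (i+1)) (D.X i)
  comm i x := by
    apply cext
    · change (0 : C.X (i+1+1)) = -(C.d (i+1) 0)
      simp
    · change D.d i x = φ.f (i+1) 0 + D.d i x
      simp

@[simp] lemma cfst_inr (i : ℤ) (x : D.X i) : cfst φ i ((coneInr φ).f i x) = 0 := rfl
@[simp] lemma csnd_inr (i : ℤ) (x : D.X i) : csnd φ i ((coneInr φ).f i x) = x := rfl

lemma coneZ1 {n : ℤ} (x : (cone φ).Z n) : cfst φ _ x.1 ∈ C.Z (n+1) := by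
  have := congrArg (cfst φ _) (show (cone φ).d (n+1) x.1 = 0 from x.2)
  rw [cfst_d, map_zero, neg_eq_zero] at this
  exact this

lemma coneZ2 {n : ℤ} (x : (cone φ).Z n) :
    φ.f (n+1+1) (cfst φ _ x.1) + D.d (n+1) (csnd φ _ x.1) = 0 := by
  have := congrArg (csnd φ _) (show (cone φ).d (n+1) x.1 = 0 from x.2)
  rw [csnd_d, map_zero] at this
  exact this

/-- the projection `cone φ ⟶ C[1]` on homology -/
def coneFst (n : ℤ) : (cone φ).h n →ₗ[R] C.h (n+1) :=
  Submodule.mapQ _ _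
    (LinearMap.restrict (cfst φ (n+1)) (fun x hx => coneZ1 φ ⟨x, hx⟩))
    (by
      rintro x ⟨y, hy⟩
      refine ⟨-(cfst φ _ y), ?_⟩
      have := congrArg (cfst φ _) hy
      rw [cfst_d] at this
      rw [map_neg]
      exact this)

lemma coneFst_cls (n : ℤ) (x : (cone φ).Z n) :
    coneFst φ n ((cone φ).cls n x) = C.cls (n+1) ⟨cfst φ _ x.1, coneZ1 φ x⟩ := rfl

lemma cone_exact1 (n : ℤ) : Function.Exact (φ.h n) ((coneInr φ).h n) := by
  intro y
  obtain ⟨y, rfl⟩ := D.cls_surj n y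
  rw [Hom.h_cls, cls_eq_zero]
  constructor
  · rintro ⟨w, hw⟩
    have h1 := congrArg (cfst φ _) hw
    have h2 := congrArg (csnd φ _) hw
    simp only [Hom.z_coe, cfst_d, csnd_d, cfst_inr, csnd_inr, neg_eq_zero] at h1 h2
    refine ⟨C.cls n ⟨_, h1⟩, ?_⟩
    rw [Hom.h_cls, cls_eq]
    refine ⟨-(csnd φ _ w), ?_⟩
    rw [← h2]; simp
  · rintro ⟨x, hx⟩
    obtain ⟨x, rfl⟩ := C.cls_surj n x
    rw [Hom.h_cls, cls_eq] at hx
    obtain ⟨w, hw⟩ := hx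
    simp only [Hom.z_coe] at hw
    refine ⟨cmk φ _ x.1 (-w), ?_⟩
    have h1 : C.d (n+1) x.1 = 0 := x.2
    apply cext
    · simp [h1]
    · simp [hw]

lemma cone_exact2 (n : ℤ) : Function.Exact ((coneInr φ).h n) (coneFst φ n) := by
  intro y
  obtain ⟨y, rfl⟩ := (cone φ).cls_surj n y
  rw [coneFst_cls φ n y, cls_eq_zero]
  constructor
  · rintro ⟨c, hc⟩
    change C.d (n+1) c = cfst φ _ y.1 at hc
    have hz : csnd φ _ y.1 + φ.f (n+1) c ∈ D.Z n := by
      change D.d (n+1) _ = 0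
      have := coneZ2 φ y
      rw [← hc, φ.comm] at this
      rw [map_add, ← this]; exact add_comm _ _
    refine ⟨D.cls n ⟨_, hz⟩, ?_⟩
    rw [Hom.h_cls, cls_eq]
    refine ⟨cmk φ _ c 0, ?_⟩
    apply cext
    · simp [hc]
    · simp
  · rintro ⟨x, hx⟩
    obtain ⟨x, rfl⟩ := D.cls_surj n x
    rw [Hom.h_cls, cls_eq] at hx
    obtain ⟨w, hw⟩ := hx
    have h1 := congrArg (cfst φ _) hw
    simp only [Hom.z_coe, cfst_inr, map_add, cfst_d] at h1
    exact ⟨_, (add_neg_eq_zero.1 h1.symm).symm⟩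

lemma cone_exact3 (n : ℤ) : Function.Exact (coneFst φ n) (φ.h (n+1)) := by
  intro x
  obtain ⟨x, rfl⟩ := C.cls_surj _ x
  rw [Hom.h_cls, cls_eq_zero]
  constructor
  · rintro ⟨y, hy⟩
    simp only [Hom.z_coe] at hy
    have hx0 : C.d (n+1+1) x.1 = 0 := x.2
    have : cmk φ _ x.1 (-y) ∈ (cone φ).Z n := by
      change (cone φ).d (n+1) _ = 0
      apply cext
      · simp [hx0]
      · simp [hy]
    exact ⟨(cone φ).cls n ⟨_, this⟩, coneFst_cls φ n _⟩
  · rintro ⟨y, hy⟩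
    obtain ⟨y, rfl⟩ := (cone φ).cls_surj _ y
    rw [coneFst_cls φ n y, cls_eq] at hy
    obtain ⟨c, hc⟩ := hy
    simp only at hc
    have := coneZ2 φ y
    rw [hc, map_add, φ.comm] at this
    refine ⟨-(csnd φ _ y.1 + φ.f (n+1) c), ?_⟩
    rw [map_neg, map_add]
    simp only [Hom.z_coe]
    have h3 : φ.f (n+1+1) x.1 + (D.d (n+1) (csnd φ _ y.1) + D.d (n+1) (φ.f (n+1) c)) = 0 := by
      rw [← this]; abel
    exact (eq_neg_of_add_eq_zero_left h3).symm

variable {C' D' : Cx R} {φ} {φ' : Hom C' D'}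

def coneMap (a : Hom C C') (b : Hom D D')
    (hab : ∀ i x, φ'.f i (a.f i x) = b.f i (φ.f i x)) : Hom (cone φ) (cone φ') where
  f i := LinearMap.prodMap (a.f (i+1)) (b.f i)
  comm i x := by
    apply cext
    · change a.f _ (-(C.d (i+1) (cfst φ _ x))) = -(C'.d _ (a.f _ (cfst φ _ x)))
      rw [← a.comm, map_neg]
    · change b.f _ (φ.f (i+1) (cfst φ i x) + D.d i (csnd φ i x)) =
        φ'.f _ (a.f _ (cfst φ _ x)) + D'.d _ (b.f _ (csnd φ i x))
      rw [hab, ← b.comm, map_add]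

@[simp] lemma cfst_coneMap (a : Hom C C') (b : Hom D D')
    (hab : ∀ i x, φ'.f i (a.f i x) = b.f i (φ.f i x)) (i : ℤ) (x) :
    cfst φ' i ((coneMap a b hab).f i x) = a.f (i+1) (cfst φ i x) := rfl

@[simp] lemma csnd_coneMap (a : Hom C C') (b : Hom D D')
    (hab : ∀ i x, φ'.f i (a.f i x) = b.f i (φ.f i x)) (i : ℤ) (x) :
    csnd φ' i ((coneMap a b hab).f i x) = b.f i (csnd φ i x) := rfl

lemma coneFst_coneMap (a : Hom C C') (b : Hom D D')
    (hab : ∀ i x, φ'.f i (a.f i x) = b.f i (φ.f i x)) (n : ℤ) (x) :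
    coneFst φ' n ((coneMap a b hab).h n x) = a.h (n+1) (coneFst φ n x) := by
  obtain ⟨x, rfl⟩ := (cone φ).cls_surj _ x
  rfl

end cone

end Cx
end LCoh
end

section
open CategoryTheory
namespace LCoh
variable {R : Type u} [CommRing R]
namespace Cx

noncomputable abbrev lmk (f : R) (M : Type u) [AddCommGroup M] [Module R M] :=
  LocalizedModule.mkLinearMap (Submonoid.powers f) M

noncomputable abbrev lmap (f : R) {M N : Type u} [AddCommGroup M] [Module R M]
    [AddCommGroup N] [Module R N] (g : M →ₗ[R] N) :
    LocalizedModule (Submonoid.powers f) M →ₗ[R] LocalizedModule (Submonoid.powers f) N :=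
  IsLocalizedModule.map (Submonoid.powers f) (lmk f M) (lmk f N) g

lemma lmap_mk (f : R) {M N : Type u} [AddCommGroup M] [Module R M]
    [AddCommGroup N] [Module R N] (g : M →ₗ[R] N) (m : M) (s : Submonoid.powers f) :
    lmap f g (LocalizedModule.mk m s) = LocalizedModule.mk (g m) s :=
  IsLocalizedModule.map_LocalizedModules _ _ _ _

noncomputable def loc (f : R) (C : Cx R) : Cx R where
  X i := LocalizedModule (Submonoid.powers f) (C.X i)
  d i := lmap f (C.d i)
  dd i x := by
    induction x using LocalizedModule.induction_on with
    | h m s => rw [lmap_mk, lmap_mk, C.dd, LocalizedModule.zero_mk]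

def lm {f : R} {C : Cx R} {i : ℤ} (m : C.X i) (s : Submonoid.powers f) : (loc f C).X i :=
  LocalizedModule.mk m s

lemma lm_surj {f : R} {C : Cx R} {i : ℤ} (x : (loc f C).X i) : ∃ (m : C.X i) (s : _), x = lm m s := by
  induction x using LocalizedModule.induction_on with
  | h m s => exact ⟨m, s, rfl⟩

lemma lm_d {f : R} {C : Cx R} {i : ℤ} (m : C.X i) (s : Submonoid.powers f) :
    (loc f C).d i (lm m s) = lm (C.d i m) s := lmap_mk _ _ _ _

lemma lm_eq_zero {f : R} {C : Cx R} {i : ℤ} (m : C.X i) (s : Submonoid.powers f) :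
    (lm m s : (loc f C).X i) = 0 ↔ ∃ t : Submonoid.powers f, t.1 • m = 0 := by
  change LocalizedModule.mk m s = 0 ↔ _
  rw [← LocalizedModule.zero_mk s, LocalizedModule.mk_eq]
  constructor
  · rintro ⟨u, hu⟩
    refine ⟨u * s, ?_⟩
    simpa [Submonoid.smul_def, mul_smul] using hu
  · rintro ⟨t, ht⟩
    refine ⟨t, ?_⟩
    rw [Submonoid.smul_def, Submonoid.smul_def, smul_comm, ht]
    simp

lemma lm_smul {f : R} {C : Cx R} {i : ℤ} (r : R) (m : C.X i) (s : Submonoid.powers f) :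
    r • (lm m s : (loc f C).X i) = lm (r • m) s := LocalizedModule.smul'_mk _ _ _

lemma lm_cancel {f : R} {C : Cx R} {i : ℤ} (m : C.X i) (s t : Submonoid.powers f) :
    (t.1 • lm m (s * t) : (loc f C).X i) = lm m s := by
  rw [lm_smul]
  exact LocalizedModule.mk_cancel_common_right s t m

noncomputable def toLoc (f : R) (C : Cx R) : Hom C (loc f C) where
  f i := lmk f (C.X i)
  comm i x := (lm_d x 1).symm

lemma toLoc_f (f : R) (C : Cx R) (i : ℤ) (x : C.X i) : (toLoc f C).f i x = lm x 1 := rfl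

noncomputable def locMap (f : R) {C D : Cx R} (g : Hom C D) : Hom (loc f C) (loc f D) where
  f i := lmap f (g.f i)
  comm i x := by
    obtain ⟨m, s, rfl⟩ := lm_surj x
    rw [lm_d]
    change lmap f _ (LocalizedModule.mk _ _) = (loc f D).d i (lmap f _ (LocalizedModule.mk _ _))
    rw [lmap_mk, lmap_mk]
    change _ = (loc f D).d i (lm _ _)
    rw [lm_d, g.comm]; rfl

lemma locMap_lm (f : R) {C D : Cx R} (g : Hom C D) {i : ℤ} (m : C.X i) (s : Submonoid.powers f) :
    (locMap f g).f i (lm m s) = lm (g.f i m) s := lmap_mk _ _ _ _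

def smulHom (r : R) (C : Cx R) : Hom C C where
  f i := r • LinearMap.id
  comm i x := by simp

lemma smulHom_h (r : R) (C : Cx R) (n : ℤ) (x : C.h n) : (smulHom r C).h n x = r • x := by
  obtain ⟨x, rfl⟩ := C.cls_surj n x
  rw [Hom.h_cls, ← map_smul]; rfl

noncomputable def divHom {f : R} (C : Cx R) (s : Submonoid.powers f) : Hom (loc f C) (loc f C) where
  f i := LocalizedModule.divBy s
  comm i x := by
    obtain ⟨m, t, rfl⟩ := lm_surj x
    have : ∀ (j) (y : C.X j), LocalizedModule.divBy s (lm y t : (loc f C).X j) = (lm y (t * s) : (loc f C).X j) :=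
      fun _ _ => rfl
    rw [lm_d]
    exact (lm_d _ _).symm

instance locH (f : R) (C : Cx R) (n : ℤ) :
    IsLocalizedModule (Submonoid.powers f) ((toLoc f C).h n) where
  map_units s := by
    rw [Module.End.isUnit_iff]
    constructor
    · intro x y hxy
      change s.1 • x = s.1 • y at hxy
      have key : ∀ z, (divHom C s).h n (s.1 • z) = z := by
        intro z
        obtain ⟨z, rfl⟩ := cls_surj _ _ z
        rw [← map_smul, Hom.h_cls]
        congr 1
        apply Subtype.ext
        exact LocalizedModule.divBy_mul_by s _
      rw [← key x, hxy, key]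
    · intro z
      refine ⟨(divHom C s).h n z, ?_⟩
      change s.1 • _ = z
      obtain ⟨z, rfl⟩ := cls_surj _ _ z
      rw [Hom.h_cls, ← map_smul]
      refine congrArg (cls (loc f C) n) (Subtype.ext ?_)
      exact LocalizedModule.mul_by_divBy s _
  surj z := by
    obtain ⟨⟨z, hz⟩, rfl⟩ := cls_surj _ _ z
    obtain ⟨m, s, rfl⟩ := lm_surj z
    have hz' : (loc f C).d (n+1) (lm m s) = 0 := hz
    rw [lm_d, lm_eq_zero] at hz'
    obtain ⟨t, ht⟩ := hz'
    have hm : t.1 • m ∈ C.Z n := by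
      change C.d (n+1) _ = 0
      rw [map_smul, ht]
    refine ⟨(C.cls n ⟨_, hm⟩, t * s), ?_⟩
    rw [Hom.h_cls, Submonoid.smul_def, ← map_smul]
    congr 1
    apply Subtype.ext
    change (t * s).1 • lm m s = lm (t.1 • m) 1
    rw [Submonoid.coe_mul, mul_smul, ← lm_smul]
    congr 1
    have := lm_cancel (C := C) m 1 s
    rwa [one_mul] at this
  exists_of_eq {x y} hxy := by
    rw [← sub_eq_zero, ← map_sub] at hxy
    suffices ∃ c : Submonoid.powers f, c • (x - y) = 0 by
      obtain ⟨c, hc⟩ := this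
      exact ⟨c, by rw [smul_sub, sub_eq_zero] at hc; exact hc⟩
    generalize x - y = z at hxy
    obtain ⟨z, rfl⟩ := cls_surj _ _ z
    rw [Hom.h_cls, cls_eq_zero] at hxy
    obtain ⟨w, hw⟩ := hxy
    obtain ⟨m, s, rfl⟩ := lm_surj w
    have hw' : (loc f C).d n (lm m s) = lm z.1 1 := hw
    have h2 : lm (C.d n m - s.1 • z.1) 1 = (0 : (loc f C).X (n+1)) := by
      have := congrArg (fun v => s.1 • v) hw'
      simp only [lm_d] at this
      have h3 := lm_cancel (f := f) (C.d n m) 1 s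
      rw [one_mul] at h3
      rw [h3, lm_smul] at this
      have h4 : (lm (C.d n m - s.1 • z.1) 1 : (loc f C).X (n+1)) = lm (C.d n m) 1 - lm (s.1 • z.1) 1 :=
        map_sub (lmk f (C.X (n+1))) _ _
      rw [h4, this, sub_self]
    rw [lm_eq_zero] at h2
    obtain ⟨t, ht⟩ := h2
    refine ⟨t * s, ?_⟩
    rw [Submonoid.smul_def, ← map_smul, cls_eq_zero]
    refine ⟨t.1 • m, ?_⟩
    rw [smul_sub, sub_eq_zero] at ht
    rw [map_smul, ht]
    simp [mul_smul]

lemma SES.loc {C D E : Cx R} {a : Hom C D} {b : Hom D E} (s : SES a b) (f : R) :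
    SES (locMap f a) (locMap f b) := by
  constructor
  · exact fun i => IsLocalizedModule.map_injective (Submonoid.powers f) (lmk f _) (lmk f _) _ (s.inj i)
  · exact fun i => IsLocalizedModule.map_exact (Submonoid.powers f) (lmk f _) (lmk f _) (lmk f _) _ _ (s.exact i)
  · exact fun i => IsLocalizedModule.map_surjective (Submonoid.powers f) (lmk f _) (lmk f _) _ (s.surj i)

lemma SES.cone {C D E C' D' E' : Cx R} {a : Hom C D} {b : Hom D E} (s : SES a b)
    {a' : Hom C' D'} {b' : Hom D' E'} (s' : SES a' b') {φ : Hom C C'} {ψ : Hom D D'} {χ : Hom E E'}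
    (h1 : ∀ i x, ψ.f i (a.f i x) = a'.f i (φ.f i x))
    (h2 : ∀ i x, χ.f i (b.f i x) = b'.f i (ψ.f i x)) :
    SES (coneMap a a' h1) (coneMap b b' h2) where
  inj i x y hxy := by
    apply cext
    · apply s.inj
      exact congrArg (cfst _ _) hxy
    · apply s'.inj
      exact congrArg (csnd _ _) hxy
  exact i y := by
    constructor
    · intro hy
      have e1 : b.f (i+1) (cfst _ _ y) = 0 := by rw [← cfst_coneMap b b' h2, hy, map_zero]
      have e2 : b'.f i (csnd _ _ y) = 0 := by rw [← csnd_coneMap b b' h2, hy, map_zero]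
      obtain ⟨c, hc⟩ := (s.exact _ _).1 e1
      obtain ⟨e, he⟩ := (s'.exact _ _).1 e2
      refine ⟨cmk _ _ c e, cext _ ?_ ?_⟩
      · simp [hc]
      · simp [he]
    · rintro ⟨x, rfl⟩
      apply cext
      · simp [s.gf]
      · simp [s'.gf]
  surj i y := by
    obtain ⟨c, hc⟩ := s.surj _ (cfst _ _ y)
    obtain ⟨e, he⟩ := s'.surj _ (csnd _ _ y)
    exact ⟨cmk _ _ c e, cext _ (by simp [hc]) (by simp [he])⟩

/-- module in degree zero -/
noncomputable def base (M : Type u) [AddCommGroup M] [Module R M] : Cx R where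
  X i := (if i = 0 then ⊤ else ⊥ : Submodule R M)
  d i := 0
  dd i x := rfl

noncomputable def bval {M : Type u} [AddCommGroup M] [Module R M] (i : ℤ) :
    (base (R := R) M).X i →ₗ[R] M :=
  Submodule.subtype (if i = 0 then ⊤ else ⊥ : Submodule R M)

lemma bval_inj {M : Type u} [AddCommGroup M] [Module R M] {i : ℤ} {x y : (base (R := R) M).X i}
    (h : bval i x = bval i y) : x = y := Subtype.ext h

lemma bval_zero {M : Type u} [AddCommGroup M] [Module R M] {i : ℤ} (hi : i ≠ 0)
    (x : (base (R := R) M).X i) : x = 0 := by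
  have h : (bval i x) ∈ (if i = 0 then ⊤ else ⊥ : Submodule R M) := x.2
  rw [if_neg hi, Submodule.mem_bot] at h
  exact bval_inj (by rw [h, map_zero])

lemma bval_surj {M : Type u} [AddCommGroup M] [Module R M] {i : ℤ} (hi : i = 0) (m : M) :
    ∃ x : (base (R := R) M).X i, bval i x = m := ⟨⟨m, by rw [if_pos hi]; trivial⟩, rfl⟩

noncomputable def baseMap {M N : Type u} [AddCommGroup M] [Module R M] [AddCommGroup N] [Module R N]
    (g : M →ₗ[R] N) : Hom (base M (R := R)) (base N) where
  f i := LinearMap.restrict g (p := (if i = 0 then ⊤ else ⊥ : Submodule R M))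
    (q := (if i = 0 then ⊤ else ⊥ : Submodule R N)) (by
      intro x hx
      split_ifs at hx ⊢
      · trivial
      · rw [Submodule.mem_bot] at hx ⊢; rw [hx, map_zero])
  comm i x := map_zero _

lemma bval_map {M N : Type u} [AddCommGroup M] [Module R M] [AddCommGroup N] [Module R N]
    (g : M →ₗ[R] N) (i : ℤ) (x : (base (R := R) M).X i) :
    bval i ((baseMap g).f i x) = g (bval i x) := rfl

lemma base_ses {M N P : Type u} [AddCommGroup M] [Module R M] [AddCommGroup N] [Module R N]
    [AddCommGroup P] [Module R P] {a : M →ₗ[R] N} {b : N →ₗ[R] P} (ha : Function.Injective a)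
    (hab : Function.Exact a b) (hb : Function.Surjective b) : SES (baseMap a) (baseMap b) where
  inj i x y hxy := bval_inj (ha (by rw [← bval_map, hxy, bval_map]))
  exact i y := by
    constructor
    · intro hy
      by_cases hi : i = 0
      · obtain ⟨x, hx⟩ := (hab (bval i y)).1 (by rw [← bval_map, hy, map_zero])
        obtain ⟨x, rfl⟩ := bval_surj (R := R) hi x
        exact ⟨x, bval_inj (by rw [bval_map, hx])⟩
      · exact ⟨0, by rw [bval_zero hi y, map_zero]⟩
    · rintro ⟨x, rfl⟩
      exact bval_inj (by rw [bval_map, bval_map, hab.apply_apply_eq_zero, map_zero])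
  surj i y := by
    by_cases h : i = 0
    · obtain ⟨x, hx⟩ := hb (bval i y)
      obtain ⟨x, rfl⟩ := bval_surj (R := R) h x
      exact ⟨x, bval_inj (by rw [bval_map, hx])⟩
    · exact ⟨0, by rw [bval_zero h y, map_zero]⟩

/-- The Čech complex. -/
noncomputable def cech : List R → (M : Type u) → [AddCommGroup M] → [Module R M] → Cx R
  | [], M, _, _ => base M
  | f :: l, M, _, _ => cone (toLoc f (cech l M))

noncomputable def cechMap : (l : List R) → {M N : Type u} → [AddCommGroup M] → [Module R M] →
    [AddCommGroup N] → [Module R N] → (M →ₗ[R] N) → Hom (cech l M) (cech l N)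
  | [], _, _, _, _, _, _, g => baseMap g
  | f :: l, _, _, _, _, _, _, g => coneMap (cechMap l g) (locMap f (cechMap l g))
      (fun i x => (locMap_lm f (cechMap l g) x 1).symm)

variable {M N P : Type u} [AddCommGroup M] [Module R M] [AddCommGroup N] [Module R N]
    [AddCommGroup P] [Module R P]

lemma cech_ses (l : List R) {a : M →ₗ[R] N} {b : N →ₗ[R] P} (ha : Function.Injective a)
    (hab : Function.Exact a b) (hb : Function.Surjective b) : SES (cechMap l a) (cechMap l b) := by
  induction l with
  | nil => exact base_ses ha hab hb
  | cons f l ih => exact SES.cone ih (ih.loc f) _ _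

lemma cechMap_id (l : List R) (i : ℤ) (x) :
    (cechMap l (LinearMap.id : M →ₗ[R] M)).f i x = x := by
  induction l generalizing i with
  | nil => rfl
  | cons f l ih =>
    refine cext (toLoc f (cech l M)) (ih _ _) ?_
    change (locMap f _).f i (csnd (toLoc f (cech l M)) i x) = _
    obtain ⟨m, s, hs⟩ := lm_surj (csnd (toLoc f (cech l M)) i x)
    rw [hs, locMap_lm, ih]

lemma cechMap_comp (l : List R) (g : N →ₗ[R] P) (k : M →ₗ[R] N) (i : ℤ) (x) :
    (cechMap l (g ∘ₗ k)).f i x = (cechMap l g).f i ((cechMap l k).f i x) := by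
  induction l generalizing i with
  | nil => rfl
  | cons f l ih =>
    refine cext (toLoc f (cech l P)) (ih _ _) ?_
    change (locMap f _).f i (csnd (toLoc f (cech l M)) i x) =
      (locMap f _).f i ((locMap f _).f i (csnd (toLoc f (cech l M)) i x))
    obtain ⟨m, s, hs⟩ := lm_surj (csnd (toLoc f (cech l M)) i x)
    rw [hs, locMap_lm, locMap_lm, locMap_lm, ih]

lemma cechMap_smul (l : List R) (r : R) (i : ℤ) (x) :
    (cechMap l (r • LinearMap.id : M →ₗ[R] M)).f i x = r • x := by
  induction l generalizing i with
  | nil => rfl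
  | cons f l ih =>
    refine cext (toLoc f (cech l M)) (ih _ _) ?_
    change (locMap f _).f i (csnd (toLoc f (cech l M)) i x) = r • (csnd (toLoc f (cech l M)) i x)
    obtain ⟨m, s, hs⟩ := lm_surj (csnd (toLoc f (cech l M)) i x)
    rw [hs, locMap_lm, ih, lm_smul]

end Cx

open Cx

/-- Čech cohomology, `i`-th -/
def H (l : List R) (i : ℤ) (M : Type u) [AddCommGroup M] [Module R M] : Type u :=
  (cech l M).h (i - l.length - 1)

section
variable (l : List R) (i : ℤ) {M N P : Type u} [AddCommGroup M] [Module R M] [AddCommGroup N]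
  [Module R N] [AddCommGroup P] [Module R P]

noncomputable instance : AddCommGroup (H l i M) := inferInstanceAs (AddCommGroup ((cech l M).h (i - l.length - 1)))
noncomputable instance : Module R (H l i M) := inferInstanceAs (Module R ((cech l M).h (i - l.length - 1)))

noncomputable def H.map (g : M →ₗ[R] N) : H l i M →ₗ[R] H l i N :=
  (cechMap l g).h (i - l.length - 1)

lemma H.map_id_apply (x : H l i M) : H.map l i LinearMap.id x = x := by
  obtain ⟨x, rfl⟩ := cls_surj _ _ x
  exact congrArg (cls _ _) (Subtype.ext (cechMap_id l _ _))

lemma H.map_comp_apply (g : N →ₗ[R] P) (k : M →ₗ[R] N) (x : H l i M) :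
    H.map l i (g ∘ₗ k) x = H.map l i g (H.map l i k x) := by
  obtain ⟨x, rfl⟩ := cls_surj _ _ x
  exact congrArg (cls _ _) (Subtype.ext (cechMap_comp l _ _ _ _))

lemma H.map_smul_id (r : R) (x : H l i M) : H.map l i (r • LinearMap.id) x = r • x := by
  obtain ⟨x, rfl⟩ := cls_surj _ _ x
  exact congrArg (cls _ _) (Subtype.ext (cechMap_smul l _ _ _))

theorem H.exact_mid {a : M →ₗ[R] N} {b : N →ₗ[R] P} (ha : Function.Injective a)
    (hab : Function.Exact a b) (hb : Function.Surjective b) :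
    Function.Exact (H.map l i a) (H.map l i b) := (cech_ses l ha hab hb).exact_mid _

theorem Cx.SES.exists_delta' {C D E : Cx R} {f : Hom C D} {g : Hom D E} (s : SES f g) (n m : ℤ)
    (h : m = n + 1) : ∃ δ : E.h n →ₗ[R] C.h m,
    Function.Exact (g.h n) δ ∧ Function.Exact δ (f.h m) := by
  subst h; exact s.exists_delta n

theorem H.exists_delta {a : M →ₗ[R] N} {b : N →ₗ[R] P} (ha : Function.Injective a)
    (hab : Function.Exact a b) (hb : Function.Surjective b) (j : ℤ) (hj : j = i + 1) :
    ∃ δ : H l i P →ₗ[R] H l j M,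
      Function.Exact (H.map l i b) δ ∧ Function.Exact δ (H.map l j a) :=
  (cech_ses l ha hab hb).exists_delta' _ _ (by lia)

theorem exists_loc_aux (f : R) (C : Cx R) (n m k : ℤ) (hm : m = n + 1) (hk : k = n) :
    ∃ (L : Type u) (_ : AddCommGroup L) (_ : Module R L) (ι : C.h n →ₗ[R] L)
      (δ : L →ₗ[R] (cone (toLoc f C)).h k) (a : (cone (toLoc f C)).h k →ₗ[R] C.h m),
      IsLocalizedModule (Submonoid.powers f) ι ∧ Function.Exact ι δ ∧ Function.Exact δ a ∧
      (∀ z : C.h m, z ∈ LinearMap.range a ↔ ∃ k : ℕ, f ^ k • z = 0) := by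
  subst hm; subst hk
  refine ⟨_, _, _, (toLoc f C).h k, (coneInr (toLoc f C)).h k,
    coneFst (toLoc f C) k, inferInstance, cone_exact1 _ _, cone_exact2 _ _, fun z => ?_⟩
  rw [LinearMap.mem_range, ← Set.mem_range, ← cone_exact3, 
    IsLocalizedModule.eq_zero_iff (Submonoid.powers f)]
  constructor
  · rintro ⟨⟨_, n, rfl⟩, hc⟩; exact ⟨n, hc⟩
  · rintro ⟨n, hc⟩; exact ⟨⟨_, n, rfl⟩, hc⟩

/-- the four-term sequence -/
theorem H.exists_loc (f : R) (j : ℤ) (hj : j = i + 1) :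
    ∃ (L : Type u) (_ : AddCommGroup L) (_ : Module R L) (ι : H l i M →ₗ[R] L)
      (δ : L →ₗ[R] H (f :: l) j M) (a : H (f :: l) j M →ₗ[R] H l j M),
      IsLocalizedModule (Submonoid.powers f) ι ∧ Function.Exact ι δ ∧ Function.Exact δ a ∧
      (∀ z : H l j M, z ∈ LinearMap.range a ↔ ∃ k : ℕ, f ^ k • z = 0) :=
  exists_loc_aux f (cech l M) (i - l.length - 1) (j - l.length - 1) (j - (f :: l).length - 1)
    (by lia) (by simp; lia)

theorem exists_a_aux (f : R) (n m k : ℤ) (hm : m = k + 1) (hk : n = k) :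
    ∃ (a : ∀ (M : Type u) [AddCommGroup M] [Module R M],
      (cech (f :: l) M).h k →ₗ[R] (cech l M).h m),
    ∀ (M N : Type u) [AddCommGroup M] [Module R M] [AddCommGroup N] [Module R N] (g : M →ₗ[R] N),
      (∀ x, a N ((cechMap (f :: l) g).h k x) = (cechMap l g).h m (a M x)) ∧
      (∀ z : (cech l M).h m, z ∈ LinearMap.range (a M) ↔ ∃ k : ℕ, f ^ k • z = 0) ∧
      (Subsingleton ((cech l M).h n) → Function.Injective (a M)) := by
  subst hm; subst hk
  refine ⟨fun M _ _ => coneFst (toLoc f (cech l M)) n, fun M N _ _ _ _ g => ⟨fun x => ?_, ?_, ?_⟩⟩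
  · exact coneFst_coneMap _ _ _ _ _
  · intro z
    change z ∈ LinearMap.range (coneFst (toLoc f (cech l M)) n) ↔ _
    rw [LinearMap.mem_range, ← Set.mem_range, ← cone_exact3, 
      IsLocalizedModule.eq_zero_iff (Submonoid.powers f)]
    constructor
    · rintro ⟨⟨_, n, rfl⟩, hc⟩; exact ⟨n, hc⟩
    · rintro ⟨n, hc⟩; exact ⟨⟨_, n, rfl⟩, hc⟩
  · intro hs
    refine (injective_iff_map_eq_zero _).2 fun x hx => ?_
    obtain ⟨y, rfl⟩ := (cone_exact2 _ _ _).1 hx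
    obtain ⟨⟨m, s⟩, hm⟩ := IsLocalizedModule.surj (Submonoid.powers f) ((toLoc f (cech l M)).h n) y
    have : y = 0 := by
      have h0 : m = 0 := Subsingleton.elim _ _
      simp only [h0, map_zero] at hm
      have := (Module.End.isUnit_iff _).1
        (IsLocalizedModule.map_units (S := Submonoid.powers f) ((toLoc f (cech l M)).h n) s)
      exact this.1 (by rw [map_zero]; exact hm)
    rw [this]; exact map_zero _

/-- natural version of `a` -/
theorem H.exists_a (f : R) : ∃ (a : ∀ (M : Type u) [AddCommGroup M] [Module R M],
      H (f :: l) i M →ₗ[R] H l i M),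
    ∀ (M N : Type u) [AddCommGroup M] [Module R M] [AddCommGroup N] [Module R N] (g : M →ₗ[R] N),
      (∀ x, a N (H.map _ _ g x) = H.map _ _ g (a M x)) ∧
      (∀ z : H l i M, z ∈ LinearMap.range (a M) ↔ ∃ k : ℕ, f ^ k • z = 0) ∧
      (Subsingleton (H l (i - 1) M) → Function.Injective (a M)) :=
  exists_a_aux l f (i - 1 - l.length - 1) (i - l.length - 1) (i - (f :: l).length - 1)
    (by simp; lia) (by simp; lia)

lemma H.nil_subsingleton (hi : i ≠ 0) : Subsingleton (H ([] : List R) i M) := by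
  refine ⟨fun x y => ?_⟩
  suffices ∀ x : H ([] : List R) i M, x = 0 by rw [this x, this y]
  intro x
  obtain ⟨x, rfl⟩ := cls_surj _ _ x
  have : x = 0 := by
    apply Subtype.ext
    exact bval_zero (by simpa using hi) _
  rw [this]; exact map_zero _

noncomputable def bH (M : Type u) [AddCommGroup M] [Module R M] (n : ℤ) :
    (base (R := R) M).h n →ₗ[R] M :=
  Submodule.liftQ _ (bval (n+1) ∘ₗ Submodule.subtype _) (by
    rintro x ⟨y, hy⟩
    have : (0 : (base M (R := R)).X _) = x.1 := hy
    change bval _ x.1 = 0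
    rw [← this, map_zero])

theorem H.nil_zero : ∃ (e : ∀ (M : Type u) [AddCommGroup M] [Module R M],
      H ([] : List R) 0 M →ₗ[R] M),
    ∀ (M N : Type u) [AddCommGroup M] [Module R M] [AddCommGroup N] [Module R N] (g : M →ₗ[R] N),
      (∀ x, e N (H.map _ _ g x) = g (e M x)) ∧ Function.Bijective (e M) := by
  refine ⟨fun M _ _ => bH M _, fun M N _ _ _ _ g => ⟨?_, ?_, ?_⟩⟩
  · intro x
    obtain ⟨x, rfl⟩ := cls_surj _ _ x
    rfl
  · refine (injective_iff_map_eq_zero (bH (R := R) M _)).2 fun x hx => ?_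
    obtain ⟨x, rfl⟩ := cls_surj _ _ x
    have : x = 0 := Subtype.ext (bval_inj (hx.trans (map_zero _).symm))
    rw [this]; exact map_zero _
  · intro m
    obtain ⟨x, hx⟩ := bval_surj (R := R) (M := M) (i := 0 - (([] : List R).length : ℤ) - 1 + 1) (by simp) m
    exact ⟨cls (base M) _ ⟨x, rfl⟩, hx⟩

end
end LCoh
end

section
open CategoryTheory
namespace LCoh
open Cx
section
variable {R : Type u} [CommRing R] (l : List R) (i : ℤ) {M N P : Type u} [AddCommGroup M] [Module R M]
  [AddCommGroup N] [Module R N] [AddCommGroup P] [Module R P]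

lemma locunit {f : R} {A L : Type u} [AddCommGroup A] [Module R A] [AddCommGroup L] [Module R L]
    (ι : A →ₗ[R] L) [IsLocalizedModule (Submonoid.powers f) ι] (n : ℕ) :
    Function.Bijective (fun y : L => f ^ n • y) :=
  (Module.End.isUnit_iff _).1
    (IsLocalizedModule.map_units (S := Submonoid.powers f) ι ⟨_, n, rfl⟩)

lemma locsurj {f : R} {A L : Type u} [AddCommGroup A] [Module R A] [AddCommGroup L] [Module R L]
    (ι : A →ₗ[R] L) [IsLocalizedModule (Submonoid.powers f) ι] (y : L) :
    ∃ (n : ℕ) (a : A), f ^ n • y = ι a := by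
  obtain ⟨⟨m, ⟨_, n, rfl⟩⟩, hm⟩ := IsLocalizedModule.surj (Submonoid.powers f) ι y
  exact ⟨n, m, hm⟩

lemma lockern {f : R} {A L : Type u} [AddCommGroup A] [Module R A] [AddCommGroup L] [Module R L]
    (ι : A →ₗ[R] L) [IsLocalizedModule (Submonoid.powers f) ι] (a : A) :
    ι a = 0 ↔ ∃ n : ℕ, f ^ n • a = 0 := by
  rw [IsLocalizedModule.eq_zero_iff (Submonoid.powers f)]
  constructor
  · rintro ⟨⟨_, n, rfl⟩, hc⟩; exact ⟨n, hc⟩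
  · rintro ⟨n, hc⟩; exact ⟨⟨_, n, rfl⟩, hc⟩

/-- torsion -/
theorem H.tors (x : R) (hx : x ∈ l) (z : H l i M) : ∃ k : ℕ, x ^ k • z = 0 := by
  induction l generalizing i with
  | nil => simp at hx
  | cons f l ih =>
    obtain ⟨L, _, _, ι, δ, a, hι, h1, h2, h3⟩ := H.exists_loc l (i - 1) (M := M) f i (by lia)
    obtain ⟨k, hk⟩ : ∃ k : ℕ, x ^ k • a z = 0 := by
      rcases List.mem_cons.1 hx with rfl | hx
      · exact (h3 _).1 ⟨z, rfl⟩
      · exact ih _ hx _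
    rw [← map_smul] at hk
    obtain ⟨w, hw⟩ := (h2 _).1 hk
    obtain ⟨n, v, hv⟩ := locsurj (f := f) ι w
    rcases List.mem_cons.1 hx with rfl | hx
    · refine ⟨n + k, ?_⟩
      rw [pow_add, mul_smul, ← hw, ← map_smul, hv]
      exact h1.apply_apply_eq_zero v
    · obtain ⟨t, ht⟩ := ih _ hx v
      have : x ^ t • w = 0 := by
        apply (locunit (f := f) ι n).1
        simp only [smul_zero]
        rw [smul_comm, hv, ← map_smul, ht, map_zero]
      refine ⟨t + k, ?_⟩
      rw [pow_add, mul_smul, ← hw, ← map_smul, this, map_zero]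

lemma loc_sub {f : R} {A L : Type u} [AddCommGroup A] [Module R A] [AddCommGroup L] [Module R L]
    (ι : A →ₗ[R] L) [IsLocalizedModule (Submonoid.powers f) ι]
    (h : ∀ a : A, ∃ n : ℕ, f ^ n • a = 0) (y : L) : y = 0 := by
  obtain ⟨n, v, hv⟩ := locsurj (f := f) ι y
  apply (locunit (f := f) ι n).1
  simp only [smul_zero]
  rw [hv]; exact (lockern (f := f) ι v).2 (h v)

theorem H.neg (hi : i < 0) (z : H l i M) : z = 0 := by
  induction l generalizing i with
  | nil => exact (H.nil_subsingleton (M := M) i (by lia)).elim _ _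
  | cons f l ih =>
    obtain ⟨L, _, _, ι, δ, a, hι, h1, h2, h3⟩ := H.exists_loc l (i - 1) (M := M) f i (by lia)
    obtain ⟨w, hw⟩ := (h2 _).1 (ih i hi (a z))
    rw [← hw, loc_sub (f := f) ι (fun a => ⟨0, by rw [ih _ (by lia) a]; simp⟩) w, map_zero]

/-- degree zero -/
theorem H.zero : ∃ (e : ∀ (M : Type u) [AddCommGroup M] [Module R M],
      H l 0 M →ₗ[R] M),
    ∀ (M N : Type u) [AddCommGroup M] [Module R M] [AddCommGroup N] [Module R N] (g : M →ₗ[R] N),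
      (∀ x, e N (H.map _ _ g x) = g (e M x)) ∧ Function.Injective (e M) ∧
      ∀ m : M, m ∈ LinearMap.range (e M) ↔ ∀ x ∈ l, ∃ k : ℕ, x ^ k • m = 0 := by
  induction l with
  | nil =>
    obtain ⟨e, he⟩ := H.nil_zero (R := R)
    refine ⟨e, fun M N _ _ _ _ g => ⟨(he M N g).1, (he M N g).2.1, fun m => ?_⟩⟩
    simpa using (he M N g).2.2 m
  | cons f l ih =>
    obtain ⟨e, he⟩ := ih
    obtain ⟨a, ha⟩ := H.exists_a l 0 f
    refine ⟨fun M _ _ => e M ∘ₗ a M, fun M N _ _ _ _ g => ⟨fun x => ?_, ?_, fun m => ?_⟩⟩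
    · simp [(ha M N g).1, (he M N g).1]
    · exact (he M N g).2.1.comp ((ha M N g).2.2
        ⟨fun x y => by rw [H.neg l _ (by lia) x, H.neg l _ (by lia) y]⟩)
    · constructor
      · rintro ⟨x, rfl⟩ y hy
        rcases List.mem_cons.1 hy with rfl | hy
        · obtain ⟨k, hk⟩ := ((ha M N g).2.1 _).1 ⟨x, rfl⟩
          exact ⟨k, by simp [-map_smul]; rw [← map_smul, hk, map_zero]⟩
        · exact ((he M N g).2.2 _).1 ⟨a M x, rfl⟩ y hy
      · intro h
        obtain ⟨y, rfl⟩ := ((he M N g).2.2 _).2 fun x hx => h x (List.mem_cons_of_mem _ hx)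
        obtain ⟨k, hk⟩ := h f (by simp)
        rw [← map_smul] at hk
        have hk := (he M N g).2.1 (hk.trans (map_zero _).symm)
        obtain ⟨x, rfl⟩ := ((ha M N g).2.1 _).2 ⟨k, hk⟩
        exact ⟨x, rfl⟩

lemma H.smul_zero_of (s : R) (h : ∀ m : M, s • m = 0) (z : H l i M) : s • z = 0 := by
  rw [← H.map_smul_id]
  have : (s • LinearMap.id : M →ₗ[R] M) = (0 : R) • LinearMap.id := by
    ext m; simpa using h m
  rw [this, H.map_smul_id, zero_smul]

theorem H.zero_tors (l : List R) (f : R) (h : ∀ m : M, ∃ k : ℕ, f ^ k • m = 0) (z : H l 0 M) :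
    ∃ k : ℕ, f ^ k • z = 0 := by
  obtain ⟨e, he⟩ := H.zero (R := R) l
  obtain ⟨k, hk⟩ := h (e M z)
  exact ⟨k, (he M M .id).2.1 (by rw [map_smul, hk, map_zero])⟩

theorem H.of_tors (hi : i ≠ 0) (h : ∀ m : M, ∀ x ∈ l, ∃ k : ℕ, x ^ k • m = 0) (z : H l i M) :
    z = 0 := by
  induction l generalizing i with
  | nil => exact (H.nil_subsingleton (M := M) i hi).elim _ _
  | cons f l ih =>
    obtain ⟨L, _, _, ι, δ, a, hι, h1, h2, h3⟩ := H.exists_loc l (i - 1) (M := M) f i (by lia)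
    obtain ⟨w, hw⟩ := (h2 _).1 (ih i hi (fun m x hx => h m x (by simp [hx])) (a z))
    rw [← hw, loc_sub (f := f) ι (fun a => ?_) w, map_zero]
    by_cases h0 : i - 1 = 0
    · obtain rfl : i = 1 := by lia
      exact H.zero_tors l f (fun m => h m f (by simp)) a
    · exact ⟨0, by rw [ih _ h0 (fun m x hx => h m x (by simp [hx])) a]; simp⟩

theorem H.congr (e : M ≃ₗ[R] N) : ∃ e' : H l i M ≃ₗ[R] H l i N, ∀ x, e' x = H.map l i e.toLinearMap x := by
  refine ⟨LinearEquiv.ofLinearMap (H.map l i e.toLinearMap) (H.map l i e.symm.toLinearMap) ?_ ?_, fun x => rfl⟩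
  · ext x
    simp only [LinearMap.comp_apply, LinearMap.id_apply]
    rw [← H.map_comp_apply]; simp [H.map_id_apply]
  · ext x
    simp only [LinearMap.comp_apply, LinearMap.id_apply]
    rw [← H.map_comp_apply]; simp [H.map_id_apply]

lemma H.of_sub [Subsingleton M] (z : H l i M) : z = 0 := by
  rw [← one_smul R z]; exact H.smul_zero_of l i 1 (fun m => Subsingleton.elim _ _) z

lemma H.map_surj {a : M →ₗ[R] N} {b : N →ₗ[R] P} (ha : Function.Injective a)
    (hab : Function.Exact a b) (hb : Function.Surjective b) (j : ℤ) (hj : j = i + 1)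
    (h : ∀ z : H l j M, z = 0) : Function.Surjective (H.map l i b) := by
  obtain ⟨δ, h1, h2⟩ := H.exists_delta l i ha hab hb j hj
  intro z
  exact (h1 z).1 (h _)

lemma H.map_inj {a : M →ₗ[R] N} {b : N →ₗ[R] P} (ha : Function.Injective a)
    (hab : Function.Exact a b) (hb : Function.Surjective b)
    (h : ∀ z : H l i M, z = 0) : Function.Injective (H.map l i b) := by
  refine (injective_iff_map_eq_zero _).2 fun z hz => ?_
  obtain ⟨w, rfl⟩ := (H.exact_mid l i ha hab hb z).1 hz
  rw [h w, map_zero]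

lemma H.mid_zero {a : M →ₗ[R] N} {b : N →ₗ[R] P} (ha : Function.Injective a)
    (hab : Function.Exact a b) (hb : Function.Surjective b)
    (h : ∀ z : H l i M, z = 0) (h' : ∀ z : H l i P, z = 0) (z : H l i N) : z = 0 :=
  H.map_inj l i ha hab hb h ((h' _).trans (h' _).symm)

/-- multiplication by a regular element -/
theorem H.mul_delta (x : R) (hx : ∀ m : M, x • m = 0 → m = 0) (j : ℤ) (hj : j = i + 1)
    (K : Submodule R M) (hK : ∀ m, m ∈ K ↔ ∃ m', m = x • m') :
    ∃ δ : H l i (M ⧸ K) →ₗ[R] H l j M,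
      Function.Exact (H.map l i K.mkQ) δ ∧ (∀ z, z ∈ LinearMap.range δ ↔ x • z = 0) ∧
      (∀ z : H l i M, H.map l i K.mkQ z = 0 ↔ ∃ w, z = x • w) := by
  have hi : Function.Injective (x • LinearMap.id : M →ₗ[R] M) :=
    (injective_iff_map_eq_zero _).2 fun m hm => hx m (by simpa using hm)
  have he : Function.Exact (x • LinearMap.id : M →ₗ[R] M) K.mkQ := by
    intro m
    rw [Submodule.mkQ_apply, Submodule.Quotient.mk_eq_zero, hK]
    simp [eq_comm]
  obtain ⟨δ, h1, h2⟩ := H.exists_delta l i hi he K.mkQ_surjective j hj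
  refine ⟨δ, h1, fun z => ?_, fun z => ?_⟩
  · rw [LinearMap.mem_range, ← Set.mem_range, ← h2 z, H.map_smul_id]
  · rw [H.exact_mid l i hi he K.mkQ_surjective z]
    simp [H.map_smul_id, eq_comm]

/-- killing torsion submodules -/
theorem H.quot_tors (K : Submodule R M) (hK : ∀ m ∈ K, ∀ x ∈ l, ∃ k : ℕ, x ^ k • m = 0)
    (hi : 0 < i) : Function.Bijective (H.map l i K.mkQ) := by
  have ht : ∀ j : ℤ, j ≠ 0 → ∀ z : H l j K, z = 0 := fun j hj z => H.of_tors l j hj (fun m x hx => by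
    obtain ⟨k, hk⟩ := hK m m.2 x hx
    exact ⟨k, Subtype.ext hk⟩) z
  have he : Function.Exact K.subtype K.mkQ := LinearMap.exact_subtype_mkQ K
  exact ⟨H.map_inj l i K.injective_subtype he K.mkQ_surjective (ht i (by lia)),
    H.map_surj l i K.injective_subtype he K.mkQ_surjective (i + 1) rfl (ht _ (by lia))⟩

end
end LCoh
end

section
open CategoryTheory
namespace LCoh
section
variable {R : Type u} [CommRing R] {A B : Type u} [AddCommGroup A] [Module R A]
  [AddCommGroup B] [Module R B]

/-- `J`-torsion -/
def Tor (J : Ideal R) (A : Type u) [AddCommGroup A] [Module R A] : Prop :=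
  ∀ x ∈ J, ∀ a : A, ∃ k : ℕ, x ^ k • a = 0

/-- `0 :_A J` -/
def ann0 (J : Ideal R) (A : Type u) [AddCommGroup A] [Module R A] : Submodule R A :=
  Submodule.torsionBySet R A (J : Set R)

lemma mem_ann0 {J : Ideal R} {a : A} : a ∈ ann0 J A ↔ ∀ x ∈ J, x • a = 0 := by
  simp [ann0, Submodule.mem_torsionBySet_iff]

lemma mem_ann0_list {l : List R} {a : A} :
    a ∈ ann0 (Ideal.span {x | x ∈ l}) A ↔ ∀ x ∈ l, x • a = 0 := by
  rw [mem_ann0]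
  refine ⟨fun h x hx => h x (Ideal.subset_span hx), fun h x hx => ?_⟩
  induction hx using Submodule.span_induction with
  | mem x hx => exact h x hx
  | zero => simp
  | add x y _ _ h1 h2 => rw [add_smul, h1, h2, add_zero]
  | smul c x _ h1 => rw [smul_eq_mul, mul_smul, h1, smul_zero]

lemma exists_list [IsNoetherianRing R] (J : Ideal R) : ∃ l : List R, J = Ideal.span {x | x ∈ l} := by
  obtain ⟨s, rfl⟩ := (IsNoetherian.noetherian J : J.FG)
  exact ⟨s.toList, by congr 1; ext; simp⟩

lemma Tor.pow_smul [IsNoetherianRing R] {J : Ideal R} (h : Tor J A) (a : A) :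
    ∃ n : ℕ, ∀ x ∈ J ^ n, x • a = 0 := by
  let K : Ideal R := Submodule.colon (⊥ : Submodule R A) {a}
  have hK : ∀ x, x ∈ K ↔ x • a = 0 := fun x => by simp [K, Submodule.mem_colon]
  have : J ≤ K.radical := fun x hx => by
    obtain ⟨k, hk⟩ := h x hx a
    exact ⟨k, (hK _).2 hk⟩
  obtain ⟨n, hn⟩ := Ideal.exists_pow_le_of_le_radical_of_fg this (IsNoetherian.noetherian J)
  exact ⟨n, fun x hx => (hK x).1 (hn hx)⟩

lemma Tor.of_pow {J : Ideal R} (h : ∀ a : A, ∃ n : ℕ, ∀ x ∈ J ^ n, x • a = 0) : Tor J A :=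
  fun x hx a => (h a).imp fun n hn => hn _ (Ideal.pow_mem_pow hx n)

lemma Tor.of_inj {J : Ideal R} (h : Tor J B) (f : A →ₗ[R] B) (hf : Function.Injective f) : Tor J A :=
  fun x hx a => (h x hx (f a)).imp fun n hn => hf (by rw [map_smul, hn, map_zero])

lemma Tor.of_surj {J : Ideal R} (h : Tor J A) (f : A →ₗ[R] B) (hf : Function.Surjective f) :
    Tor J B := fun x hx b => by
  obtain ⟨a, rfl⟩ := hf b
  exact (h x hx a).imp fun n hn => by rw [← map_smul, hn, map_zero]

lemma Tor.mono {J K : Ideal R} (h : Tor J A) (hK : K ≤ J) : Tor K A := fun x hx => h x (hK hx)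

lemma art_of_x (x : R) (h : ∀ a : A, ∃ k : ℕ, x ^ k • a = 0)
    (hA : IsArtinian R (LinearMap.ker (x • LinearMap.id : A →ₗ[R] A))) : IsArtinian R A := by
  rw [← monotone_stabilizes_iff_artinian]
  intro b
  let K := LinearMap.ker (x • LinearMap.id : A →ₗ[R] A)
  -- G i n = {a ∈ K | ∃ c ∈ b i, a = x^n c}
  let G : ℕ → ℕ → Submodule R K := fun i n =>
    (Submodule.map (x ^ n • LinearMap.id : A →ₗ[R] A) (OrderDual.ofDual (b i))).comap K.subtype
  have hG : ∀ i n (a : K), a ∈ G i n ↔ ∃ c ∈ OrderDual.ofDual (b i), x ^ n • c = a.1 := by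
    intro i n a; simp [G, Submodule.mem_map]
  have hb : ∀ i j, i ≤ j → OrderDual.ofDual (b j) ≤ OrderDual.ofDual (b i) := fun i j hij => b.2 hij
  have hG1 : ∀ i j n, i ≤ j → G j n ≤ G i n := by
    intro i j n hij a ha
    obtain ⟨c, hc, h1⟩ := (hG _ _ _).1 ha
    exact (hG _ _ _).2 ⟨c, hb i j hij hc, h1⟩
  have hG2 : ∀ i n m, n ≤ m → G i m ≤ G i n := by
    intro i n m hij a ha
    obtain ⟨c, hc, h1⟩ := (hG _ _ _).1 ha
    refine (hG _ _ _).2 ⟨x ^ (m - n) • c, Submodule.smul_mem _ _ hc, ?_⟩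
    rw [smul_smul, ← pow_add, Nat.add_sub_cancel' hij, h1]
  have stab : ∀ n, ∃ i, ∀ j, i ≤ j → G i n = G j n := fun n =>
    IsArtinian.monotone_stabilizes (R := R) (M := K)
      ⟨fun i => OrderDual.toDual (G i n), fun i j hij => hG1 i j n hij⟩
  obtain ⟨n0, hn0⟩ := IsArtinian.monotone_stabilizes (R := R) (M := K)
      ⟨fun i => OrderDual.toDual (G i i), fun i j hij => (hG2 j i j hij).trans (hG1 i j i hij)⟩
  have hn0 : ∀ m, n0 ≤ m → G n0 n0 = G m m := hn0
  choose i hi using stab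
  let i0 := n0 + ∑ n ∈ Finset.range n0, i n
  have key : ∀ n j, i0 ≤ j → G i0 n ≤ G j n := by
    intro n j hj
    by_cases hn : n < n0
    · have h1 : i n ≤ i0 := le_trans (Finset.single_le_sum (f := i) (fun _ _ => Nat.zero_le _)
        (Finset.mem_range.2 hn)) (Nat.le_add_left _ _)
      rw [← hi n i0 h1, ← hi n j (h1.trans hj)]
    · push Not at hn
      have h0 : n0 ≤ i0 := Nat.le_add_right _ _
      calc G i0 n ≤ G i0 n0 := hG2 _ _ _ hn
        _ ≤ G n0 n0 := hG1 _ _ _ h0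
        _ = G (max n j) (max n j) := hn0 _ (hn.trans (le_max_left _ _))
        _ ≤ G j n := (hG1 _ _ _ (le_max_right _ _)).trans (hG2 _ _ _ (le_max_left _ _))
  refine ⟨i0, fun j hj => ?_⟩
  refine (show OrderDual.ofDual (b i0) = OrderDual.ofDual (b j) from le_antisymm ?_ (hb _ _ hj))
  have : ∀ n, ∀ c ∈ OrderDual.ofDual (b i0), x ^ n • c = 0 → c ∈ OrderDual.ofDual (b j) := by
    intro n
    induction n with
    | zero => intro c _ h; simp at h; rw [h]; exact Submodule.zero_mem _
    | succ n ih =>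
      intro c hc h
      have hk : x ^ n • c ∈ K := by
        rw [LinearMap.mem_ker]; simpa [smul_smul, pow_succ] using h
      obtain ⟨c', hc', h'⟩ := (hG _ _ _).1 (key n j hj ((hG i0 n ⟨_, hk⟩).2 ⟨c, hc, rfl⟩))
      have := ih (c - c') (Submodule.sub_mem _ hc (hb _ _ hj hc')) (by rw [smul_sub, h', sub_self])
      simpa using Submodule.add_mem _ this hc'
  intro c hc
  obtain ⟨k, hk⟩ := h c
  exact this k c hc hk

lemma art_of_list (l : List R) (h : ∀ x ∈ l, ∀ a : A, ∃ k : ℕ, x ^ k • a = 0)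
    (hA : IsArtinian R (ann0 (Ideal.span {x | x ∈ l}) A)) : IsArtinian R A := by
  induction l generalizing A with
  | nil =>
    have : ann0 (Ideal.span {x | x ∈ ([] : List R)}) A = ⊤ := by
      ext a; rw [mem_ann0_list]; simp
    rw [this] at hA
    exact isArtinian_of_linearEquiv (Submodule.topEquiv (R := R) (M := A))
  | cons f l ih =>
    apply art_of_x f (h f (by simp))
    apply ih
    · intro x hx a
      obtain ⟨k, hk⟩ := h x (by simp [hx]) a
      exact ⟨k, Subtype.ext hk⟩
    · let g : ann0 (Ideal.span {x | x ∈ l}) (LinearMap.ker (f • LinearMap.id : A →ₗ[R] A)) →ₗ[R]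
          ann0 (Ideal.span {x | x ∈ f :: l}) A :=
        LinearMap.codRestrict _ (Submodule.subtype _ ∘ₗ Submodule.subtype _) (by
          rintro ⟨⟨a, ha⟩, ha'⟩
          rw [mem_ann0_list] at ha' ⊢
          intro x hx
          rcases List.mem_cons.1 hx with rfl | hx
          · simpa using ha
          · exact congrArg Subtype.val (ha' x hx))
      apply isArtinian_of_injective g
      intro a b hab
      have := congrArg Subtype.val hab
      exact Subtype.ext (Subtype.ext this)

lemma art_of_ann [IsNoetherianRing R] (J : Ideal R) (h : Tor J A) (hA : IsArtinian R (ann0 J A)) :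
    IsArtinian R A := by
  obtain ⟨l, rfl⟩ := exists_list J
  exact art_of_list l (fun x hx => h x (Ideal.subset_span hx)) hA

open IsLocalRing
variable [IsLocalRing R]

lemma ann0_art_of_fin [h : Module.Finite R (ann0 (maximalIdeal R) A)] :
    IsArtinian R (ann0 (maximalIdeal R) A) := by
  letI : Module (R ⧸ maximalIdeal R) (ann0 (maximalIdeal R) A) :=
    inferInstanceAs (Module (R ⧸ maximalIdeal R) (Submodule.torsionBySet R A (maximalIdeal R : Set R)))
  haveI : IsScalarTower R (R ⧸ maximalIdeal R) (ann0 (maximalIdeal R) A) :=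
    inferInstanceAs (IsScalarTower R (R ⧸ maximalIdeal R) (Submodule.torsionBySet R A (maximalIdeal R : Set R)))
  haveI : Module.Finite (R ⧸ maximalIdeal R) (ann0 (maximalIdeal R) A) := Module.Finite.of_restrictScalars_finite R _ _
  letI : Field (R ⧸ maximalIdeal R) := Ideal.Quotient.field _
  have h1 : IsArtinian (R ⧸ maximalIdeal R) (ann0 (maximalIdeal R) A) := inferInstance
  exact isArtinian_of_surjective_algebraMap (S := R) (R := R ⧸ maximalIdeal R) Ideal.Quotient.mk_surjective

lemma ann0_fin_of_art [h : IsArtinian R A] :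
    Module.Finite R (ann0 (maximalIdeal R) A) := by
  letI : Module (R ⧸ maximalIdeal R) (ann0 (maximalIdeal R) A) :=
    inferInstanceAs (Module (R ⧸ maximalIdeal R) (Submodule.torsionBySet R A (maximalIdeal R : Set R)))
  haveI : IsScalarTower R (R ⧸ maximalIdeal R) (ann0 (maximalIdeal R) A) :=
    inferInstanceAs (IsScalarTower R (R ⧸ maximalIdeal R) (Submodule.torsionBySet R A (maximalIdeal R : Set R)))
  have h0 : IsArtinian R (ann0 (maximalIdeal R) A) := inferInstance
  letI : Field (R ⧸ maximalIdeal R) := Ideal.Quotient.field _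
  have h1 : IsArtinian (R ⧸ maximalIdeal R) (ann0 (maximalIdeal R) A) := isArtinian_of_tower R h0
  have h2 : Module.Finite (R ⧸ maximalIdeal R) (ann0 (maximalIdeal R) A) :=
    (IsSemisimpleModule.finite_tfae.out 0 2).2 h1
  exact Module.Finite.trans (R ⧸ maximalIdeal R) _

variable [IsNoetherianRing R]

lemma art_of_socle (h : Tor (maximalIdeal R) A) (hA : Module.Finite R (ann0 (maximalIdeal R) A)) :
    IsArtinian R A := art_of_ann _ h ann0_art_of_fin

lemma art_of_fin [Module.Finite R A] (h : Tor (maximalIdeal R) A) : IsArtinian R A :=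
  art_of_socle h inferInstance

end
end LCoh
end

section
open CategoryTheory
namespace LCoh
open IsLocalRing
section
variable {R : Type u} [CommRing R]

/-- abstract injectivity -/
def Inj (R : Type u) [CommRing R] (E : Type u) [AddCommGroup E] [Module R E] : Prop :=
  ∀ (X Y : Type u) [AddCommGroup X] [Module R X] [AddCommGroup Y] [Module R Y] (f : X →ₗ[R] Y)
    (_ : Function.Injective f) (g : X →ₗ[R] E), ∃ h : Y →ₗ[R] E, ∀ x, h (f x) = g x

theorem exists_inj (M : Type u) [AddCommGroup M] [Module R M] :
    ∃ (E : Type u) (_ : AddCommGroup E) (_ : Module R E), Inj R E ∧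
      ∃ f : M →ₗ[R] E, Function.Injective f := by
  let J := Injective.under (ModuleCat.of R M)
  haveI hJ : Injective J := inferInstanceAs (Injective (Injective.under (ModuleCat.of R M)))
  haveI : Injective (ModuleCat.of R J) := hJ
  haveI : Module.Injective R J := Module.injective_module_of_injective_object R J
  refine ⟨J, inferInstance, inferInstance, ?_, (Injective.ι (ModuleCat.of R M)).hom, ?_⟩
  · intro X Y _ _ _ _ f hf g
    exact Module.Injective.out f hf g
  · exact (ModuleCat.mono_iff_injective _).1 inferInstance

theorem exists_E [IsLocalRing R] : ∃ (E : Type u) (_ : AddCommGroup E) (_ : Module R E), Inj R E ∧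
    ∃ e0 : E, (∀ x ∈ maximalIdeal R, x • e0 = 0) ∧ e0 ≠ 0 ∧
      ∀ e : E, (∀ x ∈ maximalIdeal R, x • e = 0) → ∃ r : R, e = r • e0 := by
  obtain ⟨E, _, _, hE, ι, hι⟩ := exists_inj (R := R) (R ⧸ maximalIdeal R)
  let e0 := ι 1
  have he0 : ∀ x ∈ maximalIdeal R, x • e0 = 0 := by
    intro x hx
    have : x • (1 : R ⧸ maximalIdeal R) = 0 := by
      rw [Algebra.smul_def, mul_one]; exact Ideal.Quotient.eq_zero_iff_mem.2 hx
    rw [← map_smul, this, map_zero]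
  have he0' : e0 ≠ 0 := fun h => one_ne_zero (hι (h.trans (map_zero ι).symm))
  let S : Set (Submodule R E) := {B | ∀ b ∈ B, b ≠ 0 → ∃ r : R, r • b ≠ 0 ∧ r • b ∈ Submodule.span R {e0}}
  have hS0 : Submodule.span R {e0} ∈ S := fun b hb h => ⟨1, by simpa using h, by simpa using hb⟩
  obtain ⟨B, hB0, hBS, hB⟩ := zorn_le_nonempty₀ S (by
    intro c hc hch y hy
    refine ⟨sSup c, ?_, fun z hz => le_sSup hz⟩
    intro b hb
    obtain ⟨B, hB, hb⟩ := (Submodule.mem_sSup_of_directed ⟨y, hy⟩ hch.directedOn).1 hb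
    exact hc hB b hb) _ hS0
  have he0B : e0 ∈ B := hB0 (Submodule.mem_span_singleton_self _)
  let T : Set (Submodule R E) := {C | ∀ b ∈ B, b ∈ C → b = 0}
  obtain ⟨C, -, hCT, hC⟩ := zorn_le_nonempty₀ T (by
    intro c hc hch y hy
    refine ⟨sSup c, ?_, fun z hz => le_sSup hz⟩
    intro b hb hb'
    obtain ⟨B, hB, hb'⟩ := (Submodule.mem_sSup_of_directed ⟨y, hy⟩ hch.directedOn).1 hb'
    exact hc hB b hb hb') ⊥ (by intro b _ hb; simpa using hb)
  obtain ⟨ψ, hψ⟩ := hE B (E ⧸ C) (C.mkQ ∘ₗ B.subtype) (by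
    refine (injective_iff_map_eq_zero _).2 fun b hb => ?_
    exact Subtype.ext (hCT b b.2 (by simpa using hb))) B.subtype
  have hψB : ∀ b ∈ B, ψ (C.mkQ b) = b := fun b hb => hψ ⟨b, hb⟩
  have hr : LinearMap.range ψ ∈ S := by
    rintro _ ⟨y, rfl⟩ hne
    obtain ⟨y, rfl⟩ := C.mkQ_surjective y
    have hyC : y ∉ C := fun h => hne (by rw [show C.mkQ y = 0 by simpa using h, map_zero])
    have : ∃ b ∈ B, b ≠ 0 ∧ b ∈ C ⊔ Submodule.span R {y} := by
      by_contra! hcon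
      have hT : C ⊔ Submodule.span R {y} ∈ T := fun b hb hb' => by
        by_contra hne; exact hcon b hb hne hb'
      exact hyC (hC hT le_sup_left (Submodule.mem_sup_right (Submodule.mem_span_singleton_self y)))
    obtain ⟨b, hb, hb0, hbC⟩ := this
    obtain ⟨c, hc, z, hz, hcz⟩ := Submodule.mem_sup.1 hbC
    obtain ⟨r, rfl⟩ := Submodule.mem_span_singleton.1 hz
    obtain ⟨s, hs1, hs2⟩ := hBS b hb hb0
    have : r • ψ (C.mkQ y) = b := by
      rw [← map_smul, ← map_smul, ← hψB b hb, ← hcz, map_add, show C.mkQ c = 0 by simpa using hc, zero_add]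
    exact ⟨s * r, by rwa [mul_smul, this], by rwa [mul_smul, this]⟩
  have hle : LinearMap.range ψ ≤ B := hB hr fun b hb => ⟨_, hψB b hb⟩
  let ρ : E →ₗ[R] B := LinearMap.codRestrict B (ψ ∘ₗ C.mkQ) fun e => hle ⟨_, rfl⟩
  refine ⟨B, inferInstance, inferInstance, ?_, ⟨e0, he0B⟩, ?_, ?_, ?_⟩
  · intro X Y _ _ _ _ f hf g
    obtain ⟨h, hh⟩ := hE X Y f hf (B.subtype ∘ₗ g)
    refine ⟨ρ ∘ₗ h, fun x => Subtype.ext ?_⟩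
    change ψ (C.mkQ (h (f x))) = g x
    rw [hh]; exact hψB _ (g x).2
  · intro x hx; exact Subtype.ext (he0 x hx)
  · exact fun h => he0' (congrArg Subtype.val h)
  · rintro ⟨e, he⟩ h
    by_cases h0 : e = 0
    · exact ⟨0, Subtype.ext (by simpa using h0)⟩
    · obtain ⟨r, hr1, hr2⟩ := hBS e he h0
      have hu : IsUnit r := by
        by_contra hr
        exact hr1 (congrArg Subtype.val (h r ((mem_maximalIdeal r).2 hr)))
      obtain ⟨s, hs⟩ := Submodule.mem_span_singleton.1 hr2
      obtain ⟨u, rfl⟩ := hu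
      refine ⟨↑u⁻¹ * s, Subtype.ext ?_⟩
      change e = (↑u⁻¹ * s) • e0
      rw [mul_smul, hs, smul_smul, Units.inv_mul, one_smul]

end
end LCoh
end

section
open CategoryTheory
namespace LCoh
open IsLocalRing
section
variable {R : Type u} [CommRing R]

lemma hom_mem_smul [IsNoetherianRing R] {E A : Type u} [AddCommGroup E] [Module R E] [AddCommGroup A] [Module R A]
    (hE : Inj R E) (J : Ideal R) (θ : A →ₗ[R] E) (hθ : ∀ a ∈ ann0 J A, θ a = 0) :
    θ ∈ J • (⊤ : Submodule R (A →ₗ[R] E)) := by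
  obtain ⟨l, rfl⟩ := exists_list J
  let X : A →ₗ[R] (Fin l.length → A) := LinearMap.pi fun j => l.get j • LinearMap.id
  have hX : LinearMap.ker X ≤ LinearMap.ker θ := by
    intro a ha
    refine hθ a (mem_ann0_list.2 fun x hx => ?_)
    obtain ⟨j, rfl⟩ := List.get_of_mem hx
    have := congrFun (LinearMap.mem_ker.1 ha) j
    simpa [X] using this
  obtain ⟨h, hh⟩ := hE (A ⧸ LinearMap.ker X) (Fin l.length → A) ((LinearMap.ker X).liftQ X le_rfl)
    (LinearMap.ker_eq_bot.1 (Submodule.ker_liftQ_eq_bot _ _ _ le_rfl)) ((LinearMap.ker X).liftQ θ hX)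
  have hh' : ∀ a, h (X a) = θ a := fun a => hh (Submodule.Quotient.mk a)
  have : θ = ∑ j, l.get j • (h ∘ₗ LinearMap.single R (fun _ => A) j) := by
    ext a
    rw [← hh' a]
    conv_lhs => rw [← Finset.univ_sum_single (X a)]
    rw [map_sum, LinearMap.sum_apply]
    refine Finset.sum_congr rfl fun j _ => ?_
    rw [LinearMap.smul_apply, LinearMap.comp_apply, ← map_smul, ← map_smul]
    rfl
  rw [this]
  exact Submodule.sum_mem _ fun j _ => Submodule.smul_mem_smul (Ideal.subset_span (List.get_mem l j)) trivial

lemma nak_nilp {N : Type u} [AddCommGroup N] [Module R N] (m : Ideal R) (W : Submodule R N)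
    (h : W ⊔ m • ⊤ = ⊤) (n : ℕ) (hn : ∀ x ∈ m ^ n, ∀ a : N, x • a = 0) : W = ⊤ := by
  have : ∀ t : ℕ, W ⊔ (m ^ t) • ⊤ = ⊤ := by
    intro t
    induction t with
    | zero => simp
    | succ t ih =>
      rw [eq_top_iff]
      refine h.symm.le.trans ?_
      refine sup_le le_sup_left ?_
      calc m • (⊤ : Submodule R N) = m • (W ⊔ (m ^ t) • ⊤) := by rw [ih]
        _ = m • W ⊔ (m ^ (t + 1)) • (⊤ : Submodule R N) := by
            rw [Submodule.smul_sup, pow_succ', Submodule.mul_smul]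
        _ ≤ _ := sup_le_sup_right Submodule.smul_le_right _
  rw [← this n, show (m ^ n) • (⊤ : Submodule R N) = ⊥ from ?_, sup_bot_eq]
  rw [eq_bot_iff, Submodule.smul_le]
  intro x hx a _
  simpa using hn x hx a

lemma exists_soc_basis [IsLocalRing R] (A : Type u) [AddCommGroup A] [Module R A]
    [Module.Finite R (ann0 (maximalIdeal R) A)] :
    ∃ (r : ℕ) (b : Fin r → ann0 (maximalIdeal R) A)
      (c : Fin r → ann0 (maximalIdeal R) A →ₗ[R] R ⧸ maximalIdeal R),
      ∀ s (t : Fin r → R), (∀ j, Ideal.Quotient.mk _ (t j) = c j s) → s = ∑ j, t j • b j := by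
  letI : Module (R ⧸ maximalIdeal R) (ann0 (maximalIdeal R) A) :=
    inferInstanceAs (Module (R ⧸ maximalIdeal R) (Submodule.torsionBySet R A (maximalIdeal R : Set R)))
  haveI : IsScalarTower R (R ⧸ maximalIdeal R) (ann0 (maximalIdeal R) A) :=
    inferInstanceAs (IsScalarTower R (R ⧸ maximalIdeal R) (Submodule.torsionBySet R A (maximalIdeal R : Set R)))
  haveI : Module.Finite (R ⧸ maximalIdeal R) (ann0 (maximalIdeal R) A) :=
    Module.Finite.of_restrictScalars_finite R _ _
  letI : Field (R ⧸ maximalIdeal R) := Ideal.Quotient.field _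
  let b := Module.finBasis (R ⧸ maximalIdeal R) (ann0 (maximalIdeal R) A)
  refine ⟨_, b, fun j => (b.coord j).restrictScalars R, fun s t ht => ?_⟩
  rw [← b.sum_repr s]
  refine Finset.sum_congr rfl fun j _ => ?_
  rw [← algebraMap_smul (R ⧸ maximalIdeal R) (t j) (b j)]
  exact congrArg (· • b j) (ht j).symm

theorem lemmaB [IsLocalRing R] [IsNoetherianRing R] (A : Type u) [AddCommGroup A] [Module R A]
    (hA : Module.Finite R (ann0 (maximalIdeal R) A)) :
    ∃ r : ℕ, ∀ n : ℕ, ∀ (J : Ideal R) (f : R), (∀ a ∈ ann0 J A, f • a = 0) →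
      ∃ i ∈ J, ∀ a ∈ ann0 (maximalIdeal R ^ (n + 1)) A, f ^ r • a = i • a := by
  let m := maximalIdeal R
  obtain ⟨E, _, _, hE, e0, he1, he2, he3⟩ := exists_E (R := R)
  let S := ann0 m A
  haveI : Module.Finite R S := hA
  obtain ⟨r, b, bc, hb⟩ := exists_soc_basis (R := R) A
  let κ : (R ⧸ m) →ₗ[R] E := m.liftQ (LinearMap.toSpanSingleton R E e0) (fun x hx => he1 x hx)
  have hκ : ∀ x : R, κ (Ideal.Quotient.mk m x) = x • e0 := fun x => rfl
  have hκi : ∀ x, κ x = 0 → x = 0 := by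
    intro x hx
    obtain ⟨x, rfl⟩ := Ideal.Quotient.mk_surjective x
    rw [hκ] at hx
    rw [Ideal.Quotient.eq_zero_iff_mem]
    by_contra hxm
    have hu : IsUnit x := by by_contra h; exact hxm ((mem_maximalIdeal x).2 h)
    exact he2 ((hu.smul_eq_zero).1 hx)
  refine ⟨r, fun n J f hf => ?_⟩
  let A' := ann0 (m ^ (n + 1)) A
  have hSA : S ≤ A' := fun a ha => mem_ann0.2 fun x hx =>
    mem_ann0.1 ha x (Ideal.pow_le_self (by simp) hx)
  let σ : S →ₗ[R] A' := Submodule.inclusion hSA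
  have hσ : Function.Injective σ := Submodule.inclusion_injective hSA
  have : ∀ j : Fin r, ∃ φ : A' →ₗ[R] E, ∀ s : S, φ (σ s) = κ (bc j s) := fun j =>
    hE S A' σ hσ (κ ∘ₗ bc j)
  choose φ hφ using this
  have hS' : ∀ a : A', (∀ x ∈ m, x • a = 0) → ∃ s : S, σ s = a := fun a ha =>
    ⟨⟨a.1, mem_ann0.2 fun x hx => congrArg Subtype.val (ha x hx)⟩, Subtype.ext rfl⟩
  have hnil : ∀ x ∈ m ^ (n + 1), ∀ a : A', x • a = 0 := fun x hx a => Subtype.ext (mem_ann0.1 a.2 x hx)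
  -- generation
  have hW : Submodule.span R (Set.range φ) = ⊤ := by
    refine nak_nilp m _ ?_ (n + 1) fun x hx ψ => by
      ext a
      rw [LinearMap.smul_apply, ← map_smul, hnil x hx, map_zero, LinearMap.zero_apply]
    rw [eq_top_iff]
    intro ψ _
    have : ∀ j, ∃ c : R, ψ (σ (b j)) = c • e0 := fun j => he3 _ fun x hx => by
      rw [← map_smul, ← map_smul]
      have : x • b j = 0 := Subtype.ext (mem_ann0.1 (b j).2 x hx)
      rw [this, map_zero, map_zero]
    choose c hc using this
    have h2 : ψ - ∑ j, c j • φ j ∈ m • (⊤ : Submodule R (A' →ₗ[R] E)) := by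
      apply hom_mem_smul hE
      intro a ha
      obtain ⟨s, rfl⟩ := hS' a (mem_ann0.1 ha)
      have : ∀ j, ∃ t : R, Ideal.Quotient.mk m t = bc j s := fun j => Ideal.Quotient.mk_surjective _
      choose t ht using this
      have hs : s = ∑ j, t j • b j := hb s t ht
      rw [LinearMap.sub_apply, sub_eq_zero, LinearMap.sum_apply]
      simp only [LinearMap.smul_apply, hφ, ← ht, hκ]
      conv_lhs => rw [hs]
      simp only [map_sum, map_smul, hc]
      exact Finset.sum_congr rfl fun j _ => smul_comm _ _ _
    have h3 : ∑ j, c j • φ j ∈ Submodule.span R (Set.range φ) :=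
      Submodule.sum_mem _ fun j _ => Submodule.smul_mem _ _ (Submodule.subset_span ⟨j, rfl⟩)
    have := Submodule.add_mem_sup h3 h2
    rwa [add_sub_cancel] at this
  haveI : Module.Finite R (A' →ₗ[R] E) := Module.Finite.of_fg_top (hW ▸ Submodule.fg_span (Set.finite_range φ))
  have hsr : (⊤ : Submodule R (A' →ₗ[R] E)).spanFinrank ≤ r := by
    rw [← hW]
    refine (Submodule.spanFinrank_span_le_ncard_of_finite (Set.finite_range φ)).trans ?_
    rw [← Set.image_univ]
    refine (Set.ncard_image_le (Set.toFinite _)).trans (by simp [Set.ncard_univ])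
  obtain ⟨p, hp1, hp2, hp3, hp4⟩ :=
    LinearMap.exists_monic_and_natDegree_eq_and_coeff_mem_pow_and_aeval_eq_zero R
      (algebraMap R (Module.End R (A' →ₗ[R] E)) f) J (by
        rintro _ ⟨ψ, rfl⟩
        apply hom_mem_smul hE
        intro a ha
        have : f • a = 0 := Subtype.ext (hf a.1 (mem_ann0.2 fun x hx =>
          congrArg Subtype.val (mem_ann0.1 ha x hx)))
        change f • ψ a = 0
        rw [← map_smul, this, map_zero])
  rw [Polynomial.aeval_algebraMap_apply] at hp4
  have hpz : ∀ ψ : A' →ₗ[R] E, (Polynomial.aeval f p) • ψ = 0 := fun ψ =>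
    by simpa using LinearMap.congr_fun hp4 ψ
  have hpe : ∃ i ∈ J, Polynomial.aeval f p = f ^ p.natDegree - i := by
    refine ⟨- ∑ k ∈ Finset.range p.natDegree, p.coeff k * f ^ k, ?_, ?_⟩
    · refine Submodule.neg_mem _ (Submodule.sum_mem _ fun k hk => Ideal.mul_mem_right _ _ ?_)
      exact Ideal.pow_le_self (by have := Finset.mem_range.1 hk; lia) (hp3 k)
    · rw [Polynomial.coe_aeval_eq_eval, Polynomial.eval_eq_sum_range, Finset.sum_range_succ,
        Polynomial.coeff_natDegree, hp1.leadingCoeff]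
      ring
  obtain ⟨i, hi, hpi⟩ := hpe
  rw [hpi] at hpz
  have hcog : ∀ a : A', (∀ ψ : A' →ₗ[R] E, ψ a = 0) → a = 0 := by
    intro a ha
    have : ∀ t, (∀ x ∈ m ^ t, x • a = 0) → a = 0 := by
      intro t
      induction t with
      | zero => intro h; simpa using h 1 (by simp)
      | succ t ih =>
        intro h
        refine ih fun y hy => ?_
        obtain ⟨s, hs⟩ := hS' (y • a) (fun x hx => by
          rw [smul_smul]; exact h _ (by rw [pow_succ']; exact Ideal.mul_mem_mul hx hy))
        have : s = 0 := by
          rw [hb s (fun _ => 0) (fun j => ?_)]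
          · simp
          have h3 := hφ j s
          rw [hs, map_smul, ha, smul_zero] at h3
          simpa using (hκi _ h3.symm).symm
        rw [← hs, this, map_zero]
    exact this (n + 1) fun x hx => hnil x hx a
  refine ⟨f ^ (r - p.natDegree) * i, Ideal.mul_mem_left _ _ hi, fun a ha => ?_⟩
  have h1 : (f ^ p.natDegree - i) • (⟨a, ha⟩ : A') = 0 := hcog _ fun ψ => by
    rw [map_smul]; exact LinearMap.congr_fun (hpz ψ) _
  have h2 : f ^ p.natDegree • a = i • a := by
    have := congrArg Subtype.val h1
    rw [sub_smul, sub_eq_zero] at h1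
    exact congrArg Subtype.val h1
  rw [mul_smul, ← h2, smul_smul, ← pow_add]
  congr 2; lia

end
end LCoh
end

section
open CategoryTheory
namespace LCoh
open IsLocalRing
section
variable {R : Type u} [CommRing R] [IsLocalRing R] [IsNoetherianRing R]

lemma krull_closed (K : Ideal R) (x : R) (h : ∀ t, x ∈ K ⊔ maximalIdeal R ^ t) : x ∈ K := by
  have h1 : (⨅ i : ℕ, maximalIdeal R ^ i • (⊤ : Submodule R (R ⧸ K))) = ⊥ :=
    Ideal.iInf_pow_smul_eq_bot_of_isLocalRing _ (maximalIdeal.isMaximal R).ne_top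
  rw [← Ideal.Quotient.eq_zero_iff_mem, ← Submodule.mem_bot R, ← h1, Submodule.mem_iInf]
  intro t
  obtain ⟨k, hk, y, hy, rfl⟩ := Submodule.mem_sup.1 (h t)
  have : Ideal.Quotient.mk K (k + y) = y • (1 : R ⧸ K) := by
    rw [map_add, Ideal.Quotient.eq_zero_iff_mem.2 hk, zero_add, Algebra.smul_def, mul_one]; rfl
  rw [this]
  exact Submodule.smul_mem_smul hy trivial

/-- Chevalley's theorem -/
theorem chevalley [IsAdicComplete (maximalIdeal R) R] (a : ℕ → Ideal R) (ha : Antitone a) (t : ℕ) :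
    ∃ n, a n ≤ (⨅ n, a n) ⊔ maximalIdeal R ^ t := by
  let m := maximalIdeal R
  have stab : ∀ t, ∃ n, ∀ k, n ≤ k → a n ⊔ m ^ t = a k ⊔ m ^ t := by
    intro t
    have : IsArtinian R (R ⧸ m ^ t) := art_of_fin (Tor.of_pow fun a => ⟨t, fun x hx => by
      obtain ⟨a, rfl⟩ := Ideal.Quotient.mk_surjective a
      rw [Algebra.smul_def]
      exact (map_mul _ _ _).symm.trans (Ideal.Quotient.eq_zero_iff_mem.2 (Ideal.mul_mem_right _ _ hx))⟩)
    obtain ⟨n, hn⟩ := IsArtinian.monotone_stabilizes (R := R) (M := R ⧸ m ^ t)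
      ⟨fun n => OrderDual.toDual (Submodule.map (Submodule.mkQ (m ^ t)) (a n)),
        fun i j hij => Submodule.map_mono (ha hij)⟩
    refine ⟨n, fun k hk => ?_⟩
    have h1 : Submodule.map (Submodule.mkQ (m ^ t)) (a n) = Submodule.map (Submodule.mkQ (m ^ t)) (a k) := hn k hk
    have h2 := congrArg (Submodule.comap (Submodule.mkQ (m ^ t))) h1
    rw [Submodule.comap_map_mkQ, Submodule.comap_map_mkQ] at h2
    rw [sup_comm, sup_comm (a k)]; exact h2
  choose n hn using stab
  let K : ℕ → Ideal R := fun t => a (n t) ⊔ m ^ t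
  have hKa : ∀ t j, K t ≤ a j ⊔ m ^ t := fun t j => by
    rcases le_total (n t) j with h | h
    · exact (hn t j h).le
    · exact sup_le_sup_right (ha h) _
  have step : ∀ t, ∀ x ∈ K t, ∃ y ∈ K (t + 1), y - x ∈ m ^ t := by
    intro t x hx
    obtain ⟨y, hy, z, hz, rfl⟩ := Submodule.mem_sup.1 (hKa t (n (t + 1)) hx)
    exact ⟨y, Submodule.mem_sup_left hy, by simpa using hz⟩
  refine ⟨n t, fun x hx => ?_⟩
  have hx : x ∈ K t := Submodule.mem_sup_left hx
  -- sequence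
  obtain ⟨G, hG0, hGK, hG⟩ : ∃ G : ℕ → R, G 0 = x ∧ (∀ i, G i ∈ K (t + i)) ∧
      ∀ i, G (i + 1) - G i ∈ m ^ (t + i) := by
    let g : ∀ i : ℕ, {y : R // y ∈ K (t + i)} := fun i => Nat.rec ⟨x, hx⟩
      (fun i y => ⟨(step _ y.1 y.2).choose, (step _ y.1 y.2).choose_spec.1⟩) i
    exact ⟨fun i => (g i).1, rfl, fun i => (g i).2,
      fun i => (step _ (g i).1 (g i).2).choose_spec.2⟩
  have hg' : ∀ i j, G (i + j) - G i ∈ m ^ (t + i) := by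
    intro i j
    induction j with
    | zero => simp
    | succ j ih =>
      have := Ideal.add_mem _ (Ideal.pow_le_pow_right (show t + i ≤ t + (i + j) by lia) (hG (i + j))) ih
      rw [← add_assoc i j 1]
      simpa using this
  obtain ⟨L, hL⟩ := IsPrecomplete.prec' (I := m) (M := R) (fun i => G (i - t)) (by
    intro i j hij
    rw [SModEq.sub_mem, smul_eq_mul, Ideal.mul_top, ← neg_mem_iff, neg_sub]
    have := hg' (i - t) (j - i)
    rcases le_total t i with h | h
    · rw [show i - t + (j - i) = j - t by lia, show t + (i - t) = i by lia] at this
      exact this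
    · rw [show i - t = 0 by lia]
      have := hg' 0 (j - t)
      rw [zero_add] at this
      exact Ideal.pow_le_pow_right (by lia) this)
  have hL' : ∀ i, L - G i ∈ m ^ (t + i) := fun i => by
    have := hL (t + i)
    rw [SModEq.sub_mem, smul_eq_mul, Ideal.mul_top, ← neg_mem_iff, neg_sub, Nat.add_sub_cancel_left] at this
    exact this
  have hLa : ∀ j, L ∈ a j := by
    intro j
    refine krull_closed _ _ fun s => ?_
    have h1 := hKa _ j (hGK s)
    have h2 : L - G s ∈ a j ⊔ m ^ (t + s) := Submodule.mem_sup_right (hL' s)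
    have h3 := Ideal.add_mem _ h2 h1
    rw [sub_add_cancel] at h3
    have h5 : a j ⊔ m ^ (t + s) ≤ a j ⊔ m ^ s :=
      sup_le_sup_left (Ideal.pow_le_pow_right (show s ≤ t + s by lia)) (a j)
    exact h5 h3
  have h4 := hL' 0
  rw [hG0] at h4
  rw [show x = L + -(L - x) by ring]
  exact Submodule.add_mem_sup (Submodule.mem_iInf _ |>.2 hLa) (Submodule.neg_mem _ h4)

theorem lemmaB_complete [IsAdicComplete (maximalIdeal R) R] (A : Type u) [AddCommGroup A] [Module R A]
    (hT : Tor (maximalIdeal R) A) (hA : Module.Finite R (ann0 (maximalIdeal R) A)) (J : Ideal R) (f : R)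
    (hf : ∀ a ∈ ann0 J A, f • a = 0) : ∃ r : ℕ, f ^ r ∈ J ⊔ Module.annihilator R A := by
  obtain ⟨r, hr⟩ := lemmaB A hA
  refine ⟨r, krull_closed _ _ fun t => ?_⟩
  let a : ℕ → Ideal R := fun n => Module.annihilator R (ann0 (maximalIdeal R ^ (n + 1)) A)
  have hmem : ∀ n x, x ∈ a n ↔ ∀ b ∈ ann0 (maximalIdeal R ^ (n + 1)) A, x • b = 0 := fun n x => by
    rw [Module.mem_annihilator]
    exact ⟨fun h b hb => congrArg Subtype.val (h ⟨b, hb⟩), fun h b => Subtype.ext (h b.1 b.2)⟩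
  have ha : Antitone a := fun i j hij x hx => (hmem _ _).2 fun b hb => (hmem _ _).1 hx b
    (mem_ann0.2 fun y hy => mem_ann0.1 hb y (Ideal.pow_le_pow_right (by lia) hy))
  have hinf : ⨅ n, a n ≤ Module.annihilator R A := fun x hx => Module.mem_annihilator.2 fun b => by
    obtain ⟨n, hn⟩ := hT.pow_smul b
    exact (hmem n x).1 ((Submodule.mem_iInf _).1 hx n) b
      (mem_ann0.2 fun y hy => hn y (Ideal.pow_le_pow_right (by lia) hy))
  obtain ⟨n, hn⟩ := chevalley a ha t
  obtain ⟨i, hi, hia⟩ := hr n J f hf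
  have h1 : f ^ r - i ∈ a n := (hmem _ _).2 fun b hb => by rw [sub_smul, hia b hb, sub_self]
  have h2 := hn.trans (sup_le_sup_right hinf _) h1
  rw [show f ^ r = i + (f ^ r - i) by ring, sup_assoc]
  exact Submodule.add_mem_sup hi h2

lemma ann0_anti {J K : Ideal R} (h : J ≤ K) (A : Type u) [AddCommGroup A] [Module R A] :
    ann0 K A ≤ ann0 J A := fun _ ha => mem_ann0.2 fun x hx => mem_ann0.1 ha x (h hx)

lemma fin_of_le {A : Type u} [AddCommGroup A] [Module R A] {B C : Submodule R A} (h : B ≤ C)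
    (hC : Module.Finite R C) : Module.Finite R B :=
  Module.Finite.of_injective (Submodule.inclusion h) (Submodule.inclusion_injective h)

lemma tor_fin_kill {A : Type u} [AddCommGroup A] [Module R A] [hA : Module.Finite R A] (f : R)
    (h : ∀ a : A, ∃ k : ℕ, f ^ k • a = 0) : ∃ k : ℕ, ∀ a : A, f ^ k • a = 0 := by
  obtain ⟨s, hs⟩ := hA.fg_top
  choose k hk using h
  refine ⟨∑ a ∈ s, k a, fun a => ?_⟩
  have ha : a ∈ Submodule.span R (s : Set A) := hs ▸ trivial
  induction ha using Submodule.span_induction with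
  | mem x hx =>
    obtain ⟨c, hc⟩ := Nat.exists_eq_add_of_le' (Finset.single_le_sum (f := k) (fun _ _ => Nat.zero_le _) hx)
    rw [hc, pow_add, mul_smul, hk, smul_zero]
  | zero => simp
  | add x y _ _ h1 h2 => rw [smul_add, h1, h2, add_zero]
  | smul c x _ h1 => rw [smul_comm, h1, smul_zero]

theorem prim_of_art [IsAdicComplete (maximalIdeal R) R] (A : Type u) [AddCommGroup A] [Module R A]
    (hT : Tor (maximalIdeal R) A) (J : Ideal R) (hJ : Module.Finite R (ann0 J A)) :
    maximalIdeal R ≤ (J ⊔ Module.annihilator R A).radical := by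
  by_cases hJt : J = ⊤
  · rw [hJt, top_sup_eq, Ideal.radical_top]; exact le_top
  have hA := fin_of_le (ann0_anti (le_maximalIdeal hJt) A) hJ
  intro f hf
  obtain ⟨k, hk⟩ := tor_fin_kill (A := ann0 J A) f fun a => by
    obtain ⟨k, hk⟩ := hT f hf a.1
    exact ⟨k, Subtype.ext hk⟩
  obtain ⟨r, hr⟩ := lemmaB_complete A hT hA J (f ^ k) fun a ha => congrArg Subtype.val (hk ⟨a, ha⟩)
  exact ⟨k * r, by rwa [pow_mul]⟩

end
end LCoh
end

section
open CategoryTheory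
namespace LCoh
open IsLocalRing
section
variable {R : Type u} [CommRing R]

/-- there is a chain of primes of length `n` from `Q` to something `≤ P` -/
def Ch : ℕ → Ideal R → Ideal R → Prop
  | 0, Q, P => Q ≤ P
  | n + 1, Q, P => ∃ Q' : Ideal R, Q'.IsPrime ∧ Q < Q' ∧ Ch n Q' P

lemma Ch.le {n : ℕ} {Q P : Ideal R} (h : Ch n Q P) : Q ≤ P := by
  induction n generalizing Q with
  | zero => exact h
  | succ n ih => obtain ⟨Q', _, h1, h2⟩ := h; exact h1.le.trans (ih h2)

lemma Ch.pred {n : ℕ} {Q P : Ideal R} (h : Ch (n + 1) Q P) : Ch n Q P := by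
  induction n generalizing Q with
  | zero => exact h.le
  | succ n ih => obtain ⟨Q', h0, h1, h2⟩ := h; exact ⟨Q', h0, h1, ih h2⟩

lemma Ch.mono {n k : ℕ} {Q P : Ideal R} (h : Ch n Q P) (hk : k ≤ n) : Ch k Q P := by
  induction n, hk using Nat.le_induction with
  | base => exact h
  | succ n _ ih => exact ih h.pred

lemma Ch.left {n : ℕ} {Q0 Q P : Ideal R} (h : Ch n Q P) (h0 : Q0 ≤ Q) : Ch n Q0 P := by
  cases n with
  | zero => exact h0.trans h
  | succ n => obtain ⟨Q', h1, h2, h3⟩ := h; exact ⟨Q', h1, h0.trans_lt h2, h3⟩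

lemma Ch.right {n : ℕ} {Q P P1 : Ideal R} (h : Ch n Q P) (h0 : P ≤ P1) : Ch n Q P1 := by
  induction n generalizing Q with
  | zero => exact le_trans h h0
  | succ n ih => obtain ⟨Q', h1, h2, h3⟩ := h; exact ⟨Q', h1, h2, ih h3⟩

lemma Ch.trans {n k : ℕ} {Q P P1 : Ideal R} (h : Ch n Q P) (h0 : Ch k P P1) : Ch (n + k) Q P1 := by
  induction n generalizing Q with
  | zero => rw [zero_add]; exact h0.left h
  | succ n ih =>
    obtain ⟨Q', h1, h2, h3⟩ := h
    rw [show n + 1 + k = (n + k) + 1 by lia]; exact ⟨Q', h1, h2, ih h3⟩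

lemma Ch.one {Q P : Ideal R} (hP : P.IsPrime) (h : Q < P) : Ch 1 Q P := ⟨P, hP, h, le_rfl⟩

lemma Ch.last {n : ℕ} {Q P : Ideal R} (hQ : Q.IsPrime) (h : Ch (n + 1) Q P) :
    ∃ P' : Ideal R, P'.IsPrime ∧ P' < P ∧ Ch n Q P' := by
  induction n generalizing Q with
  | zero => obtain ⟨Q', h1, h2, h3⟩ := h; exact ⟨Q, hQ, h2.trans_le h3, le_rfl⟩
  | succ n ih =>
    obtain ⟨Q', h1, h2, h3⟩ := h
    obtain ⟨P', h4, h5, h6⟩ := ih h1 h3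
    exact ⟨P', h4, h5, Q', h1, h2, h6⟩

/-- `dim (R/J)_P < n` -/
def Dlt (J P : Ideal R) (n : ℕ) : Prop := ∀ Q : Ideal R, Q.IsPrime → J ≤ Q → ¬ Ch n Q P

lemma Dlt.mono {J J' P : Ideal R} {n k : ℕ} (h : Dlt J P n) (hJ : J ≤ J') (hk : n ≤ k) : Dlt J' P k :=
  fun Q hQ hJQ hc => h Q hQ (hJ.trans hJQ) (hc.mono hk)

lemma Dlt.not_ch {Q P : Ideal R} (hQ : Q.IsPrime) {n : ℕ} (h : Dlt Q P n) : ¬ Ch n Q P :=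
  h Q hQ le_rfl

lemma dlt_iff {Q P : Ideal R} (hQ : Q.IsPrime) {n : ℕ} : Dlt Q P n ↔ ¬ Ch n Q P :=
  ⟨fun h => h.not_ch hQ, fun h _ _ h1 h2 => h (h2.left h1)⟩

lemma Dlt.zero_iff {J P : Ideal R} (hP : P.IsPrime) : Dlt J P 0 ↔ ¬ J ≤ P :=
  ⟨fun h h1 => h P hP h1 le_rfl, fun h Q _ h1 h2 => h (h1.trans h2)⟩

/-- adding an element outside the small primes -/
lemma Dlt.succ_of {J P : Ideal R} {x : R} {n : ℕ} (h : Dlt J P (n + 1))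
    (hx : ∀ Q : Ideal R, Q.IsPrime → J ≤ Q → Ch n Q P → x ∉ Q) : Dlt (J ⊔ Ideal.span {x}) P n :=
  fun Q hQ hJ hc => hx Q hQ (le_sup_left.trans hJ) hc
    (hJ (Submodule.mem_sup_right (Ideal.mem_span_singleton_self x)))

/-- strictly smaller for a prime -/
lemma Dlt.of_lt {Q J P : Ideal R} {n : ℕ} (h : Dlt Q P (n + 1)) (hQ : Q.IsPrime) (hJ : Q < J) :
    Dlt J P n := fun Q' hQ' h1 h2 => h Q hQ le_rfl ⟨Q', hQ', hJ.trans_le h1, h2⟩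

lemma Dlt.radical {J J' P : Ideal R} {n : ℕ} (h : Dlt J P n) (hJ : J ≤ J'.radical) : Dlt J' P n :=
  fun Q hQ h1 h2 => h Q hQ (hJ.trans (hQ.radical_le_iff.2 h1)) h2

lemma Dlt.mul {J J' P : Ideal R} {n : ℕ} (h : Dlt J P n) (h' : Dlt J' P n) : Dlt (J * J') P n :=
  fun Q hQ h1 h2 => (hQ.mul_le.1 h1).elim (fun h3 => h Q hQ h3 h2) (fun h3 => h' Q hQ h3 h2)

lemma ch_iff_series {n : ℕ} {Q P : PrimeSpectrum R} :
    Ch n Q.asIdeal P.asIdeal ↔ ∃ s : LTSeries (PrimeSpectrum R), s.length = n ∧ s.head = Q ∧ s.last ≤ P := by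
  induction n generalizing Q with
  | zero =>
    refine ⟨fun h => ⟨RelSeries.singleton _ Q, rfl, rfl, h⟩, ?_⟩
    rintro ⟨s, h1, h2, h3⟩
    have : s.head ≤ s.last := LTSeries.head_le_last s
    rw [h2] at this; exact this.trans h3
  | succ n ih =>
    constructor
    · rintro ⟨Q', h1, h2, h3⟩
      obtain ⟨s, h4, h5, h6⟩ := (ih (Q := ⟨Q', h1⟩)).1 h3
      refine ⟨s.cons Q (by rw [h5]; exact h2), by simp [h4], by simp, by simpa using h6⟩
    · rintro ⟨s, h1, h2, h3⟩
      have hl : s.length ≠ 0 := by lia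
      refine ⟨(s.tail hl).head.asIdeal, (s.tail hl).head.2, ?_, (ih (Q := (s.tail hl).head)).2
        ⟨s.tail hl, by simp [h1], rfl, by simpa using h3⟩⟩
      rw [← h2, RelSeries.head_tail]
      have := s.strictMono (show (0 : Fin (s.length + 1)) < 1 by
        rw [Fin.lt_def]; simp; rw [Nat.one_mod_eq_one.2 (by lia)]; norm_num)
      exact this

lemma dlt_iff_dim [IsLocalRing R] (J : Ideal R) (n : ℕ) :
    Dlt J (maximalIdeal R) n ↔ ringKrullDim (R ⧸ J) < n := by
  rw [ringKrullDim_quotient]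
  constructor
  · intro h
    by_contra! h1
    rw [Order.le_krullDim_iff] at h1
    obtain ⟨s, hs⟩ := h1
    refine h s.head.1.asIdeal s.head.1.2 s.head.2 ?_
    exact (ch_iff_series (P := closedPoint R)).2 ⟨s.map _ (Subtype.strictMono_coe _), hs, rfl,
      le_maximalIdeal (PrimeSpectrum.isPrime _).ne_top⟩
  · intro h Q hQ h1 h2
    obtain ⟨s, h3, h4, h5⟩ := (ch_iff_series (P := closedPoint R) (Q := ⟨Q, hQ⟩)).1 h2
    refine h.not_ge ?_
    rw [Order.le_krullDim_iff]
    refine ⟨⟨s.length, fun i => ⟨s i, ?_⟩, fun i => s.step i⟩, h3⟩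
    have : s.head ≤ s i := LTSeries.head_le s i
    rw [h4] at this
    exact h1.trans this

/-- dimension drops by at most one -/
lemma Dlt.drop [IsLocalRing R] [IsNoetherianRing R] {J : Ideal R} {x : R} (hx : x ∈ maximalIdeal R)
    {n : ℕ} (h : Dlt (J ⊔ Ideal.span {x}) (maximalIdeal R) n) : Dlt J (maximalIdeal R) (n + 1) := by
  rw [dlt_iff_dim] at h ⊢
  by_cases hJ : J = ⊤
  · subst hJ
    rw [ringKrullDim_eq_bot_of_subsingleton]; exact WithBot.bot_lt_coe _
  have : Nontrivial (R ⧸ J) := Ideal.Quotient.nontrivial_iff.2 hJ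
  have h1 := ringKrullDim_le_ringKrullDim_quotient_add_card (R := R ⧸ J) {Ideal.Quotient.mk J x} (by
    have : IsLocalRing (R ⧸ J) := IsLocalRing.of_surjective' _ Ideal.Quotient.mk_surjective
    rw [IsLocalRing.ringJacobson_eq_maximalIdeal]
    intro y hy
    simp at hy
    subst hy
    have : IsLocalHom (Ideal.Quotient.mk J) := IsLocalHom.of_surjective _ Ideal.Quotient.mk_surjective
    exact (mem_maximalIdeal _).2 fun hu => (mem_maximalIdeal _).1 hx (isUnit_of_map_unit _ _ hu))
  have h2 : ringKrullDim ((R ⧸ J) ⧸ Ideal.span ({Ideal.Quotient.mk J x} : Set (R ⧸ J))) =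
      ringKrullDim (R ⧸ (J ⊔ Ideal.span {x})) := by
    refine ringKrullDim_eq_of_ringEquiv ?_
    refine (Ideal.quotEquivOfEq ?_).trans (DoubleQuot.quotQuotEquivQuotSup J (Ideal.span {x}))
    rw [Ideal.map_span, Set.image_singleton]
  rw [Finset.coe_singleton, h2, Finset.card_singleton] at h1
  refine h1.trans_lt ?_
  generalize ringKrullDim (R ⧸ (J ⊔ Ideal.span {x})) = d at h
  refine lt_of_le_of_lt (b := ((n : ℕ) : WithBot ℕ∞)) ?_ (by exact_mod_cast Nat.lt_succ_self n)
  rw [Nat.cast_one]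
  match d, h with
  | ⊥, _ => simp
  | ⊤, h => exact absurd h (by simp)
  | (k : ℕ), h => 
    have h : k < n := by exact_mod_cast h
    exact_mod_cast h

lemma exists_dlt [IsLocalRing R] [IsNoetherianRing R] : ∃ n, Dlt (⊥ : Ideal R) (maximalIdeal R) n := by
  have h := ringKrullDim_lt_top (R := R)
  have h1 : ringKrullDim (R ⧸ (⊥ : Ideal R)) = ringKrullDim R :=
    ringKrullDim_eq_of_ringEquiv (RingEquiv.quotientBot R)
  obtain ⟨n, hn⟩ : ∃ n : ℕ, ringKrullDim R = n := by
    have := ringKrullDim_ne_bot (R := R)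
    generalize ringKrullDim R = d at *
    match d with
    | ⊥ => simp at this
    | ⊤ => simp at h
    | (n : ℕ) => exact ⟨n, rfl⟩
  refine ⟨n + 1, (dlt_iff_dim _ _).2 ?_⟩
  rw [h1, hn]
  exact_mod_cast Nat.lt_succ_self n

end
end LCoh
end

section
open CategoryTheory
namespace LCoh
open IsLocalRing
section
variable {R : Type u} [CommRing R] [IsNoetherianRing R] (l : List R)

/-- the submodule `xM` -/
abbrev xM (x : R) (M : Type u) [AddCommGroup M] [Module R M] : Submodule R M :=
  LinearMap.range (x • LinearMap.id : M →ₗ[R] M)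

lemma mem_xM {x : R} {M : Type u} [AddCommGroup M] [Module R M] (m : M) : m ∈ xM x M ↔ ∃ m', m = x • m' := by
  simp [xM, eq_comm]

lemma ann_quot {x : R} {M : Type u} [AddCommGroup M] [Module R M] :
    Module.annihilator R M ⊔ Ideal.span {x} ≤ Module.annihilator R (M ⧸ xM x M) := by
  rw [sup_le_iff, Ideal.span_singleton_le_iff_mem]
  constructor
  · exact LinearMap.annihilator_le_of_surjective _ (Submodule.mkQ_surjective _)
  · rw [Module.mem_annihilator]
    intro z
    obtain ⟨z, rfl⟩ := Submodule.mkQ_surjective _ z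
    rw [← map_smul, Submodule.mkQ_apply, Submodule.Quotient.mk_eq_zero, mem_xM]
    exact ⟨z, rfl⟩

lemma reg_of_prime {p : Ideal R} [hp : p.IsPrime] {N : Type u} [AddCommGroup N] [Module R N] (e : N ≃ₗ[R] R ⧸ p)
    {x : R} (hx : x ∉ p) (m : N) (hm : x • m = 0) : m = 0 := by
  have h : x • e m = 0 := by rw [← map_smul, hm, map_zero]
  obtain ⟨y, hy⟩ := Ideal.Quotient.mk_surjective (e m)
  have : y ∈ p := (hp.mem_or_mem (x := x) (y := y) (by
    rw [← Ideal.Quotient.eq_zero_iff_mem, map_mul, hy]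
    rw [Algebra.smul_def] at h; exact h)).resolve_left hx
  have h2 : e m = 0 := by rw [← hy, Ideal.Quotient.eq_zero_iff_mem.2 this]
  exact (map_eq_zero_iff e e.injective).1 h2

lemma ann_of_equiv {p : Ideal R} {N : Type u} [AddCommGroup N] [Module R N] (e : N ≃ₗ[R] R ⧸ p) :
    Module.annihilator R N = p := by
  rw [e.annihilator_eq, Ideal.annihilator_quotient]

theorem van (P : Ideal R) [hP : P.IsPrime] (n : ℕ) (M : Type u) [AddCommGroup M] [Module R M]
    [hM : Module.Finite R M] (h : Dlt (Module.annihilator R M) P n) (i : ℤ) (hi : (n : ℤ) ≤ i) (z : H l i M) :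
    ∃ s : R, s ∉ P ∧ s • z = 0 := by
  induction n generalizing M i with
  | zero =>
    obtain ⟨s, hs, hsP⟩ := SetLike.not_le_iff_exists.1 ((Dlt.zero_iff hP).1 h)
    exact ⟨s, hsP, H.smul_zero_of l i s (fun m => Module.mem_annihilator.1 hs m) z⟩
  | succ n ih =>
    induction hM using IsNoetherianRing.induction_on_isQuotientEquivQuotientPrime R with
    | subsingleton N => exact ⟨1, hP.one_notMem, by rw [H.of_sub l i z, smul_zero]⟩
    | quotient N p e =>
      have hp := p.2
      rw [ann_of_equiv e] at h
      by_cases hl : ∀ x ∈ l, x ∈ p.1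
      · refine ⟨1, hP.one_notMem, ?_⟩
        rw [H.of_tors l i (by lia) (fun m x hx => ⟨1, ?_⟩) z, smul_zero]
        rw [pow_one]
        exact Module.mem_annihilator.1 (show x ∈ Module.annihilator R N by rw [ann_of_equiv e]; exact hl x hx) m
      · push Not at hl
        obtain ⟨x, hxl, hxp⟩ := hl
        obtain ⟨δ, -, h2, -⟩ := H.mul_delta l (i - 1) x (reg_of_prime e hxp) i (by lia) (xM x N) mem_xM
        have key : ∀ z : H l i N, x • z = 0 → ∃ s : R, s ∉ P ∧ s • z = 0 := by
          intro z hz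
          obtain ⟨w, rfl⟩ := (h2 z).2 hz
          obtain ⟨s, hs, hsw⟩ := ih (N ⧸ xM x N) (by
            refine Dlt.mono (h.of_lt hp (J := p.1 ⊔ Ideal.span {x}) ?_) ?_ le_rfl
            · refine lt_of_le_of_ne le_sup_left fun h3 => hxp ?_
              rw [h3]; exact Submodule.mem_sup_right (Ideal.mem_span_singleton_self x)
            · have := ann_quot (x := x) (M := N)
              rwa [ann_of_equiv e] at this) (i - 1) (by lia) w
          exact ⟨s, hs, by rw [← map_smul, hsw, map_zero]⟩
        obtain ⟨k, hk⟩ := H.tors l i x hxl z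
        have : ∀ k, ∀ z : H l i N, x ^ k • z = 0 → ∃ s : R, s ∉ P ∧ s • z = 0 := by
          intro k
          induction k with
          | zero => intro z hz; exact ⟨1, hP.one_notMem, by simpa using hz⟩
          | succ k ihk =>
            intro z hz
            obtain ⟨s, hs, hsz⟩ := key (x ^ k • z) (by rw [← mul_smul, ← pow_succ', hz])
            obtain ⟨t, ht, htz⟩ := ihk (s • z) (by rw [smul_comm, hsz])
            exact ⟨t * s, fun h => (hP.mem_or_mem h).elim ht hs, by rw [mul_smul, htz]⟩
        exact this k z hk
    | exact N₁ N₂ N₃ f g hf hg hfg h₁ h₃ =>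
      obtain ⟨s, hs, hsz⟩ := h₃ (h.mono (LinearMap.annihilator_le_of_surjective _ hg) le_rfl) (H.map l i g z)
      rw [← map_smul] at hsz
      obtain ⟨w, hw⟩ := (H.exact_mid l i hf hfg hg _).1 hsz
      obtain ⟨t, ht, htw⟩ := h₁ (h.mono (LinearMap.annihilator_le_of_injective _ hf) le_rfl) w
      exact ⟨t * s, fun h => (hP.mem_or_mem h).elim ht hs, by rw [mul_smul, ← hw, ← map_smul, htw, map_zero]⟩

lemma vanm [IsLocalRing R] {n : ℕ} {M : Type u} [AddCommGroup M] [Module R M]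
    [hM : Module.Finite R M] (h : Dlt (Module.annihilator R M) (maximalIdeal R) n) {i : ℤ} (hi : (n : ℤ) ≤ i)
    (z : H l i M) : z = 0 := by
  obtain ⟨s, hs, hsz⟩ := van l (maximalIdeal R) n M h i hi z
  have hu : IsUnit s := by simpa using hs
  exact hu.smul_eq_zero.1 hsz

/-- right exactness: `H^i(M)/xH^i(M) = H^i(M/xM)` -/
lemma H.coker (x : R) (M : Type u) [AddCommGroup M] [Module R M] (i : ℤ)
    (h : ∀ z : H l (i + 1) (LinearMap.ker (x • LinearMap.id : M →ₗ[R] M)), z = 0) (z : H l i M) :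
    H.map l i (xM x M).mkQ z = 0 ↔ ∃ w, z = x • w := by
  let f : M →ₗ[R] M := x • LinearMap.id
  have he : Function.Exact (xM x M).subtype (xM x M).mkQ := LinearMap.exact_subtype_mkQ _
  have hs := H.map_surj l i (a := (LinearMap.ker f).subtype) (b := f.rangeRestrict)
    (Submodule.injective_subtype _) (by
      intro y; simp [Subtype.ext_iff]) f.surjective_rangeRestrict (i + 1) rfl h
  have hc : ∀ w, x • w = H.map l i (xM x M).subtype (H.map l i f.rangeRestrict w) := by
    intro w
    rw [← H.map_comp_apply, ← H.map_smul_id]; rfl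
  constructor
  · intro hz
    obtain ⟨w, rfl⟩ := (H.exact_mid l i (Submodule.injective_subtype _) he (Submodule.mkQ_surjective _) _).1 hz
    obtain ⟨v, rfl⟩ := hs w
    exact ⟨v, (hc v).symm⟩
  · rintro ⟨w, rfl⟩
    rw [hc]
    exact (H.exact_mid l i (Submodule.injective_subtype _) he (Submodule.mkQ_surjective _) _).2 ⟨_, rfl⟩

/-- `H^i(M)` divisible by `x` in top degree -/
lemma divm [IsLocalRing R] {n : ℕ} {M : Type u} [AddCommGroup M] [Module R M] [hM : Module.Finite R M] (x : R)
    (h : Dlt (Module.annihilator R M) (maximalIdeal R) (n + 1))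
    (h' : Dlt (Module.annihilator R M ⊔ Ideal.span {x}) (maximalIdeal R) n) {i : ℤ} (hi : (n : ℤ) ≤ i)
    (z : H l i M) : ∃ w, z = x • w :=
  (H.coker l x M i (fun z => vanm l (h.mono (LinearMap.annihilator_le_of_injective _
    (Submodule.injective_subtype _)) le_rfl) (by push_cast; lia) z) z).1 (vanm l (h'.mono ann_quot le_rfl) hi _)

end
end LCoh
end

section
open CategoryTheory
namespace LCoh
open IsLocalRing
section
variable {R : Type u} [CommRing R] [IsNoetherianRing R] (l : List R)

/-- the ideal generated by a list -/
abbrev sp (l : List R) : Ideal R := Ideal.span {x | x ∈ l}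

lemma mem_sp {l : List R} {x : R} (hx : x ∈ l) : x ∈ sp l := Ideal.subset_span hx

lemma tor_of_list {A : Type u} [AddCommGroup A] [Module R A]
    (h : ∀ x ∈ l, ∀ a : A, ∃ k : ℕ, x ^ k • a = 0) : Tor (sp l) A := by
  intro x hx a
  let K : Ideal R := LinearMap.ker (LinearMap.toSpanSingleton R A a)
  have h1 : sp l ≤ K.radical := Ideal.span_le.2 fun y hy => by
    obtain ⟨k, hk⟩ := h y hy a
    exact ⟨k, by simpa [K] using hk⟩
  obtain ⟨k, hk⟩ := h1 hx
  exact ⟨k, by simpa [K] using hk⟩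

lemma H.torI (i : ℤ) (M : Type u) [AddCommGroup M] [Module R M] : Tor (sp l) (H l i M) :=
  tor_of_list l fun x hx => H.tors l i x hx

lemma H.ann_le (i : ℤ) (M : Type u) [AddCommGroup M] [Module R M] :
    Module.annihilator R M ≤ Module.annihilator R (H l i M) := fun s hs =>
  Module.mem_annihilator.2 fun z => H.smul_zero_of l i s (fun m => Module.mem_annihilator.1 hs m) z

lemma Tor.of_rad {J K : Ideal R} {A : Type u} [AddCommGroup A] [Module R A] (h : Tor J A)
    (hK : K ≤ (J ⊔ Module.annihilator R A).radical) : Tor K A := by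
  intro x hx a
  obtain ⟨k, hk⟩ := hK hx
  obtain ⟨y, hy, z, hz, hyz⟩ := Submodule.mem_sup.1 hk
  obtain ⟨j, hj⟩ := h y hy a
  refine ⟨k * j, ?_⟩
  rw [pow_mul, ← hyz]
  have : ∀ j : ℕ, (y + z) ^ j • a = y ^ j • a := by
    intro j
    induction j with
    | zero => simp
    | succ j ih => rw [pow_succ', mul_smul, ih, add_smul, Module.mem_annihilator.1 hz, add_zero,
        ← mul_smul, ← pow_succ']
  rw [this, hj]

lemma H.torm [IsLocalRing R] (i : ℤ) (M : Type u) [AddCommGroup M] [Module R M]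
    (hM : maximalIdeal R ≤ (sp l ⊔ Module.annihilator R M).radical) : Tor (maximalIdeal R) (H l i M) :=
  (H.torI l i M).of_rad (hM.trans (Ideal.radical_mono (sup_le_sup_left (H.ann_le l i M) _)))

variable [IsLocalRing R]

lemma dlt_one {J : Ideal R} (h : maximalIdeal R ≤ J.radical) : Dlt J (maximalIdeal R) 1 := by
  rintro Q hQ h1 ⟨Q', h2, h3, h4⟩
  have : maximalIdeal R ≤ Q := h.trans (hQ.radical_le_iff.2 h1)
  exact (h3.trans_le h4).not_ge this

lemma dlt_of_sub {A : Type u} [AddCommGroup A] [Module R A] (h : ∀ a : A, a = 0) (n : ℕ) :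
    Dlt (Module.annihilator R A) (maximalIdeal R) n := by
  intro Q hQ h1 _
  exact hQ.ne_top ((Ideal.eq_top_iff_one _).2 (h1 (Module.mem_annihilator.2 fun a => by rw [h a, smul_zero])))

lemma art_of_sub {A : Type u} [AddCommGroup A] [Module R A] (h : ∀ a : A, a = 0) : IsArtinian R A := by
  have : Subsingleton A := ⟨fun a b => by rw [h a, h b]⟩
  infer_instance

theorem lemC [IsAdicComplete (maximalIdeal R) R] (n : ℕ) (M : Type u) [AddCommGroup M] [Module R M]
    [hM : Module.Finite R M] (h : maximalIdeal R ≤ (sp l ⊔ Module.annihilator R M).radical) :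
    IsArtinian R (H l n M) ∧ Dlt (Module.annihilator R (H l n M)) (maximalIdeal R) (n + 1) := by
  induction n generalizing M with
  | zero =>
    obtain ⟨e, he⟩ := H.zero l
    obtain ⟨-, h1, -⟩ := he M M LinearMap.id
    have hf : Module.Finite R (H l 0 M) := Module.Finite.of_injective (e M) h1
    have ht := H.torm l 0 M h
    refine ⟨art_of_fin ht, dlt_one fun x hx => ?_⟩
    obtain ⟨k, hk⟩ := tor_fin_kill x (ht x hx)
    exact ⟨k, Module.mem_annihilator.2 hk⟩
  | succ n ih =>
    induction hM using IsNoetherianRing.induction_on_isQuotientEquivQuotientPrime R with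
    | subsingleton N => exact ⟨art_of_sub (H.of_sub l _), dlt_of_sub (H.of_sub l _) _⟩
    | quotient N p e =>
      have hp := p.2
      have h' := h
      rw [ann_of_equiv e] at h
      by_cases hl : ∀ x ∈ l, x ∈ p.1
      · have : ∀ z : H l (n + 1 : ℕ) N, z = 0 := H.of_tors l _ (by lia) (fun m x hx => ⟨1, by
          rw [pow_one]
          exact Module.mem_annihilator.1 (show x ∈ Module.annihilator R N by
            rw [ann_of_equiv e]; exact hl x hx) m⟩)
        exact ⟨art_of_sub this, dlt_of_sub this _⟩
      · push Not at hl
        obtain ⟨x, hxl, hxp⟩ := hl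
        by_cases hxm : x ∈ maximalIdeal R
        · obtain ⟨δ, -, h2, -⟩ := H.mul_delta l (n : ℤ) x (reg_of_prime e hxp) (n + 1 : ℕ) (by simp) (xM x N) mem_xM
          obtain ⟨ih1, ih2⟩ := ih (N ⧸ xM x N) (h'.trans (Ideal.radical_mono (sup_le_sup_left (le_sup_left.trans ann_quot) _)))
          have hk : LinearMap.ker (x • LinearMap.id : H l (n + 1 : ℕ) N →ₗ[R] _) = LinearMap.range δ := by
            ext z; rw [h2]; simp
          have hA : IsArtinian R (H l (n + 1 : ℕ) N) := art_of_x x (H.tors l _ x hxl) (by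
            rw [hk]; exact isArtinian_of_surjective _ δ.rangeRestrict δ.surjective_rangeRestrict)
          refine ⟨hA, Dlt.drop hxm (ih2.radical fun f hf => ?_)⟩
          obtain ⟨r, hr⟩ := lemmaB_complete (H l (n + 1 : ℕ) N) (H.torm l _ N h') ann0_fin_of_art (Ideal.span {x}) f
            (fun a ha => by
              obtain ⟨w, rfl⟩ := (h2 a).2 (mem_ann0.1 ha x (Ideal.mem_span_singleton_self x))
              rw [← map_smul, Module.mem_annihilator.1 hf, map_zero])
          exact ⟨r, by rwa [sup_comm]⟩
        · have : ∀ z : H l (n + 1 : ℕ) N, z = 0 := fun z => by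
            obtain ⟨k, hk⟩ := H.tors l _ x hxl z
            have hu : IsUnit x := by simpa using hxm
            exact (hu.pow k).smul_eq_zero.1 hk
          exact ⟨art_of_sub this, dlt_of_sub this _⟩
    | exact N₁ N₂ N₃ f g hf hg hfg h₁ h₃ =>
      obtain ⟨a1, d1⟩ := h₁ (h.trans (Ideal.radical_mono (sup_le_sup_left (LinearMap.annihilator_le_of_injective _ hf) _)))
      obtain ⟨a3, d3⟩ := h₃ (h.trans (Ideal.radical_mono (sup_le_sup_left (LinearMap.annihilator_le_of_surjective _ hg) _)))
      have he := H.exact_mid l (n + 1 : ℕ) hf hfg hg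
      refine ⟨isArtinian_of_range_eq_ker _ _ (LinearMap.exact_iff.1 he).symm, (d1.mul d3).mono ?_ le_rfl⟩
      refine Ideal.mul_le.2 fun s hs t ht => Module.mem_annihilator.2 fun z => ?_
      obtain ⟨w, hw⟩ := (he (t • z)).1 (by rw [map_smul]; exact Module.mem_annihilator.1 ht _)
      rw [mul_smul, ← hw, ← map_smul, Module.mem_annihilator.1 hs, map_zero]

end
end LCoh
end

section
open CategoryTheory
namespace LCoh
open IsLocalRing
section
variable {R : Type u} [CommRing R] [IsNoetherianRing R] (l : List R)

/-- prime avoidance for a finite set of primes -/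
lemma avoid_fin (S : Set (Ideal R)) (hS : S.Finite) (hp : ∀ Q ∈ S, Q.IsPrime) (a : Ideal R)
    (h : ∀ Q ∈ S, ¬ a ≤ Q) : ∃ y ∈ a, ∀ Q ∈ S, y ∉ Q := by
  by_contra! hc
  have := (Ideal.subset_union_prime (s := hS.toFinset) (f := id) ⊥ ⊥
    (fun i hi _ _ => hp i (by simpa using hi)) (I := a)).1 (by
      intro y hy
      obtain ⟨Q, hQ, hyQ⟩ := hc y hy
      simp only [Set.mem_iUnion]
      exact ⟨Q, by simpa using hQ, hyQ⟩)
  obtain ⟨Q, hQ, h1⟩ := this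
  exact h Q (by simpa using hQ) h1

lemma top_primes_min {B P : Ideal R} {n : ℕ} (hB : Dlt B P (n + 1)) {Q : Ideal R} (hQ : Q.IsPrime)
    (hBQ : B ≤ Q) (hc : Ch n Q P) : Q ∈ B.minimalPrimes := by
  obtain ⟨Q', h1, h2⟩ := Ideal.exists_minimalPrimes_le hBQ
  rcases h2.lt_or_eq with h3 | rfl
  · exact absurd ⟨Q, hQ, h3, hc⟩ (hB Q' h1.1.1 h1.1.2)
  · exact h1

lemma avoid_top {B P a : Ideal R} {n : ℕ} (hB : Dlt B P (n + 1)) (ha : Dlt a P n) :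
    ∃ y ∈ a, ∀ Q : Ideal R, Q.IsPrime → B ≤ Q → Ch n Q P → y ∉ Q := by
  obtain ⟨y, hy, h⟩ := avoid_fin {Q | Q.IsPrime ∧ B ≤ Q ∧ Ch n Q P}
    ((Ideal.finite_minimalPrimes_of_isNoetherianRing R B).subset fun Q hQ =>
      top_primes_min hB hQ.1 hQ.2.1 hQ.2.2) (fun Q hQ => hQ.1) a (fun Q hQ h => ha Q hQ.1 h hQ.2.2)
  exact ⟨y, hy, fun Q h1 h2 h3 => h Q ⟨h1, h2, h3⟩⟩

variable [IsLocalRing R]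

lemma ann_cyc {N : Type u} [AddCommGroup N] [Module R N] (f : R →ₗ[R] N) (hf : Function.Surjective f) :
    Module.annihilator R N = LinearMap.ker f := by
  rw [← (f.quotKerEquivOfSurjective hf).annihilator_eq]
  exact Ideal.annihilator_quotient

theorem nonvan_step [IsAdicComplete (maximalIdeal R) R] (hl : ∀ x ∈ l, x ∈ maximalIdeal R) (e : ℕ)
    (N : Type u) [AddCommGroup N] [Module R N] (f : R →ₗ[R] N) (hf : Function.Surjective f)
    (hN : maximalIdeal R ≤ (sp l ⊔ Module.annihilator R N).radical)
    (hd : Dlt (Module.annihilator R N) (maximalIdeal R) (e + 1))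
    (hc : ¬ Dlt (Module.annihilator R N) (maximalIdeal R) e) 
    (ih : ∀ (p : Ideal R) (_ : p.IsPrime), maximalIdeal R ≤ (sp l ⊔ p).radical → 
      Dlt p (maximalIdeal R) (e + 1) → Ch e p (maximalIdeal R) → ∃ z : H l e (R ⧸ p), z ≠ 0) : 
    ∃ z : H l e N, z ≠ 0 := by
  have hfin : Module.Finite R N := Module.Finite.of_surjective f hf
  simp only [Dlt] at hc
  push Not at hc
  obtain ⟨p, hp, hNp, hcp⟩ := hc
  obtain ⟨z, hz⟩ := ih p hp (hN.trans (Ideal.radical_mono (sup_le_sup_left hNp _))) (hd.mono hNp le_rfl) hcp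
  rw [ann_cyc f hf] at hNp
  let g : N →ₗ[R] R ⧸ p := (LinearMap.ker f).mapQ p LinearMap.id hNp ∘ₗ (f.quotKerEquivOfSurjective hf).symm.toLinearMap
  have hg : Function.Surjective g := by
    intro y
    obtain ⟨r, rfl⟩ := Ideal.Quotient.mk_surjective y
    refine ⟨f r, ?_⟩
    have : (f.quotKerEquivOfSurjective hf).symm (f r) = Submodule.Quotient.mk r := by
      rw [LinearEquiv.symm_apply_eq]; rfl
    simp only [g, LinearMap.comp_apply, LinearEquiv.coe_coe, this]
    rfl
  obtain ⟨w, hw⟩ := H.map_surj l e (a := (LinearMap.ker g).subtype) (b := g) (Submodule.injective_subtype _)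
    (LinearMap.exact_subtype_ker_map _) hg (e + 1) rfl (vanm l (hd.mono (LinearMap.annihilator_le_of_injective _ 
      (Submodule.injective_subtype _)) le_rfl) (by simp)) z
  exact ⟨w, fun h => hz (by rw [← hw, h, map_zero])⟩

theorem nonvan_prime [IsAdicComplete (maximalIdeal R) R] (hl : ∀ x ∈ l, x ∈ maximalIdeal R) (e : ℕ)
    (p : Ideal R) (hp : p.IsPrime) (h : maximalIdeal R ≤ (sp l ⊔ p).radical)
    (hd : Dlt p (maximalIdeal R) (e + 1)) (hc : Ch e p (maximalIdeal R)) : ∃ z : H l e (R ⧸ p), z ≠ 0 := by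
  induction e generalizing p with
  | zero =>
    have hpm : p = maximalIdeal R := by
      by_contra hne
      exact hd p hp le_rfl (Ch.one (maximalIdeal.isMaximal R).isPrime (lt_of_le_of_ne hc hne))
    subst hpm
    obtain ⟨e, he⟩ := H.zero l
    obtain ⟨-, h1, h2⟩ := he (R ⧸ maximalIdeal R) (R ⧸ maximalIdeal R) LinearMap.id
    obtain ⟨z, hz⟩ := (h2 1).2 fun x hx => ⟨1, by
      rw [pow_one, Algebra.smul_def, mul_one]
      exact Ideal.Quotient.eq_zero_iff_mem.2 (hl x hx)⟩
    refine ⟨z, fun h => ?_⟩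
    rw [h, map_zero] at hz
    exact zero_ne_one hz
  | succ e ih =>
    by_contra! hz
    obtain ⟨x, hxl, hxp⟩ : ∃ x ∈ l, x ∉ p := by
      by_contra! hcon
      have h1 : sp l ≤ p := Ideal.span_le.2 hcon
      rw [sup_eq_right.2 h1, hp.radical] at h
      obtain ⟨Q', h2, h3, h4⟩ := hc
      exact (h3.trans_le h4.le).not_ge h
    have hann : Module.annihilator R (R ⧸ p) = p := Ideal.annihilator_quotient
    have hreg : ∀ k : ℕ, ∀ y : R ⧸ p, x ^ k • y = 0 → y = 0 := fun k =>
      reg_of_prime (LinearEquiv.refl R _) (fun h => hxp (hp.mem_of_pow_mem k h))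
    have hann1 : Module.annihilator R ((R ⧸ p) ⧸ xM x (R ⧸ p)) ≤ p ⊔ Ideal.span {x} := by
      intro a ha
      have h1 := Module.mem_annihilator.1 ha (Submodule.Quotient.mk 1)
      rw [← Submodule.Quotient.mk_smul, Submodule.Quotient.mk_eq_zero, mem_xM] at h1
      obtain ⟨y, hy⟩ := h1
      obtain ⟨y, rfl⟩ := Ideal.Quotient.mk_surjective y
      have h2 : a - x * y ∈ p := by
        rw [← Ideal.Quotient.eq_zero_iff_mem, map_sub, map_mul, sub_eq_zero]
        rw [Algebra.smul_def, Algebra.smul_def, mul_one] at hy; exact hy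
      rw [show a = (a - x * y) + y * x by ring]
      exact Submodule.add_mem_sup h2 (Ideal.mul_mem_left _ _ (Ideal.mem_span_singleton_self x))
    have hlt : p < p ⊔ Ideal.span {x} := lt_of_le_of_ne le_sup_left fun h3 => hxp (by
      rw [h3]; exact Submodule.mem_sup_right (Ideal.mem_span_singleton_self x))
    have hann2 : p ⊔ Ideal.span {x} ≤ Module.annihilator R ((R ⧸ p) ⧸ xM x (R ⧸ p)) := by
      have := ann_quot (x := x) (M := R ⧸ p); rwa [hann] at this
    have hdW : Dlt (Module.annihilator R ((R ⧸ p) ⧸ xM x (R ⧸ p))) (maximalIdeal R) (e + 1) :=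
      (hd.of_lt hp hlt).mono hann2 le_rfl
    -- the nonzero element
    obtain ⟨w, hw⟩ := nonvan_step l hl e ((R ⧸ p) ⧸ xM x (R ⧸ p))
      ((xM x (R ⧸ p)).mkQ ∘ₗ Submodule.mkQ p) ((Submodule.mkQ_surjective _).comp (Submodule.mkQ_surjective _))
      (h.trans (Ideal.radical_mono (sup_le_sup_left (le_sup_left.trans hann2) _))) hdW
      (fun hh => hd.not_ch hp |> fun _ => (Dlt.drop (hl x hxl) (hh.mono hann1 le_rfl)).not_ch hp hc)
      ih
    apply hw
    obtain ⟨δ, hδ1, hδ2, hδ3⟩ := H.mul_delta l e x (by simpa using hreg 1) (e + 1 : ℕ) (by simp) (xM x (R ⧸ p)) mem_xM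
    have hsurj : ∀ w : H l e ((R ⧸ p) ⧸ xM x (R ⧸ p)), ∃ a, H.map l e (xM x (R ⧸ p)).mkQ a = w := fun w =>
      (hδ1 w).1 (hz _)
    have hA := (lemC l e (R ⧸ p) (by rwa [hann])).1
    obtain ⟨n, hn⟩ := IsArtinian.range_smul_pow_stabilizes (R := R) (M := H l e (R ⧸ p)) x
    have hn' : ∀ a : H l e (R ⧸ p), ∃ b, x ^ n • (a - x • b) = 0 := by
      intro a
      have : x ^ n • a ∈ LinearMap.range (x ^ (n + 1) • LinearMap.id : H l e (R ⧸ p) →ₗ[R] _) := by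
        rw [← hn (n + 1) (by lia)]; exact ⟨a, rfl⟩
      obtain ⟨b, hb⟩ := this
      refine ⟨b, ?_⟩
      rw [smul_sub, ← mul_smul, ← pow_succ, ← hb]
      simp
    obtain ⟨𝔞, ha1, ha2⟩ : ∃ 𝔞 : Ideal R, Dlt 𝔞 (maximalIdeal R) e ∧
        ∀ a : H l e (R ⧸ p), x ^ n • a = 0 → ∀ y ∈ 𝔞, y • a = 0 := by
      cases e with
      | zero =>
        obtain ⟨δ', -, hδ2', -⟩ := H.mul_delta l (-1) (x ^ n) (hreg n) ((0 : ℕ) : ℤ) (by simp) (xM (x ^ n) (R ⧸ p)) mem_xM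
        refine ⟨⊤, fun Q hQ h1 _ => hQ.ne_top (top_le_iff.1 h1), fun a ha y _ => ?_⟩
        obtain ⟨v, rfl⟩ := (hδ2' a).2 ha
        rw [H.neg l _ (by simp) v, map_zero, smul_zero]
      | succ k =>
        obtain ⟨δ', -, hδ2', -⟩ := H.mul_delta l k (x ^ n) (hreg n) ((k + 1 : ℕ) : ℤ) (by simp) (xM (x ^ n) (R ⧸ p)) mem_xM
        refine ⟨_, (lemC l k ((R ⧸ p) ⧸ xM (x ^ n) (R ⧸ p)) (h.trans (Ideal.radical_mono
          (sup_le_sup_left (hann.ge.trans (le_sup_left.trans ann_quot)) _)))).2, fun a ha y hy => ?_⟩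
        obtain ⟨v, rfl⟩ := (hδ2' a).2 ha
        rw [← map_smul, Module.mem_annihilator.1 hy, map_zero]
    obtain ⟨y, hy, hyQ⟩ := avoid_top hdW ha1
    obtain ⟨v, rfl⟩ := divm l y hdW (hdW.succ_of hyQ) (le_refl (e : ℤ)) w
    obtain ⟨a, rfl⟩ := hsurj v
    obtain ⟨b, hb⟩ := hn' a
    rw [← map_smul, hδ3]
    have := ha2 _ hb y hy
    exact ⟨y • b, by rw [smul_sub, sub_eq_zero] at this; rw [this, smul_comm]⟩

theorem nonvan [IsAdicComplete (maximalIdeal R) R] (hl : ∀ x ∈ l, x ∈ maximalIdeal R) (e : ℕ)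
    (N : Type u) [AddCommGroup N] [Module R N] (f : R →ₗ[R] N) (hf : Function.Surjective f)
    (hN : maximalIdeal R ≤ (sp l ⊔ Module.annihilator R N).radical)
    (hd : Dlt (Module.annihilator R N) (maximalIdeal R) (e + 1))
    (hc : ¬ Dlt (Module.annihilator R N) (maximalIdeal R) e) : ∃ z : H l e N, z ≠ 0 :=
  nonvan_step l hl e N f hf hN hd hc fun p hp => nonvan_prime l hl e p hp

end
end LCoh
end

section
open CategoryTheory
namespace LCoh
open IsLocalRing
section
variable {R : Type u} [CommRing R] [IsNoetherianRing R] (l : List R)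

lemma Tor.of_ker {A : Type u} [AddCommGroup A] [Module R A] (J : Ideal R) (x : R)
    (hx : ∀ a : A, ∃ k : ℕ, x ^ k • a = 0) (h : ∀ y ∈ J, ∀ a : A, x • a = 0 → ∃ k : ℕ, y ^ k • a = 0) :
    Tor J A := by
  intro y hy a
  obtain ⟨k, hk⟩ := hx a
  induction k generalizing a with
  | zero => exact ⟨0, by simpa using hk⟩
  | succ k ih =>
    obtain ⟨j, hj⟩ := h y hy (x ^ k • a) (by rw [← mul_smul, ← pow_succ', hk])
    obtain ⟨i, hi⟩ := ih (y ^ j • a) (by rw [smul_comm, hj])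
    exact ⟨i + j, by rw [pow_add, mul_smul, hi]⟩

lemma Tor.ext {A B C : Type u} [AddCommGroup A] [Module R A] [AddCommGroup B] [Module R B]
    [AddCommGroup C] [Module R C] {J : Ideal R} {f : A →ₗ[R] B} {g : B →ₗ[R] C}
    (h : Function.Exact f g) (hA : Tor J A) (hC : Tor J C) : Tor J B := by
  intro y hy b
  obtain ⟨j, hj⟩ := hC y hy (g b)
  obtain ⟨a, ha⟩ := (h (y ^ j • b)).1 (by rw [map_smul, hj])
  obtain ⟨i, hi⟩ := hA y hy a
  exact ⟨i + j, by rw [pow_add, mul_smul, ← ha, ← map_smul, hi, map_zero]⟩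

lemma ann_ext {A B C : Type u} [AddCommGroup A] [Module R A] [AddCommGroup B] [Module R B]
    [AddCommGroup C] [Module R C] {f : A →ₗ[R] B} {g : B →ₗ[R] C}
    (h : Function.Exact f g) : Module.annihilator R A * Module.annihilator R C ≤ Module.annihilator R B := by
  refine Ideal.mul_le.2 fun s hs t ht => Module.mem_annihilator.2 fun z => ?_
  obtain ⟨w, hw⟩ := (h (t • z)).1 (by rw [map_smul]; exact Module.mem_annihilator.1 ht _)
  rw [mul_smul, ← hw, ← map_smul, Module.mem_annihilator.1 hs, map_zero]

lemma fin_ext {A B C : Type u} [AddCommGroup A] [Module R A] [AddCommGroup B] [Module R B]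
    [AddCommGroup C] [Module R C] {f : A →ₗ[R] B} {g : B →ₗ[R] C}
    (h : Function.Exact f g) [Module.Finite R A] [Module.Finite R C] : Module.Finite R B := by
  have h1 : IsNoetherian R B := isNoetherian_of_range_eq_ker f g (LinearMap.exact_iff.1 h).symm
  infer_instance

lemma rad_mul {J a b K : Ideal R} (h : K ≤ (J ⊔ a).radical) (h' : K ≤ (J ⊔ b).radical) :
    K ≤ (J ⊔ a * b).radical := by
  intro x hx
  obtain ⟨i, hi⟩ := h hx
  obtain ⟨j, hj⟩ := h' hx
  refine ⟨i + j, ?_⟩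
  rw [pow_add]
  have : (J ⊔ a) * (J ⊔ b) ≤ J ⊔ a * b := by
    refine Ideal.mul_le.2 fun r hr s hs => ?_
    obtain ⟨r1, hr1, r2, hr2, rfl⟩ := Submodule.mem_sup.1 hr
    obtain ⟨s1, hs1, s2, hs2, rfl⟩ := Submodule.mem_sup.1 hs
    rw [show (r1 + r2) * (s1 + s2) = (r1 * (s1 + s2) + r2 * s1) + r2 * s2 by ring]
    exact Submodule.add_mem_sup (J.add_mem (J.mul_mem_right _ hr1) (J.mul_mem_left _ hs1)) (Ideal.mul_mem_mul hr2 hs2)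
  exact this (Ideal.mul_mem_mul hi hj)

variable [IsLocalRing R]

lemma ann0_pow_fin (A : Type u) [AddCommGroup A] [Module R A] [IsArtinian R A] (k : ℕ) :
    Module.Finite R (ann0 (maximalIdeal R ^ k) A) := by
  induction k with
  | zero =>
    have : ann0 (maximalIdeal R ^ 0) A = ⊥ := by
      rw [eq_bot_iff]; intro a ha
      have := mem_ann0.1 ha 1 (by simp)
      simpa using this
    rw [this]; infer_instance
  | succ k ih =>
    obtain ⟨L, hL⟩ := exists_list (maximalIdeal R)
    have hmem : ∀ j : Fin L.length, L.get j ∈ maximalIdeal R := fun j => by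
      rw [hL]; exact Ideal.subset_span (List.get_mem L j)
    let g : ann0 (maximalIdeal R ^ (k + 1)) A →ₗ[R] (Fin L.length → ann0 (maximalIdeal R ^ k) A) :=
      LinearMap.pi fun j => (((L.get j) • LinearMap.id : A →ₗ[R] A)).restrict fun a ha => mem_ann0.2 fun y hy => by
        have := mem_ann0.1 ha (y * L.get j) (by rw [pow_succ]; exact Ideal.mul_mem_mul hy (hmem j))
        simpa [mul_smul] using this
    have h1 : Module.Finite R (ann0 (maximalIdeal R) A) := ann0_fin_of_art
    have hk : Module.Finite R (LinearMap.ker g) := by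
      refine Module.Finite.of_injective (((ann0 (maximalIdeal R ^ (k + 1)) A).subtype ∘ₗ (LinearMap.ker g).subtype).codRestrict
        (ann0 (maximalIdeal R) A) fun a => ?_) ?_
      · have hann : ann0 (maximalIdeal R) A = ann0 (Ideal.span {x | x ∈ L}) A := by rw [← hL]
        rw [hann, mem_ann0_list]
        intro x hx
        obtain ⟨j, rfl⟩ := List.get_of_mem hx
        have := congrFun (LinearMap.mem_ker.1 a.2) j
        exact congrArg Subtype.val this
      · rw [← LinearMap.ker_eq_bot, LinearMap.ker_codRestrict, LinearMap.ker_eq_bot]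
        exact (Submodule.injective_subtype _).comp (Submodule.injective_subtype _)
    exact fin_ext (f := (LinearMap.ker g).subtype) (g := g) (LinearMap.exact_subtype_ker_map _)

lemma fin_of_art_kill {A : Type u} [AddCommGroup A] [Module R A] [IsArtinian R A]
    (h : maximalIdeal R ≤ (Module.annihilator R A).radical) : Module.Finite R A := by
  obtain ⟨k, hk⟩ := Ideal.exists_pow_le_of_le_radical_of_fg h (IsNoetherian.noetherian _)
  have := ann0_pow_fin (R := R) A k
  refine Module.Finite.of_injective (LinearMap.id.codRestrict (ann0 (maximalIdeal R ^ k) A) fun a =>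
    mem_ann0.2 fun y hy => Module.mem_annihilator.1 (hk hy) a) fun a b hab => congrArg Subtype.val hab

theorem HL [IsAdicComplete (maximalIdeal R) R] (n : ℕ) (M : Type u) [AddCommGroup M] [Module R M]
    [hM : Module.Finite R M] (h : Dlt (Module.annihilator R M) (maximalIdeal R) (n + 1)) :
    Tor (maximalIdeal R) (H l n M) ∧ IsArtinian R (H l n M) ∧
    maximalIdeal R ≤ (sp l ⊔ Module.annihilator R (H l n M)).radical := by
  induction n generalizing M with
  | zero =>
    have h0 : maximalIdeal R ≤ (Module.annihilator R M).radical := by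
      rw [Ideal.radical_eq_sInf]
      refine le_sInf fun Q hQ => ?_
      by_contra hc
      have hQ' := hQ.2
      refine h Q hQ.2 hQ.1 (Ch.one (maximalIdeal.isMaximal R).isPrime (lt_of_le_not_ge (le_maximalIdeal hQ.2.ne_top) hc))
    have h1 := h0.trans (Ideal.radical_mono (H.ann_le l 0 M))
    have h2 := h0.trans (Ideal.radical_mono (le_sup_right (a := sp l)))
    refine ⟨H.torm l _ M h2, (lemC l 0 M h2).1, h1.trans (Ideal.radical_mono le_sup_right)⟩
  | succ n ih =>
    have triv : ∀ (A : Type u) [AddCommGroup A] [Module R A], (∀ z : A, z = 0) →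
        Tor (maximalIdeal R) A ∧ IsArtinian R A ∧ maximalIdeal R ≤ (sp l ⊔ Module.annihilator R A).radical :=
      fun A _ _ hA => ⟨fun x _ a => ⟨0, by rw [hA a, smul_zero]⟩, art_of_sub hA, by
        rw [show Module.annihilator R A = ⊤ from (Ideal.eq_top_iff_one _).2
          (Module.mem_annihilator.2 fun a => by rw [hA a, smul_zero]), sup_top_eq, Ideal.radical_top]; exact le_top⟩
    induction hM using IsNoetherianRing.induction_on_isQuotientEquivQuotientPrime R with
    | subsingleton N => exact triv _ (H.of_sub l _)
    | quotient N p e =>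
      have hp := p.2
      have h' := h
      rw [ann_of_equiv e] at h
      by_cases hl : ∀ x ∈ l, x ∈ p.1
      · exact triv _ (H.of_tors l _ (by lia) (fun m x hx => ⟨1, by
          rw [pow_one]
          exact Module.mem_annihilator.1 (show x ∈ Module.annihilator R N by
            rw [ann_of_equiv e]; exact hl x hx) m⟩))
      · push Not at hl
        obtain ⟨x, hxl, hxp⟩ := hl
        obtain ⟨δ, -, h2, -⟩ := H.mul_delta l (n : ℤ) x (reg_of_prime e hxp) (n + 1 : ℕ) (by simp) (xM x N) mem_xM
        obtain ⟨ih1, ih2, ih3⟩ := ih (N ⧸ xM x N) (by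
            refine Dlt.mono (h.of_lt hp (J := p.1 ⊔ Ideal.span {x}) ?_) ?_ le_rfl
            · refine lt_of_le_of_ne le_sup_left fun h3 => hxp ?_
              rw [h3]; exact Submodule.mem_sup_right (Ideal.mem_span_singleton_self x)
            · have := ann_quot (x := x) (M := N)
              rwa [ann_of_equiv e] at this)
        have hk : LinearMap.ker (x • LinearMap.id : H l (n + 1 : ℕ) N →ₗ[R] _) = LinearMap.range δ := by
          ext z; rw [h2]; simp
        have hA : IsArtinian R (H l (n + 1 : ℕ) N) := art_of_x x (H.tors l _ x hxl) (by
          rw [hk]; exact isArtinian_of_surjective _ δ.rangeRestrict δ.surjective_rangeRestrict)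
        have hT : Tor (maximalIdeal R) (H l (n + 1 : ℕ) N) := Tor.of_ker _ x (H.tors l _ x hxl) fun y hy a ha => by
          obtain ⟨w, rfl⟩ := (h2 a).2 ha
          obtain ⟨k, hk⟩ := ih1 y hy w
          exact ⟨k, by rw [← map_smul, hk, map_zero]⟩
        refine ⟨hT, hA, prim_of_art _ hT _ ?_⟩
        refine fin_of_art_kill (ih3.trans (Ideal.radical_mono (sup_le ?_ ?_)))
        · exact fun y hy => Module.mem_annihilator.2 fun a => Subtype.ext (mem_ann0.1 a.2 y hy)
        · refine fun y hy => Module.mem_annihilator.2 fun a => Subtype.ext ?_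
          obtain ⟨w, hw⟩ := (h2 a.1).2 (mem_ann0.1 a.2 x (mem_sp hxl))
          change y • a.1 = 0
          rw [← hw, ← map_smul, Module.mem_annihilator.1 hy, map_zero]
    | exact N₁ N₂ N₃ f g hf hg hfg h₁ h₃ =>
      obtain ⟨t1, a1, d1⟩ := h₁ (h.mono (LinearMap.annihilator_le_of_injective _ hf) le_rfl)
      obtain ⟨t3, a3, d3⟩ := h₃ (h.mono (LinearMap.annihilator_le_of_surjective _ hg) le_rfl)
      have he := H.exact_mid l (n + 1 : ℕ) hf hfg hg
      refine ⟨t1.ext he t3, isArtinian_of_range_eq_ker _ _ (LinearMap.exact_iff.1 he).symm,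
        (rad_mul d1 d3).trans (Ideal.radical_mono (sup_le_sup_left (ann_ext he) _))⟩

theorem HL_zero [IsAdicComplete (maximalIdeal R) R] (n : ℕ) (p : Ideal R) (hp : p.IsPrime)
    (h : Dlt p (maximalIdeal R) (n + 1)) (hl : ¬ maximalIdeal R ≤ (sp l ⊔ p).radical) (z : H l n (R ⧸ p)) : z = 0 := by
  have hann : Module.annihilator R (R ⧸ p) = p := Ideal.annihilator_quotient
  obtain ⟨-, -, h3⟩ := HL l n (R ⧸ p) (by rwa [hann])
  have : ¬ Module.annihilator R (H l n (R ⧸ p)) ≤ p := fun hc =>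
    hl (h3.trans (Ideal.radical_mono (sup_le_sup_left hc _)))
  obtain ⟨x, hx, hxp⟩ := SetLike.not_le_iff_exists.1 this
  obtain ⟨w, rfl⟩ := divm l x (n := n) (M := R ⧸ p) (by rwa [hann]) (by
    rw [hann]
    refine h.of_lt hp (lt_of_le_of_ne le_sup_left fun h3 => hxp ?_)
    rw [h3]; exact Submodule.mem_sup_right (Ideal.mem_span_singleton_self x)) le_rfl z
  exact Module.mem_annihilator.1 hx w

end
end LCoh
end

section
open CategoryTheory
namespace LCoh
open IsLocalRing
section
variable {R : Type u} [CommRing R] [IsNoetherianRing R]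

lemma kht_mid {q q1 P : Ideal R} (hq : q.IsPrime) (hq1 : q1.IsPrime) (hP : P.IsPrime) (h1 : q < q1) (h2 : q1 < P)
    {x : R} (hx : x ∈ P) : ∃ q' : Ideal R, q'.IsPrime ∧ x ∈ q' ∧ q < q' ∧ q' < P := by
  obtain ⟨q', h3, h4, h5⟩ := PrimeSpectrum.exist_mem_one_of_mem_two (p₀ := ⟨q, hq⟩) (p₁ := ⟨q1, hq1⟩) (p₂ := ⟨P, hP⟩)
    h1 h2 hx
  exact ⟨q'.asIdeal, q'.2, h3, h4, h5⟩

lemma sp_cons (f : R) (l : List R) : sp (f :: l) = sp l ⊔ Ideal.span {f} := by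
  have : {x | x ∈ f :: l} = {x | x ∈ l} ∪ {f} := by ext x; simp [or_comm]
  change Ideal.span {x | x ∈ f :: l} = _
  rw [this, Ideal.span_union]

lemma mem_sup_span {J : Ideal R} {y : R} : y ∈ J ⊔ Ideal.span {y} :=
  Submodule.mem_sup_right (Ideal.mem_span_singleton_self y)

lemma sup_span_le {J P : Ideal R} {y : R} (h : J ≤ P) (hy : y ∈ P) : J ⊔ Ideal.span {y} ≤ P :=
  sup_le h ((Ideal.span_singleton_le_iff_mem _).2 hy)

lemma kht {q P : Ideal R} (hq : q.IsPrime) {y : R} (hP : P ∈ (q ⊔ Ideal.span {y}).minimalPrimes) {q1 : Ideal R}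
    (hq1 : q1.IsPrime) (h1 : q < q1) (h2 : q1 < P) : False := by
  obtain ⟨q', h3, h4, h5, h6⟩ := kht_mid hq hq1 hP.1.1 h1 h2 (x := y) (hP.1.2 mem_sup_span)
  exact h6.not_ge (hP.2 ⟨h3, sup_span_le h5.le h4⟩ h6.le)

lemma Ch.drop {n : ℕ} {Q P : Ideal R} (hQ : Q.IsPrime) (hP : P.IsPrime) (h : Ch (n + 1) Q P) {x : R} (hx : x ∈ P) :
    ∃ Q1 : Ideal R, Q1.IsPrime ∧ Q ≤ Q1 ∧ x ∈ Q1 ∧ Ch n Q1 P := by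
  induction n generalizing Q with
  | zero => exact ⟨P, hP, h.le, hx, le_rfl⟩
  | succ n ih =>
    obtain ⟨Q', h1, h2, h3⟩ := h
    by_cases hxQ : x ∈ Q'
    · exact ⟨Q', h1, h2.le, hxQ, h3⟩
    · obtain ⟨Q1, h4, h5, h6, h7⟩ := ih h1 h3
      have h8 : Q' < Q1 := lt_of_le_of_ne h5 (by rintro rfl; exact hxQ h6)
      obtain ⟨Q2, h9, h10, h11, h12⟩ := kht_mid hQ h1 h4 h2 h8 h6
      exact ⟨Q2, h9, h11.le, h10, Q1, h4, h12, h7⟩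

lemma le_rad_of {J K : Ideal R} (h : ∀ P : Ideal R, P.IsPrime → J ≤ P → K ≤ P) : K ≤ J.radical := by
  rw [Ideal.radical_eq_sInf]
  exact le_sInf fun P hP => h P hP.2 hP.1

lemma rad_le_of {J K P : Ideal R} (hP : P.IsPrime) (h : K ≤ J.radical) (hJ : J ≤ P) : K ≤ P :=
  h.trans (hP.radical_le_iff.2 hJ)

variable [IsLocalRing R]

instance : (maximalIdeal R).IsPrime := (maximalIdeal.isMaximal R).isPrime

lemma le_m {P : Ideal R} (hP : P.IsPrime) : P ≤ maximalIdeal R := le_maximalIdeal hP.ne_top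

lemma lt_m {P : Ideal R} (hP : P.IsPrime) (h : P ≠ maximalIdeal R) : P < maximalIdeal R := (le_m hP).lt_of_ne h

lemma eq_m_of_dlt2 {q P : Ideal R} (hq : q.IsPrime) (h : Dlt q (maximalIdeal R) 2) (hP : P.IsPrime) (hqP : q < P) :
    P = maximalIdeal R := by
  by_contra hc
  exact h.not_ch hq ⟨P, hP, hqP, Ch.one inferInstance (lt_m hP hc)⟩

theorem cat1 [IsAdicComplete (maximalIdeal R) R] {p0 q : Ideal R} (hp : p0.IsPrime) (hq : q.IsPrime) (hpq : p0 ≤ q)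
    (hqm : q ≠ maximalIdeal R) (hq2 : Dlt q (maximalIdeal R) 2) {d : ℕ} (hd : Dlt p0 (maximalIdeal R) (d + 2))
    (hc : Ch (d + 1) p0 (maximalIdeal R)) : Ch d p0 q := by
  by_contra hcon
  have hcon' : Dlt p0 q d := (dlt_iff hp).2 hcon
  obtain ⟨f, hfm, hfq⟩ := SetLike.exists_of_lt (lt_m hq hqm)
  obtain ⟨l, hl⟩ := exists_list q
  have hann : Module.annihilator R (R ⧸ p0) = p0 := Ideal.annihilator_quotient
  have hsp : sp (f :: l) = q ⊔ Ideal.span {f} := by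
    rw [sp_cons, hl]
  have hlm : ∀ x ∈ f :: l, x ∈ maximalIdeal R := by
    intro x hx
    rcases List.mem_cons.1 hx with rfl | hx
    · exact hfm
    · exact le_m hq (by rw [hl]; exact mem_sp hx)
  obtain ⟨z, hz⟩ := nonvan_prime (f :: l) hlm (d + 1) p0 hp (le_rad_of fun P hP h => by
    rw [hsp] at h
    have : q < P := lt_of_le_of_ne (le_sup_left.trans (le_sup_left.trans h)) (by
      rintro rfl; exact hfq (h (Ideal.mem_sup_left mem_sup_span)))
    rw [eq_m_of_dlt2 hq hq2 hP this]) hd hc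
  obtain ⟨L, _, _, ι, δ, a, hι, h1, h2, h3⟩ := H.exists_loc l (d : ℕ) (M := R ⧸ p0) f (d + 1 : ℕ) (by push_cast; rfl)
  have haz : a z = 0 := HL_zero l (d + 1) p0 hp hd (by
    change ¬ _ ≤ (Ideal.span {x | x ∈ l} ⊔ p0).radical
    rw [← hl, sup_eq_left.2 hpq, hq.radical]
    exact (lt_m hq hqm).not_ge) _
  obtain ⟨w, rfl⟩ := (h2 z).1 haz
  apply hz
  rw [loc_sub (f := f) ι _ w, map_zero]
  intro v
  obtain ⟨s, hs, hsv⟩ := van l q d (R ⧸ p0) (by rwa [hann]) d le_rfl v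
  have : maximalIdeal R ≤ (Ideal.torsionOf R _ v).radical := le_rad_of fun P hP h => by
    have hqP : q ≤ P := fun x hx => by
      obtain ⟨k, hk⟩ := H.torI l d (R ⧸ p0) x (by rw [hl] at hx; exact hx) v
      exact hP.mem_of_pow_mem k (h (by rwa [Ideal.mem_torsionOf_iff]))
    rw [eq_m_of_dlt2 hq hq2 hP (lt_of_le_of_ne hqP (by
      rintro rfl; exact hs (h (by rwa [Ideal.mem_torsionOf_iff]))))]
  obtain ⟨n, hn⟩ := this hfm
  exact ⟨n, by rwa [Ideal.mem_torsionOf_iff] at hn⟩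

lemma e1 {Q : Ideal R} (hQ : Q.IsPrime) (hQm : Q ≠ maximalIdeal R) {s : R} (hsm : s ∈ maximalIdeal R) (hsQ : s ∉ Q) :
    ∃ q : Ideal R, q.IsPrime ∧ Q ≤ q ∧ s ∉ q ∧ q ≠ maximalIdeal R ∧ Dlt q (maximalIdeal R) 2 := by
  obtain ⟨q, ⟨hq, hQq, hsq⟩, hmax⟩ := set_has_maximal_iff_noetherian.2 (inferInstance : IsNoetherian R R)
    {q : Ideal R | q.IsPrime ∧ Q ≤ q ∧ s ∉ q} ⟨Q, hQ, le_rfl, hsQ⟩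
  refine ⟨q, hq, hQq, hsq, by rintro rfl; exact hsq hsm, ?_⟩
  rw [dlt_iff hq]
  rintro ⟨q1, h1, h2, h3⟩
  have hq1m : q1 < maximalIdeal R := by
    obtain ⟨q2, h4, h5, h6⟩ := h3
    exact h5.trans_le h6
  -- every prime above q contains s
  have hs : ∀ P : Ideal R, P.IsPrime → q < P → s ∈ P := fun P hP hqP => by
    by_contra hc; exact hmax P ⟨hP, hQq.trans hqP.le, hc⟩ hqP
  obtain ⟨y, hy, hyS⟩ := avoid_fin (Ideal.minimalPrimes (q ⊔ Ideal.span {s}))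
    (Ideal.finite_minimalPrimes_of_isNoetherianRing R _) (fun P hP => hP.1.1) (maximalIdeal R) (fun P hP hmP => by
      have h4 := le_antisymm (le_m hP.1.1) hmP
      subst h4
      exact kht hq hP h1 h2 hq1m)
  have hyq : y ∉ q := fun h => by
    obtain ⟨P, hP, _⟩ := Ideal.exists_minimalPrimes_le (sup_span_le (le_m hq) hsm)
    exact hyS P hP (hP.1.2 (Ideal.mem_sup_left h))
  obtain ⟨Q2, h4, h5⟩ := Ideal.exists_minimalPrimes_le (sup_span_le (le_m hq) hy)
  have h6 : q < Q2 := lt_of_le_of_ne (le_sup_left.trans h4.1.2) (by rintro rfl; exact hyq (h4.1.2 mem_sup_span))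
  have := h4.1.1
  obtain ⟨P, h7, h8⟩ := Ideal.exists_minimalPrimes_le (sup_span_le h6.le (hs Q2 h4.1.1 h6))
  refine kht hq h4 h7.1.1 (lt_of_le_of_ne (le_sup_left.trans h7.1.2) ?_) (lt_of_le_of_ne h8 ?_)
  · rintro rfl; exact hsq (h7.1.2 mem_sup_span)
  · rintro rfl; exact hyS _ h7 (h4.1.2 mem_sup_span)

theorem cat2 [IsAdicComplete (maximalIdeal R) R] {p0 Q : Ideal R} (hp : p0.IsPrime) (hQ : Q.IsPrime) (hpQ : p0 < Q)
    (hb : ∀ P : Ideal R, P.IsPrime → p0 < P → P < Q → False) {d : ℕ} (hd : Dlt p0 (maximalIdeal R) (d + 2))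
    (hc : Ch (d + 1) p0 (maximalIdeal R)) : Ch d Q (maximalIdeal R) := by
  obtain ⟨y, hyQ, hyp⟩ := SetLike.exists_of_lt hpQ
  by_cases hQm : Q = maximalIdeal R
  · subst hQm
    obtain ⟨Q1, h1, h2, h3, h4⟩ := hc.drop hp hQ hyQ
    have : Q1 = maximalIdeal R := by
      by_contra hne
      exact hb Q1 h1 (lt_of_le_of_ne h2 (by rintro rfl; exact hyp h3)) (lt_m h1 hne)
    rwa [this] at h4
  have hQmin : Q ∈ (p0 ⊔ Ideal.span {y}).minimalPrimes := by
    refine ⟨⟨hQ, sup_span_le hpQ.le hyQ⟩, fun P hP hPQ => ?_⟩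
    rcases hPQ.lt_or_eq with h | h
    · refine (hb P hP.1 (lt_of_le_of_ne (le_sup_left.trans hP.2) ?_) h).elim
      rintro rfl; exact hyp (hP.2 mem_sup_span)
    · exact h.ge
  obtain ⟨s, hsm, hsQ, hs⟩ : ∃ s ∈ maximalIdeal R, s ∉ Q ∧ ∀ P ∈ (p0 ⊔ Ideal.span {y}).minimalPrimes, P ≠ Q → s ∈ P := by
    have hfin := (Ideal.finite_minimalPrimes_of_isNoetherianRing R (p0 ⊔ Ideal.span {y})).subset
      (Set.diff_subset (t := {Q}))
    have : ¬ (maximalIdeal R ⊓ hfin.toFinset.inf id) ≤ Q := by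
      rw [hQ.inf_le, not_or]
      refine ⟨(lt_m hQ hQm).not_ge, fun h => ?_⟩
      obtain ⟨P, hP, hPQ⟩ := (hQ.inf_le' (s := hfin.toFinset) (f := id)).1 h
      rw [Set.Finite.mem_toFinset] at hP
      exact hP.2 (le_antisymm hPQ (hQmin.2 hP.1.1 hPQ))
    obtain ⟨s, hs, hsQ⟩ := SetLike.not_le_iff_exists.1 this
    refine ⟨s, hs.1, hsQ, fun P hP hPQ => ?_⟩
    exact (Finset.inf_le (f := id) (b := P) (by rw [Set.Finite.mem_toFinset]; exact ⟨hP, hPQ⟩) : _ ≤ P) hs.2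
  obtain ⟨q, hq, hQq, hsq, hqm, hq2⟩ := e1 hQ hQm hsm hsQ
  have h1 := cat1 hp hq (hpQ.le.trans hQq) hqm hq2 hd hc
  cases d with
  | zero => exact le_m hQ
  | succ d =>
    obtain ⟨Q1, h2, h3, h4, h5⟩ := h1.drop hp hq (hQq hyQ)
    obtain ⟨P, hP, hPQ1⟩ := Ideal.exists_minimalPrimes_le (sup_span_le h3 h4)
    have : P = Q := by
      by_contra hne
      exact hsq (h5.le (hPQ1 (hs P hP hne)))
    subst this
    exact (h5.left hPQ1).trans (Ch.one inferInstance (lt_m hq hqm))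

theorem cat3 [IsAdicComplete (maximalIdeal R) R] {p0 p : Ideal R} (hp0 : p0.IsPrime) (hp : p.IsPrime) (hle : p0 ≤ p)
    {d : ℕ} (hd : Dlt p0 (maximalIdeal R) (d + 1)) (hc : Ch d p0 (maximalIdeal R)) :
    ∃ a b, a + b = d ∧ Ch a p0 p ∧ Ch b p (maximalIdeal R) := by
  induction d generalizing p0 with
  | zero =>
    have : p0 = p := by
      by_contra hne
      exact hd.not_ch hp0 ⟨p, hp, lt_of_le_of_ne hle hne, le_m hp⟩
    subst this
    exact ⟨0, 0, rfl, hle, hc⟩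
  | succ d ih =>
    rcases hle.eq_or_lt with h | h
    · subst h
      exact ⟨0, d + 1, by lia, le_rfl, hc⟩
    · obtain ⟨y, hyQ, hyp⟩ := SetLike.exists_of_lt h
      obtain ⟨Q, hQ, hQp⟩ := Ideal.exists_minimalPrimes_le (sup_span_le hle hyQ)
      have hpQ : p0 < Q := lt_of_le_of_ne (le_sup_left.trans hQ.1.2) (by rintro rfl; exact hyp (hQ.1.2 mem_sup_span))
      have h2 := cat2 hp0 hQ.1.1 hpQ (fun P hP h1 h2 => kht hp0 hQ hP h1 h2) hd hc
      obtain ⟨a, b, hab, h3, h4⟩ := ih hQ.1.1 hQp (hd.of_lt hp0 hpQ) h2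
      exact ⟨a + 1, b, by lia, ⟨Q, hQ.1.1, hpQ, h3⟩, h4⟩

/-- every proper ideal has a dimension -/
lemma exists_dim (J : Ideal R) (hJ : J ≤ maximalIdeal R) :
    ∃ d, Dlt J (maximalIdeal R) (d + 1) ∧ ∃ Q : Ideal R, Q.IsPrime ∧ J ≤ Q ∧ Ch d Q (maximalIdeal R) := by
  classical
  have h : ∃ n, Dlt J (maximalIdeal R) n := by
    obtain ⟨n, hn⟩ := exists_dlt (R := R)
    exact ⟨n, hn.mono bot_le le_rfl⟩
  have h0 := Nat.find_spec h
  cases h1 : Nat.find h with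
  | zero =>
    rw [h1] at h0
    exact ((Dlt.zero_iff inferInstance).1 h0 hJ).elim
  | succ d =>
    rw [h1] at h0
    have := Nat.find_min h (m := d) (by lia)
    unfold Dlt at this
    push Not at this
    exact ⟨d, h0, this⟩

lemma exists_dim_prime (p : Ideal R) (hp : p.IsPrime) :
    ∃ d, Dlt p (maximalIdeal R) (d + 1) ∧ Ch d p (maximalIdeal R) := by
  obtain ⟨d, h1, Q, h2, h3, h4⟩ := exists_dim p (le_m hp)
  exact ⟨d, h1, h4.left h3⟩

end
end LCoh
end

section
open CategoryTheory
namespace LCoh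
open IsLocalRing
section
variable {R : Type u} [CommRing R] 

/-- `Γ_K(A)` -/
def TS (K : Ideal R) (A : Type u) [AddCommGroup A] [Module R A] : Submodule R A where
  carrier := {a | ∀ x ∈ K, ∃ k : ℕ, x ^ k • a = 0}
  zero_mem' := fun x _ => ⟨0, by simp⟩
  add_mem' := fun {a b} ha hb x hx => by
    obtain ⟨k, hk⟩ := ha x hx
    obtain ⟨n, hn⟩ := hb x hx
    refine ⟨k + n, ?_⟩
    rw [smul_add, pow_add, mul_smul, mul_smul, hn, smul_zero, add_zero, smul_comm, hk, smul_zero]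
  smul_mem' := fun r a ha x hx => by
    obtain ⟨k, hk⟩ := ha x hx
    exact ⟨k, by rw [smul_comm, hk, smul_zero]⟩

variable {A B : Type u} [AddCommGroup A] [Module R A] [AddCommGroup B] [Module R B]

lemma mem_TS {K : Ideal R} {a : A} : a ∈ TS K A ↔ ∀ x ∈ K, ∃ k : ℕ, x ^ k • a = 0 := Iff.rfl

lemma TS.tor (K : Ideal R) : Tor K (TS K A) := fun x hx a => by
  obtain ⟨k, hk⟩ := a.2 x hx
  exact ⟨k, Subtype.ext hk⟩

lemma mem_TS_rad {K : Ideal R} {a : A} : a ∈ TS K A ↔ K ≤ (Ideal.torsionOf R A a).radical := by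
  constructor
  · intro h x hx
    obtain ⟨k, hk⟩ := h x hx
    exact ⟨k, by rwa [Ideal.mem_torsionOf_iff]⟩
  · intro h x hx
    obtain ⟨k, hk⟩ := h hx
    exact ⟨k, by rwa [Ideal.mem_torsionOf_iff] at hk⟩

lemma Tor.sub {K : Ideal R} (h : Tor K A) (S : Submodule R A) : Tor K S := h.of_inj S.subtype S.injective_subtype

lemma Tor.quot {K : Ideal R} (h : Tor K A) (S : Submodule R A) : Tor K (A ⧸ S) := h.of_surj S.mkQ S.mkQ_surjective

lemma Tor.top {K : Ideal R} (h : Tor K A) (hK : K = ⊤) (a : A) : a = 0 := by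
  obtain ⟨k, hk⟩ := h 1 (by rw [hK]; trivial) a
  simpa using hk

variable [IsNoetherianRing R]

/-- support of a torsion module is the support of the annihilated part -/
lemma tor_annX {J : Ideal R} (h : Tor J A) : Tor (Module.annihilator R (ann0 J A)) A := by
  intro a ha w
  obtain ⟨n, hn⟩ := h.pow_smul w
  refine ⟨n, ?_⟩
  induction n generalizing w with
  | zero => simpa using hn 1 (by simp)
  | succ n ih =>
    have h1 : a ^ n • w ∈ ann0 J A := mem_ann0.2 fun x hx => by
      rw [smul_comm]
      refine ih (x • w) fun y hy => ?_
      rw [← mul_smul]; exact hn _ (by rw [pow_succ]; exact Ideal.mul_mem_mul hy hx)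
    have := Module.mem_annihilator.1 ha ⟨_, h1⟩
    rw [pow_succ', mul_smul]
    exact congrArg Subtype.val this

lemma eq_zero_of_ann0 {J : Ideal R} (h : Tor J A) (h0 : ∀ a ∈ ann0 J A, a = 0) (a : A) : a = 0 := by
  obtain ⟨k, hk⟩ := tor_annX h 1 (Module.mem_annihilator.2 fun w => by rw [one_smul]; exact Subtype.ext (h0 _ w.2)) a
  simpa using hk

lemma ann0_sub_fin {J : Ideal R} (S : Submodule R A) (h : Module.Finite R (ann0 J A)) : Module.Finite R (ann0 J S) := by
  refine Module.Finite.of_injective (LinearMap.codRestrict (ann0 J A) (S.subtype ∘ₗ (ann0 J S).subtype) ?_) ?_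
  · intro c; exact mem_ann0.2 fun x hx => congrArg Subtype.val (mem_ann0.1 c.2 x hx)
  · intro a b hab
    exact Subtype.ext (Subtype.ext (congrArg (fun t : ann0 J A => t.1) hab))

section
variable [IsLocalRing R]

lemma TS_art {J : Ideal R} (hT : Tor J A) (h : Module.Finite R (ann0 J A)) {S : Submodule R A}
    (hS : Tor (maximalIdeal R) S) : IsArtinian R S := by
  by_cases hJ : J = ⊤
  · exact art_of_sub fun a => (hT.sub S).top hJ a
  · exact art_of_socle hS (fin_of_le (ann0_anti (le_maximalIdeal hJ) _) (ann0_sub_fin S h))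

lemma wg_kill {J : Ideal R} (hT : Tor J A) (h : Module.Finite R (ann0 J A)) {S : Submodule R A}
    (hS : Tor (maximalIdeal R) S) (f : R) (hf : f ∈ maximalIdeal R) :
    ∃ K : ℕ, ∀ w : A, (∀ x ∈ J, x • w ∈ S) → ∃ x ∈ ann0 J A, ∃ g ∈ S, f ^ K • w = x + g := by
  have := TS_art hT h hS
  haveI hfin := ann0_sub_fin S h
  obtain ⟨k, hk⟩ := tor_fin_kill (A := ann0 J S) f (fun a => by
    obtain ⟨k, hk⟩ := hS f hf a.1
    exact ⟨k, Subtype.ext hk⟩)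
  obtain ⟨r, hr⟩ := lemmaB (R := R) S ann0_fin_of_art
  refine ⟨k * r, fun w hw => ?_⟩
  -- common bound
  obtain ⟨l, hl⟩ := exists_list J
  have hbound : ∃ N, ∀ x ∈ l, ∀ y ∈ maximalIdeal R ^ (N + 1), y • (x • w) = 0 := by
    have hl' : ∀ x ∈ l, x ∈ J := fun x hx => by rw [hl]; exact Ideal.subset_span hx
    clear hl
    induction l with
    | nil => exact ⟨0, by simp⟩
    | cons x l ih =>
      obtain ⟨N, hN⟩ := ih fun x hx => hl' x (List.mem_cons_of_mem _ hx)
      obtain ⟨n, hn⟩ := hS.pow_smul ⟨x • w, hw x (hl' x (by simp))⟩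
      refine ⟨N + n, fun y hy z hz => ?_⟩
      rcases List.mem_cons.1 hy with rfl | hy
      · exact congrArg Subtype.val (hn z (Ideal.pow_le_pow_right (by lia) hz))
      · exact hN y hy z (Ideal.pow_le_pow_right (by lia) hz)
  obtain ⟨N, hN⟩ := hbound
  obtain ⟨i, hi, h2⟩ := hr N J (f ^ k) (fun a ha => congrArg Subtype.val (hk ⟨a, ha⟩))
  refine ⟨f ^ (k * r) • w - i • w, ?_, i • w, hw i hi, by simp⟩
  rw [hl, mem_ann0_list]
  intro x hx
  have hxJ : x ∈ J := by rw [hl]; exact Ideal.subset_span hx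
  have := h2 ⟨x • w, hw x hxJ⟩ (mem_ann0.2 fun y hy => Subtype.ext (hN x hx y hy))
  have := congrArg Subtype.val this
  rw [smul_sub, sub_eq_zero, pow_mul, smul_comm, smul_comm x i]
  exact this

lemma wg_fin {J : Ideal R} (hT : Tor J A) (h : Module.Finite R (ann0 J A)) {S : Submodule R A}
    (hS : Tor (maximalIdeal R) S) : Module.Finite R (ann0 J (A ⧸ S)) := by
  have := TS_art hT h hS
  obtain ⟨l, hl⟩ := exists_list J
  -- the target of the obstruction
  let D : S →ₗ[R] (Fin l.length → S) := LinearMap.pi fun j => l.get j • LinearMap.id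
  let W := (ann0 J (A ⧸ S)).comap S.mkQ
  have hW : ∀ w : W, ∀ x ∈ J, x • w.1 ∈ S := fun w x hx => by
    have := mem_ann0.1 w.2 x hx
    rwa [← map_smul, Submodule.mkQ_apply, Submodule.Quotient.mk_eq_zero] at this
  have hlJ : ∀ j, l.get j ∈ J := fun j => by rw [hl]; exact Ideal.subset_span (List.get_mem _ _)
  let ob : W →ₗ[R] (Fin l.length → S) := LinearMap.pi fun j =>
    LinearMap.codRestrict S (l.get j • W.subtype) (fun w => hW w _ (hlJ j))
  let T := LinearMap.range D
  let X' : Submodule R W := LinearMap.ker (T.mkQ ∘ₗ ob)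
  have hart : IsArtinian R (W ⧸ X') :=
    isArtinian_of_injective (Submodule.liftQ _ (T.mkQ ∘ₗ ob) le_rfl) (LinearMap.ker_eq_bot.1
      (Submodule.ker_liftQ_eq_bot _ _ _ le_rfl))
  have hX' : ∀ w : W, w ∈ X' ↔ ∃ x ∈ ann0 J A, ∃ g ∈ S, w.1 = x + g := by
    intro w
    rw [LinearMap.mem_ker, LinearMap.comp_apply, Submodule.mkQ_apply, Submodule.Quotient.mk_eq_zero]
    constructor
    · rintro ⟨g, hg⟩
      refine ⟨w.1 - g.1, ?_, g.1, g.2, by simp⟩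
      rw [hl, mem_ann0_list]
      intro x hx
      obtain ⟨j, rfl⟩ := List.get_of_mem hx
      have := congrArg Subtype.val (congrFun hg j)
      rw [smul_sub, sub_eq_zero]
      exact this.symm
    · rintro ⟨x, hx, g, hg, hw⟩
      refine ⟨⟨g, hg⟩, funext fun j => Subtype.ext ?_⟩
      change l.get j • g = l.get j • w.1
      rw [hw, smul_add, mem_ann0.1 hx _ (hlJ j), zero_add]
  -- killed by a power of the maximal ideal
  have hkill : maximalIdeal R ≤ (Module.annihilator R (W ⧸ X')).radical := fun f hf => by
    obtain ⟨K, hK⟩ := wg_kill hT h hS f hf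
    refine ⟨K, Module.mem_annihilator.2 fun w => ?_⟩
    obtain ⟨w, rfl⟩ := Submodule.mkQ_surjective _ w
    rw [← map_smul, Submodule.mkQ_apply, Submodule.Quotient.mk_eq_zero, hX']
    exact hK w.1 (hW w)
  have hfin : Module.Finite R (W ⧸ X') := fin_of_art_kill hkill
  -- map to a finite quotient
  let N := (ann0 J A).map S.mkQ
  have hN : Module.Finite R N := by
    rw [Module.Finite.iff_fg]
    exact Submodule.FG.map _ ((Module.Finite.iff_fg).1 h)
  have hNle : N ≤ ann0 J (A ⧸ S) := by
    rintro _ ⟨x, hx, rfl⟩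
    exact mem_ann0.2 fun y hy => by rw [← map_smul, mem_ann0.1 hx y hy, map_zero]
  let φ : W →ₗ[R] (A ⧸ S) ⧸ N := N.mkQ ∘ₗ S.mkQ ∘ₗ W.subtype
  have hφ : X' ≤ LinearMap.ker φ := by
    intro w hw
    obtain ⟨x, hx, g, hg, hw⟩ := (hX' w).1 hw
    rw [LinearMap.mem_ker]
    change N.mkQ (S.mkQ w.1) = 0
    rw [hw, map_add, Submodule.mkQ_apply _ g, (Submodule.Quotient.mk_eq_zero _).2 hg, add_zero,
      Submodule.mkQ_apply, Submodule.Quotient.mk_eq_zero]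
    exact ⟨x, hx, rfl⟩
  have h3 : Module.Finite R (LinearMap.range φ) := by
    have : LinearMap.range φ = LinearMap.range (X'.liftQ φ hφ) := by rw [Submodule.range_liftQ]
    rw [this]; infer_instance
  have h4 : (ann0 J (A ⧸ S)).map N.mkQ = LinearMap.range φ := by
    ext y; constructor
    · rintro ⟨z, hz, rfl⟩
      obtain ⟨w, rfl⟩ := Submodule.mkQ_surjective _ z
      exact ⟨⟨w, hz⟩, rfl⟩
    · rintro ⟨w, rfl⟩
      exact ⟨_, w.2, rfl⟩
  rw [Module.Finite.iff_fg]
  refine Submodule.fg_of_fg_map_of_fg_inf_ker N.mkQ (by rw [h4]; exact (Module.Finite.iff_fg).1 h3) ?_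
  rw [Submodule.ker_mkQ, inf_eq_right.2 hNle]
  exact (Module.Finite.iff_fg).1 hN

lemma nak {Y : Type u} [AddCommGroup Y] [Module R Y] [Module.Finite R Y] {f : R} (hf : f ∈ maximalIdeal R)
    (h : ∀ y : Y, ∃ y', y = f • y') (y : Y) : y = 0 := by
  have : (⊤ : Submodule R Y) = ⊥ := Submodule.eq_bot_of_le_smul_of_le_jacobson_bot (maximalIdeal R) ⊤
    (Module.Finite.fg_top) (fun y _ => by
      obtain ⟨y', rfl⟩ := h y
      exact Submodule.smul_mem_smul hf trivial) (maximalIdeal_le_jacobson _)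
  exact (Submodule.mem_bot R).1 (this ▸ (trivial : y ∈ (⊤ : Submodule R Y)))

lemma lemA_local {J : Ideal R} (hT : Tor J A) (h : Module.Finite R (ann0 J A)) {f : R} (hf : f ∈ maximalIdeal R)
    (hΓ : ∀ w : A, (∃ k : ℕ, f ^ k • w = 0) → w ∈ TS (maximalIdeal R) A)
    (hdiv : ∀ w : A, ∃ w' : A, ∃ k : ℕ, f ^ k • (w - f • w') = 0) (w : A) : w ∈ TS (maximalIdeal R) A := by
  let S := TS (maximalIdeal R) A
  have hmem : ∀ w : A, w ∈ S ↔ ∃ k : ℕ, f ^ k • w = 0 := fun w => ⟨fun h => h f hf, hΓ w⟩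
  haveI := wg_fin hT h (TS.tor (A := A) (maximalIdeal R))
  have hinj : ∀ y : A ⧸ S, f • y = 0 → y = 0 := by
    intro y hy
    obtain ⟨w, rfl⟩ := Submodule.mkQ_surjective _ y
    rw [← map_smul, Submodule.mkQ_apply, Submodule.Quotient.mk_eq_zero, hmem] at hy
    obtain ⟨k, hk⟩ := hy
    rw [Submodule.mkQ_apply, Submodule.Quotient.mk_eq_zero, hmem]
    exact ⟨k + 1, by rwa [pow_succ, mul_smul]⟩
  have hz : ∀ y : ann0 J (A ⧸ S), y = 0 := nak hf fun y => by
    obtain ⟨w, hw⟩ := Submodule.mkQ_surjective _ y.1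
    obtain ⟨w', k, hk⟩ := hdiv w
    have : y.1 = f • S.mkQ w' := by
      rw [← hw, ← map_smul, ← sub_eq_zero, ← map_sub, Submodule.mkQ_apply, Submodule.Quotient.mk_eq_zero, hmem]
      exact ⟨k, hk⟩
    refine ⟨⟨S.mkQ w', mem_ann0.2 fun x hx => hinj _ ?_⟩, Subtype.ext this⟩
    rw [smul_comm, ← this]
    exact mem_ann0.1 y.2 x hx
  have := eq_zero_of_ann0 (hT.quot S) (fun a ha => congrArg Subtype.val (hz ⟨a, ha⟩)) (S.mkQ w)
  rwa [Submodule.mkQ_apply, Submodule.Quotient.mk_eq_zero] at this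

end

theorem lemA {J : Ideal R} (hT : Tor J A) (h : Module.Finite R (ann0 J A)) {f : R} (q : Ideal R) [hq : q.IsPrime]
    (hf : f ∈ q)
    (hmin : ∀ P : Ideal R, P.IsPrime → Module.annihilator R (ann0 J A) ≤ P → f ∈ P → P ≤ q → P = q)
    (hdiv : ∀ w : A, ∃ s ∉ q, ∃ w' : A, ∃ k : ℕ, f ^ k • (s • w - f • w') = 0)
    (P : Ideal R) (hP : P.IsPrime) (hXP : Module.annihilator R (ann0 J A) ≤ P) (hPq : P ≤ q) : P = q := by
  let S := Localization.AtPrime q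
  let Aq := LocalizedModule q.primeCompl A
  let ι : A →ₗ[R] Aq := LocalizedModule.mkLinearMap q.primeCompl A
  have hmk : ∀ y : Aq, ∃ s ∉ q, ∃ a : A, s • y = ι a := fun y => by
    obtain ⟨⟨a, s⟩, hs⟩ := IsLocalizedModule.surj q.primeCompl ι y
    exact ⟨s.1, s.2, a, hs⟩
  have hker : ∀ a : A, ι a = 0 ↔ ∃ s ∉ q, s • a = 0 := fun a => by
    rw [IsLocalizedModule.eq_zero_iff q.primeCompl]
    exact ⟨fun ⟨c, hc⟩ => ⟨c.1, c.2, hc⟩, fun ⟨c, hc, hc'⟩ => ⟨⟨c, hc⟩, hc'⟩⟩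
  have hinj : ∀ s ∉ q, ∀ y : Aq, s • y = 0 → y = 0 := fun s hs y hy => by
    have := (Module.End.isUnit_iff _).1 (IsLocalizedModule.map_units (S := q.primeCompl) ι ⟨s, hs⟩)
    exact this.1 (by simpa using hy)
  have hinv : ∀ s ∉ q, ∀ y : Aq, ∃ y', y = s • y' := fun s hs y => by
    have := (Module.End.isUnit_iff _).1 (IsLocalizedModule.map_units (S := q.primeCompl) ι ⟨s, hs⟩)
    obtain ⟨y', h⟩ := this.2 y
    exact ⟨y', h.symm⟩
  have hTq : Tor (J.map (algebraMap R S)) Aq := by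
    have : ∀ x ∈ J.map (algebraMap R S), ∀ y : Aq, x ∈ (Ideal.torsionOf S Aq y).radical := by
      intro x hx y
      revert x
      change J.map (algebraMap R S) ≤ _
      rw [Ideal.map_le_iff_le_comap]
      intro x hx
      obtain ⟨s, hs, a, ha⟩ := hmk y
      obtain ⟨k, hk⟩ := hT x hx a
      refine ⟨k, ?_⟩
      rw [Ideal.mem_torsionOf_iff, ← map_pow, algebraMap_smul]
      exact hinj s hs _ (by rw [smul_comm, ha, ← map_smul, hk, map_zero])
    intro x hx y
    obtain ⟨k, hk⟩ := this x hx y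
    exact ⟨k, by rwa [Ideal.mem_torsionOf_iff] at hk⟩
  have hXq : ∀ y ∈ ann0 (J.map (algebraMap R S)) Aq, ∃ s ∉ q, ∃ a ∈ ann0 J A, s • y = ι a := by
    intro y hy
    obtain ⟨s, hs, a, ha⟩ := hmk y
    obtain ⟨l, hl⟩ := exists_list J
    have : ∃ t ∉ q, ∀ x ∈ l, t • x • a = 0 := by
      have hl' : ∀ x ∈ l, x ∈ J := fun x hx => by rw [hl]; exact Ideal.subset_span hx
      clear hl
      induction l with
      | nil => exact ⟨1, fun h => hq.ne_top ((Ideal.eq_top_iff_one _).2 h), by simp⟩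
      | cons x l ih =>
        obtain ⟨t, ht, h1⟩ := ih fun x hx => hl' x (List.mem_cons_of_mem _ hx)
        have h2 : ι (x • a) = 0 := by
          rw [map_smul, ← ha, smul_comm, ← algebraMap_smul S x y,
            mem_ann0.1 hy _ (Ideal.mem_map_of_mem _ (hl' x (by simp))), smul_zero]
        obtain ⟨t', ht', h3⟩ := (hker _).1 h2
        refine ⟨t * t', fun h => (hq.mem_or_mem h).elim ht ht', fun z hz => ?_⟩
        rcases List.mem_cons.1 hz with rfl | hz
        · rw [mul_smul, h3, smul_zero]
        · rw [mul_comm, mul_smul, h1 z hz, smul_zero]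
    obtain ⟨t, ht, h1⟩ := this
    refine ⟨t * s, fun h => (hq.mem_or_mem h).elim ht hs, t • a, ?_, by rw [mul_smul, ha, map_smul]⟩
    rw [hl, mem_ann0_list]
    intro x hx
    rw [smul_comm, h1 x hx]
  have hfin : Module.Finite S (ann0 (J.map (algebraMap R S)) Aq) := by
    obtain ⟨T, hT'⟩ := (Module.Finite.iff_fg (N := ann0 J A)).1 h
    rw [Module.Finite.iff_fg]
    have : ann0 (J.map (algebraMap R S)) Aq ≤ Submodule.span S (ι '' T) := by
      intro y hy
      obtain ⟨s, hs, a, ha, h1⟩ := hXq y hy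
      have h2 : ∀ a ∈ Submodule.span R (T : Set A), ι a ∈ Submodule.span S (ι '' T) := by
        intro a ha
        induction ha using Submodule.span_induction with
        | mem x hx => exact Submodule.subset_span ⟨x, hx, rfl⟩
        | zero => rw [map_zero]; exact zero_mem _
        | add x y _ _ hx hy => rw [map_add]; exact add_mem hx hy
        | smul r x _ hx => 
          rw [map_smul, ← algebraMap_smul S r]; exact Submodule.smul_mem _ _ hx
      have h3 : y = IsLocalization.mk' S 1 (⟨s, hs⟩ : q.primeCompl) • ι a := by
        rw [← h1, ← algebraMap_smul S s y, ← mul_smul, IsLocalization.mk'_spec, map_one, one_smul]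
      rw [h3]
      exact Submodule.smul_mem _ _ (h2 a (hT'.symm ▸ ha))
    haveI : Module.Finite S (Submodule.span S (ι '' (T : Set A))) := Module.Finite.span_of_finite S (T.finite_toSet.image ι)
    haveI : IsNoetherianRing S := IsLocalization.isNoetherianRing q.primeCompl S inferInstance
    exact (Module.Finite.iff_fg).1 (fin_of_le (R := S) ‹_ ≤ _› ‹_›)
  haveI : IsNoetherianRing S := IsLocalization.isNoetherianRing q.primeCompl S inferInstance
  have hfS : algebraMap R S f ∈ maximalIdeal S := by
    rw [← Localization.AtPrime.map_eq_maximalIdeal]; exact Ideal.mem_map_of_mem _ hf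
  have key := lemA_local hTq hfin hfS (by
    rintro w ⟨k, hk⟩
    rw [mem_TS_rad]
    refine le_rad_of fun P' hP' hle => ?_
    have h1 : P'.comap (algebraMap R S) = q := by
      refine hmin _ inferInstance ?_ ?_ ?_
      · intro a ha
        obtain ⟨s, hs, a0, ha0⟩ := hmk w
        obtain ⟨n, hn⟩ := tor_annX hT a ha a0
        refine hP'.mem_of_pow_mem n (hle ?_)
        rw [Ideal.mem_torsionOf_iff, ← map_pow, algebraMap_smul]
        exact hinj s hs _ (by rw [smul_comm, ha0, ← map_smul, hn, map_zero])
      · exact hP'.mem_of_pow_mem k (hle (by rwa [Ideal.mem_torsionOf_iff]))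
      · have := Ideal.comap_mono (f := algebraMap R S) (le_m hP')
        exact this.trans (IsLocalization.AtPrime.comap_maximalIdeal S q).le
    rw [← Localization.AtPrime.map_eq_maximalIdeal, Ideal.map_le_iff_le_comap, h1]) (by
    intro w
    obtain ⟨s, hs, a, ha⟩ := hmk w
    obtain ⟨t, ht, a', k, hk⟩ := hdiv a
    obtain ⟨w', hw'⟩ := hinv (t * s) (fun h => (hq.mem_or_mem h).elim ht hs) (ι a')
    refine ⟨w', k, hinj (t * s) (fun h => (hq.mem_or_mem h).elim ht hs) _ ?_⟩
    rw [← map_pow, algebraMap_smul, algebraMap_smul, smul_comm, smul_sub, smul_comm _ f, ← hw', mul_smul, ha, ← map_smul,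
      ← map_smul, ← map_sub, ← map_smul, hk, map_zero])
  refine hmin P hP hXP ?_ hPq
  by_contra hfP
  have hns : (⟨P, hP⟩ : PrimeSpectrum R) ∉ Module.support R (ann0 J A) := by
    rw [Module.notMem_support_iff']
    intro x
    obtain ⟨k, hk⟩ := key (ι x.1) _ hfS
    rw [← map_pow, algebraMap_smul, ← map_smul, hker] at hk
    obtain ⟨s, hs, hk⟩ := hk
    refine ⟨s * f ^ k, fun h => (hP.mem_or_mem h).elim (fun h => hs (hPq h)) (fun h => hfP (hP.mem_of_pow_mem k h)), ?_⟩
    exact Subtype.ext (by rw [mul_smul]; exact hk)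
  rw [Module.mem_support_iff_of_finite] at hns
  exact hns hXP

end
end LCoh
end

section
open CategoryTheory
namespace LCoh
open IsLocalRing
section
variable {R : Type u} [CommRing R] [IsNoetherianRing R] (l : List R)

lemma dev (i : ℤ) (M : Type u) [AddCommGroup M] [Module R M] [hM : Module.Finite R M]
    (h : ∀ p : Ideal R, p.IsPrime → Module.annihilator R M ≤ p → ∀ z : H l i (R ⧸ p), z = 0) :
    ∀ z : H l i M, z = 0 := by
  induction hM using IsNoetherianRing.induction_on_isQuotientEquivQuotientPrime R with
  | subsingleton N => exact H.of_sub l _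
  | quotient N p e =>
    intro z
    obtain ⟨e', he'⟩ := H.congr l i e
    have := h p.1 p.2 (ann_of_equiv e).le (e' z)
    exact e'.map_eq_zero_iff.1 this
  | exact N₁ N₂ N₃ f g hf hg hfg h₁ h₃ =>
    exact H.mid_zero l i hf hfg hg
      (h₁ fun p hp hle => h p hp ((LinearMap.annihilator_le_of_injective _ hf).trans hle))
      (h₃ fun p hp hle => h p hp ((LinearMap.annihilator_le_of_surjective _ hg).trans hle))

/-- `H^i` vanishes for `i > t` on finitely generated modules killed by `J`. -/
def Van (J : Ideal R) (t : ℤ) : Prop :=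
  ∀ (M : Type u) [AddCommGroup M] [Module R M] [Module.Finite R M], J ≤ Module.annihilator R M →
    ∀ i : ℤ, t < i → ∀ z : H l i M, z = 0

/-- finiteness of `0 :_{H^i(M)} I` -/
def CFin : Prop :=
  ∀ (M : Type u) [AddCommGroup M] [Module R M] [Module.Finite R M] (i : ℤ), Module.Finite R (ann0 (sp l) (H l i M))

variable {l}

lemma Van.mono {J J' : Ideal R} {t : ℤ} (h : Van l J t) (hJ : J ≤ J') : Van l J' t :=
  fun M _ _ _ hM i hi z => h M (hJ.trans hM) i hi z

lemma Van.surj {J : Ideal R} {t : ℤ} (h : Van l J t) {M N : Type u} [AddCommGroup M] [Module R M] [AddCommGroup N]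
    [Module R N] [Module.Finite R M] (hJ : J ≤ Module.annihilator R M) (g : M →ₗ[R] N) (hg : Function.Surjective g)
    (i : ℤ) (hi : t ≤ i) : Function.Surjective (H.map l i g) :=
  H.map_surj l i (LinearMap.ker g).injective_subtype (LinearMap.exact_subtype_ker_map g) hg (i + 1) rfl
    (h _ (hJ.trans (LinearMap.annihilator_le_of_injective _ (LinearMap.ker g).injective_subtype)) _ (by lia))

lemma Van.q_surj {J : Ideal R} {t : ℤ} (h : Van l J t) {p q : Ideal R} (hJ : J ≤ p) (hpq : p ≤ q)
    (i : ℤ) (hi : t ≤ i) : Function.Surjective (H.map l i (Submodule.factor hpq)) :=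
  h.surj (by rwa [Ideal.annihilator_quotient]) _ (Submodule.factor_surjective hpq) i hi

lemma Van.of [IsLocalRing R] {J : Ideal R} {t : ℤ} (h : ∀ i : ℤ, t < i → ∀ z : H l i (R ⧸ J), z = 0) : Van l J t := by
  obtain ⟨n, hn⟩ := exists_dlt (R := R)
  have key : ∀ k : ℕ, Van l J (max t (n - k)) := by
    intro k
    induction k with
    | zero =>
      intro M _ _ _ hM i hi z
      exact vanm l (hn.mono bot_le le_rfl) (by lia) z
    | succ k ih =>
      intro M _ _ _ hM i hi
      refine dev l i M fun p hp hle => ?_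
      intro z
      obtain ⟨w, rfl⟩ := ih.q_surj le_rfl (hM.trans hle) i (by push_cast at hi; lia) z
      rw [h i (by lia) w, map_zero]
  intro M _ _ _ hM i hi z
  exact key (n + t.natAbs) M hM i (by
    have := neg_abs_le t
    refine max_lt hi (lt_of_le_of_lt ?_ hi); push_cast; lia) z

lemma m_le_rad_of_dlt [IsLocalRing R] {J : Ideal R} (h : Dlt J (maximalIdeal R) 1) : maximalIdeal R ≤ J.radical :=
  le_rad_of fun P hP hJ => by
    by_contra hc
    exact h P hP hJ (Ch.one inferInstance (lt_of_le_not_ge (le_m hP) hc))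

theorem cd_dim [IsLocalRing R] [IsAdicComplete (maximalIdeal R) R] (hl : ∀ x ∈ l, x ∈ maximalIdeal R)
    {J : Ideal R} {t s : ℕ} (hV : Van l J t) (hd : Dlt (sp l ⊔ J) (maximalIdeal R) (s + 1)) :
    Dlt J (maximalIdeal R) (t + s + 1) := by
  induction s generalizing J with
  | zero =>
    by_cases hJ : J ≤ maximalIdeal R
    · obtain ⟨d, h1, Q, hQ, hJQ, hc⟩ := exists_dim J hJ
      by_contra hcon
      have hdt : t < d := by
        by_contra hle
        exact hcon (h1.mono le_rfl (by lia))
      obtain ⟨z, hz⟩ := nonvan_prime l hl d Q hQ ((m_le_rad_of_dlt hd).trans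
        (Ideal.radical_mono (sup_le_sup_left hJQ _))) (h1.mono hJQ le_rfl) hc
      exact hz (hV _ (by rwa [Ideal.annihilator_quotient]) _ (by exact_mod_cast hdt) z)
    · exact fun Q hQ hJQ => absurd (hJQ.trans (le_m hQ)) hJ
  | succ s ih =>
    obtain ⟨y, hy, hav⟩ := avoid_top hd (a := maximalIdeal R) (by
      rintro Q hQ hle ⟨Q', hQ', hlt, -⟩
      exact (hle.trans_lt hlt).not_ge (le_m hQ'))
    have h1 := hd.succ_of hav
    rw [sup_assoc] at h1
    exact (ih (hV.mono le_sup_left) h1).drop hy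

lemma exists_min_prime [IsLocalRing R] (S : Set (Ideal R)) (hS : ∀ q ∈ S, q.IsPrime) (hne : S.Nonempty) :
    ∃ q ∈ S, ∀ P ∈ S, P ≤ q → P = q := by
  classical
  obtain ⟨q0, hq0⟩ := hne
  obtain ⟨N, hN⟩ := exists_dlt (R := R)
  let Pr : ℕ → Prop := fun n => ∃ q ∈ S, Ch n q (maximalIdeal R)
  have hb : ∀ n, Pr n → n ≤ N := by
    rintro n ⟨q, hq, hc⟩
    by_contra hcon
    exact hN q (hS q hq) bot_le (hc.mono (by lia))
  have h0 : Pr 0 := ⟨q0, hq0, le_m (hS _ hq0)⟩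
  obtain ⟨q, hq, hc⟩ := Nat.findGreatest_spec (P := Pr) (Nat.zero_le N) h0
  refine ⟨q, hq, fun P hP hle => ?_⟩
  by_contra hne
  have h1 : Pr (Nat.findGreatest Pr N + 1) := ⟨P, hP, q, hS _ hq, lt_of_le_of_ne hle hne, hc⟩
  have := Nat.le_findGreatest (hb _ h1) h1
  lia

lemma exists_nonmin [IsLocalRing R] {a P0 : Ideal R} (hP0 : P0.IsPrime) (ha : a ≤ P0) (hne : P0 ≠ maximalIdeal R) :
    ∃ q : Ideal R, q.IsPrime ∧ a ≤ q ∧ (∃ P : Ideal R, P.IsPrime ∧ a ≤ P ∧ P < q) ∧ ∃ f ∈ q,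
      (∀ P ∈ a.minimalPrimes, f ∉ P) ∧ ∀ P : Ideal R, P.IsPrime → a ≤ P → f ∈ P → P ≤ q → P = q := by
  obtain ⟨q, ⟨hq, P1, hP1, haP1, hlt⟩, hmin⟩ := exists_min_prime
    {q : Ideal R | q.IsPrime ∧ ∃ P : Ideal R, P.IsPrime ∧ a ≤ P ∧ P < q} (fun q hq => hq.1)
    ⟨maximalIdeal R, inferInstance, P0, hP0, ha, lt_m hP0 hne⟩
  obtain ⟨f, hf, hav⟩ := avoid_fin a.minimalPrimes (Ideal.finite_minimalPrimes_of_isNoetherianRing R a) (fun Q hQ => hQ.1.1) q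
    (fun Q hQ hle => (hlt.trans_le hle).not_ge (hQ.2 ⟨hP1, haP1⟩ (hlt.trans_le hle).le))
  refine ⟨q, hq, haP1.trans hlt.le, ⟨P1, hP1, haP1, hlt⟩, f, hf, hav, fun P hP haP hfP hle => ?_⟩
  refine hmin P ⟨hP, ?_⟩ hle
  obtain ⟨P2, hP2, hle2⟩ := Ideal.exists_minimalPrimes_le haP
  exact ⟨P2, hP2.1.1, hP2.1.2, lt_of_le_of_ne hle2 fun h => hav P2 hP2 (h ▸ hfP)⟩

theorem max_Q [IsLocalRing R] [IsAdicComplete (maximalIdeal R) R] (hl : ∀ x ∈ l, x ∈ maximalIdeal R) (hF : CFin l)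
    {c : ℕ} {Q : Ideal R} (hQ : Q.IsPrime) (hV : Van l Q c) (hne : ∃ z : H l c (R ⧸ Q), z ≠ 0)
    (hmax : ∀ Q' : Ideal R, Q'.IsPrime → Q < Q' → ∀ z : H l c (R ⧸ Q'), z = 0) :
    maximalIdeal R ≤ (sp l ⊔ Q).radical ∧ Dlt Q (maximalIdeal R) (c + 1) ∧ Ch c Q (maximalIdeal R) := by
  have hann : Module.annihilator R (R ⧸ Q) = Q := Ideal.annihilator_quotient
  have hdiv : ∀ x ∉ Q, ∀ z : H l c (R ⧸ Q), ∃ w, z = x • w := by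
    intro x hx z
    refine (H.coker l x (R ⧸ Q) c (hV _ (hann.ge.trans (LinearMap.annihilator_le_of_injective _
      (Submodule.injective_subtype _))) _ (by lia)) z).1 (dev l _ _ (fun p hp hle => ?_) _)
    have h1 := ann_quot (x := x) (M := R ⧸ Q) |>.trans hle
    rw [hann] at h1
    refine hmax p hp (lt_of_le_of_ne (le_sup_left.trans h1) fun h => hx ?_)
    rw [h]; exact h1 mem_sup_span
  have hT := H.torI l c (R ⧸ Q)
  have hQX : Q ≤ Module.annihilator R (ann0 (sp l) (H l c (R ⧸ Q))) :=
    (hann.ge.trans (H.ann_le l c (R ⧸ Q))).trans (LinearMap.annihilator_le_of_injective _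
      (Submodule.injective_subtype _))
  have h1 : maximalIdeal R ≤ (Module.annihilator R (ann0 (sp l) (H l c (R ⧸ Q)))).radical := by
    refine le_rad_of fun P hP hle => ?_
    by_contra hc
    obtain ⟨q, hq, hXq, ⟨P1, hP1, hXP1, hlt⟩, f, hf, hav, hmin⟩ := exists_nonmin hP hle (fun h => hc h.ge)
    refine hlt.ne (lemA hT (hF _ _) q hf hmin (fun w => ?_) P1 hP1 hXP1 hlt.le)
    have hfQ : f ∉ Q := fun h => by
      obtain ⟨P2, hP2, -⟩ := Ideal.exists_minimalPrimes_le hXq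
      exact hav P2 hP2 (hP2.1.2 (hQX h))
    obtain ⟨w', hw'⟩ := hdiv f hfQ w
    exact ⟨1, hq.one_notMem, w', 0, by rw [one_smul, ← hw', sub_self, smul_zero]⟩
  have hTm : Tor (maximalIdeal R) (H l c (R ⧸ Q)) := Tor.of_rad (tor_annX hT) (h1.trans (Ideal.radical_mono le_sup_left))
  have h2 := prim_of_art _ hTm (sp l) (hF _ _)
  have h3 : Module.annihilator R (H l c (R ⧸ Q)) ≤ Q := by
    intro x hx
    by_contra hxQ
    obtain ⟨z, hz⟩ := hne
    obtain ⟨w, rfl⟩ := hdiv x hxQ z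
    exact hz (Module.mem_annihilator.1 hx w)
  have h4 := h2.trans (Ideal.radical_mono (sup_le_sup_left h3 _))
  obtain ⟨d, hd1, hd2⟩ := exists_dim_prime Q hQ
  obtain ⟨z, hz⟩ := nonvan_prime l hl d Q hQ h4 hd1 hd2
  have hdc : d ≤ c := by
    by_contra hcon
    exact hz (hV _ hann.ge _ (by exact_mod_cast not_le.1 hcon) z)
  have hcd : c ≤ d := by
    by_contra hcon
    obtain ⟨z, hz⟩ := hne
    exact hz (vanm l (n := d + 1) (by rwa [hann]) (by exact_mod_cast not_le.1 hcon) z)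
  obtain rfl : d = c := le_antisymm hdc hcd
  exact ⟨h4, hd1, hd2⟩

lemma assm [IsLocalRing R] {A : Type u} [AddCommGroup A] [Module R A] {w : A} (hw : w ∉ TS (maximalIdeal R) A) :
    ∃ r : R, (Ideal.torsionOf R A (r • w)).IsPrime ∧ Ideal.torsionOf R A (r • w) ≠ maximalIdeal R := by
  let K : Ideal R := Ideal.torsionOf R (A ⧸ TS (maximalIdeal R) A) (Submodule.Quotient.mk w)
  have hK : ∀ x, x ∈ K ↔ x • w ∈ TS (maximalIdeal R) A := fun x => by
    rw [Ideal.mem_torsionOf_iff, ← Submodule.Quotient.mk_smul, Submodule.Quotient.mk_eq_zero]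
  have hnt : Nontrivial (R ⧸ K) := Ideal.Quotient.nontrivial_iff.2 fun h => hw (by
    have := (hK 1).1 (h ▸ trivial)
    rwa [one_smul] at this)
  obtain ⟨P, hP⟩ := associatedPrimes.nonempty R (R ⧸ K)
  obtain ⟨hPp, y, hy⟩ := isAssociatedPrime_iff.1 (AssociatedPrimes.mem_iff.1 hP)
  obtain ⟨r, rfl⟩ := Ideal.Quotient.mk_surjective y
  have hPr : ∀ x, x ∈ P ↔ x • r • w ∈ TS (maximalIdeal R) A := fun x => by
    rw [hy, Submodule.mem_colon_singleton, Submodule.mem_bot, ← mul_smul, ← hK, ← Ideal.Quotient.eq_zero_iff_mem]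
    rfl
  have hPm : ¬ maximalIdeal R ≤ P := by
    intro hle
    refine hPp.one_notMem ((hPr 1).2 ?_)
    rw [one_smul]
    intro x hx
    obtain ⟨k, hk⟩ := (hPr x).1 (hle hx) x hx
    exact ⟨k + 1, by rw [pow_succ, mul_smul]; exact hk⟩
  obtain ⟨s, hs, hsP⟩ := SetLike.not_le_iff_exists.1 hPm
  obtain ⟨N, hN⟩ := monotone_stabilizes_iff_noetherian.2 (inferInstance : IsNoetherian R R)
    ⟨fun k => Ideal.torsionOf R A (s ^ k • r • w), monotone_nat_of_le_succ fun k x hx => by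
      rw [Ideal.mem_torsionOf_iff] at hx ⊢
      rw [pow_succ', mul_smul, smul_comm, hx, smul_zero]⟩
  have h1 : Ideal.torsionOf R A ((s ^ N * r) • w) = P := by
    rw [mul_smul]
    ext x
    constructor
    · intro hx
      rw [Ideal.mem_torsionOf_iff] at hx
      have : x * s ^ N ∈ P := (hPr _).2 (by rw [mul_smul, hx]; exact zero_mem _)
      exact (hPp.mem_or_mem this).resolve_right fun h => hsP (hPp.mem_of_pow_mem N h)
    · intro hx
      obtain ⟨k, hk⟩ := (hPr x).1 hx s hs
      have h2 : x ∈ Ideal.torsionOf R A (s ^ (N + k) • r • w) := by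
        rw [Ideal.mem_torsionOf_iff, pow_add, mul_smul, smul_comm, smul_comm x, hk, smul_zero]
      have h3 := hN (N + k) (by lia)
      change Ideal.torsionOf R A (s ^ N • r • w) = Ideal.torsionOf R A (s ^ (N + k) • r • w) at h3
      rwa [h3]
  exact ⟨s ^ N * r, h1 ▸ hPp, fun h => hPm (h1 ▸ h.ge)⟩

lemma avoidm [IsLocalRing R] {A : Type u} [AddCommGroup A] [Module R A] {J : Ideal R} (hT : Tor J A)
    (hf : Module.Finite R (ann0 J A)) : ∃ f ∈ maximalIdeal R,
      (∀ P ∈ (Module.annihilator R (ann0 J A)).minimalPrimes, P ≠ maximalIdeal R → f ∉ P) ∧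
      ∀ (a : A) (k : ℕ), f ^ k • a = 0 → a ∈ TS (maximalIdeal R) A := by
  obtain ⟨f, hfm, hav⟩ := avoid_fin (((Module.annihilator R (ann0 J A)).minimalPrimes ∪
    associatedPrimes R (ann0 J A)) \ {maximalIdeal R})
    (((Ideal.finite_minimalPrimes_of_isNoetherianRing R _).union (associatedPrimes.finite R _)).diff)
    (by
      rintro Q ⟨hQ | hQ, -⟩
      · exact hQ.1.1
      · exact hQ.1) (maximalIdeal R) (by
      rintro Q ⟨hQ, hne⟩ hle
      have hQp : Q.IsPrime := by
        rcases hQ with hQ | hQ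
        · exact hQ.1.1
        · exact hQ.1
      exact hne (le_antisymm (le_m hQp) hle))
  refine ⟨f, hfm, fun P hP hne => hav P ⟨Or.inl hP, hne⟩, fun a k hk => ?_⟩
  by_contra ha
  obtain ⟨r, hp, hne⟩ := assm ha
  refine hav _ ⟨Or.inr ?_, hne⟩ (hp.mem_of_pow_mem k (by rw [Ideal.mem_torsionOf_iff, smul_comm, hk, smul_zero]))
  have hJ : r • a ∈ ann0 J A := mem_ann0.2 fun x hx => by
    obtain ⟨n, hn⟩ := hT x hx (r • a)
    exact hp.mem_of_pow_mem n hn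
  refine isAssociatedPrime_iff.2 ⟨hp, ⟨r • a, hJ⟩, ?_⟩
  ext x
  rw [Ideal.mem_torsionOf_iff, Submodule.mem_colon_singleton, Submodule.mem_bot, ← Subtype.coe_inj]
  rfl

end
end LCoh
end

section
open CategoryTheory
namespace LCoh
open IsLocalRing
section
variable {R : Type u} [CommRing R] [IsNoetherianRing R] {l : List R} [IsLocalRing R] [IsAdicComplete (maximalIdeal R) R]

lemma dlt_mm {n : ℕ} (hn : 1 ≤ n) : Dlt (maximalIdeal R) (maximalIdeal R) n := by
  intro Q hQ hle hc
  obtain ⟨Q', hQ', hlt, -⟩ := hc.mono hn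
  exact (hle.trans_lt hlt).not_ge (le_m hQ')

theorem main1 [IsDomain R] (hl : ∀ x ∈ l, x ∈ maximalIdeal R)
    (hQ : ∀ Q : Ideal R, Q.IsPrime → Q ≠ ⊥ → Van l Q 1 ∨ Dlt (sp l ⊔ Q) (maximalIdeal R) 2)
    (hD : ¬ Dlt (sp l) (maximalIdeal R) 2) (h2 : ∀ P : Ideal R, P.IsPrime → sp l ≤ P → Ch 2 ⊥ P) :
    Dlt (⊥ : Ideal R) (maximalIdeal R) 5 ∧ Ch 4 (⊥ : Ideal R) (maximalIdeal R) ∧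
      ∃ P : Ideal R, P.IsPrime ∧ sp l ≤ P ∧ ¬ Ch 3 ⊥ P := by
  have hb : (⊥ : Ideal R).IsPrime := Ideal.isPrime_bot
  obtain ⟨d, hd1, hd2⟩ := exists_dim_prime (⊥ : Ideal R) hb
  obtain ⟨s, hs1, P0, hP0, hIP0, hs2⟩ := exists_dim (sp l) (Ideal.span_le.2 hl)
  have hs : 2 ≤ s := by
    by_contra hcon
    exact hD (hs1.mono le_rfl (by lia))
  obtain rfl | hs3 : s = 2 ∨ 3 ≤ s := by lia
  · have h3 : ¬ Ch 3 ⊥ P0 := by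
      intro h3
      have hI : ¬ sp l ≤ ⊥ := fun h => by
        obtain ⟨Q', h1, h2, h3⟩ := h2 ⊥ hb h
        exact (h2.trans_le h3.le).ne rfl
      obtain ⟨x, hxI, hx0⟩ := SetLike.not_le_iff_exists.1 hI
      obtain ⟨Q1, hQ1, -, hxQ1, hc⟩ := h3.drop hb hP0 (hIP0 hxI)
      rcases hQ Q1 hQ1 (fun h => hx0 (h ▸ hxQ1)) with hV | hD'
      · have := cd_dim hl (t := 1) hV (hs1.mono le_sup_left le_rfl)
        exact this.not_ch hQ1 (hc.trans hs2)
      · exact hD' P0 hP0 (sup_le hIP0 hc.le) hs2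
    obtain ⟨a, b, hab, ha, hb'⟩ := cat3 hb hP0 bot_le hd1 hd2
    have ha2 : a ≤ 2 := by
      by_contra hcon
      exact h3 (ha.mono (by lia))
    have hb2 : b ≤ 2 := by
      by_contra hcon
      exact hs1 P0 hP0 hIP0 (hb'.mono (by lia))
    exact ⟨hd1.mono le_rfl (by lia), (h2 P0 hP0 hIP0).trans hs2, P0, hP0, hIP0, h3⟩
  · exfalso
    obtain ⟨s, rfl⟩ : ∃ s', s = s' + 1 := ⟨s - 1, by lia⟩
    obtain ⟨y, hy, hav⟩ := avoid_top hs1 (a := maximalIdeal R) (dlt_mm (by lia))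
    have h1 := hs1.succ_of hav
    obtain ⟨p, hp, hP0p, hyp, hcp⟩ := hs2.drop hP0 inferInstance hy
    have hyP0 := hav P0 hP0 hIP0 hs2
    have hlt : P0 < p := lt_of_le_of_ne hP0p fun h => hyP0 (h ▸ hyp)
    have h3 : Ch 3 ⊥ p := (h2 P0 hP0 hIP0).trans (Ch.one hp hlt)
    obtain ⟨Q1, hQ1, -, hyQ1, hc⟩ := h3.drop hb hp hyp
    rcases hQ Q1 hQ1 (fun h => hyP0 (by rw [h] at hyQ1; exact bot_le (a := P0) hyQ1)) with hV | hD'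
    · have := cd_dim hl (t := 1) hV (h1.mono (sup_le_sup_left ((Ideal.span_singleton_le_iff_mem _).2 hyQ1) _) le_rfl)
      exact this.not_ch hQ1 ((hc.trans hcp).mono (by lia))
    · exact hD' p hp (sup_le (hIP0.trans hP0p) hc.le) (hcp.mono (by lia))

lemma ht1 [IsDomain R] {Q : Ideal R} (hQ : Q.IsPrime) {x : R} (hx : x ≠ 0) (hxQ : x ∈ Q) {d : ℕ}
    (hd : Dlt (⊥ : Ideal R) (maximalIdeal R) (d + 2)) (hc : Ch (d + 1) (⊥ : Ideal R) (maximalIdeal R)) :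
    ∃ Q0 : Ideal R, Q0.IsPrime ∧ Q0 ≤ Q ∧ x ∈ Q0 ∧ Ch d Q0 (maximalIdeal R) := by
  have hb : (⊥ : Ideal R).IsPrime := Ideal.isPrime_bot
  obtain ⟨Q0, hQ0, hle⟩ := Ideal.exists_minimalPrimes_le (I := ⊥ ⊔ Ideal.span {x}) (J := Q) (sup_span_le bot_le hxQ)
  have hx0 : x ∈ Q0 := hQ0.1.2 mem_sup_span
  refine ⟨Q0, hQ0.1.1, hle, hx0, cat2 hb hQ0.1.1 (bot_lt_iff_ne_bot.2 fun h => hx (by rw [h] at hx0; exact hx0)) ?_ hd hc⟩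
  exact fun P hP h1 h2 => kht hb hQ0 hP h1 h2

lemma sQ [IsDomain R] {Q : Ideal R} (hQ : Q.IsPrime) (hQ0 : Q ≠ ⊥) {n : ℕ} {s : R}
    (h : ∀ x ∈ Q ^ n, s * x ∈ Q ^ (n + 1)) : s ∈ Q := by
  obtain ⟨p, hp, -, hco, hae⟩ := LinearMap.exists_monic_and_natDegree_eq_and_coeff_mem_pow_and_aeval_eq_zero R
    (M := ↥(Q ^ n)) (s • LinearMap.id) Q (by
      rintro _ ⟨x, rfl⟩
      rw [Submodule.mem_smul_top_iff]
      have := h x.1 x.2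
      rw [pow_succ'] at this
      exact this)
  obtain ⟨x, hx, hx0⟩ := (Submodule.ne_bot_iff _).1 (pow_ne_zero n hQ0 : Q ^ n ≠ ⊥)
  have h1 : p.eval s = 0 := by
    have h2 := LinearMap.congr_fun hae ⟨x, hx⟩
    have h3 : ∀ q : Polynomial R, (Polynomial.aeval (s • LinearMap.id : ↥(Q ^ n) →ₗ[R] ↥(Q ^ n)) q) ⟨x, hx⟩ =
        q.eval s • ⟨x, hx⟩ := by
      intro q
      have : (s • LinearMap.id : ↥(Q ^ n) →ₗ[R] ↥(Q ^ n)) = algebraMap R (Module.End R ↥(Q ^ n)) s := rfl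
      rw [this, Polynomial.aeval_algebraMap_apply]; rfl
    rw [h3] at h2
    have h4 : p.eval s * x = 0 := congrArg Subtype.val h2
    exact (mul_eq_zero.1 h4).resolve_right hx0
  rw [Polynomial.eval_eq_sum_range, Finset.sum_range_succ, hp.coeff_natDegree, one_mul] at h1
  refine hQ.mem_of_pow_mem p.natDegree ?_
  rw [← neg_eq_iff_add_eq_zero] at h1
  rw [← h1]
  refine Q.neg_mem (Q.sum_mem fun k hk => Q.mul_mem_right _ ?_)
  exact Ideal.pow_le_self (by have := Finset.mem_range.1 hk; lia) (hco k)

lemma ks {N : Type u} [AddCommGroup N] [Module R N] [Module.Finite R N] {Q : Ideal R} (hQ : Q.IsPrime)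
    (h : ∀ b : N, ∃ s ∉ Q, s • b = 0) : ∃ s ∉ Q, ∀ b : N, s • b = 0 := by
  have hns : (⟨Q, hQ⟩ : PrimeSpectrum R) ∉ Module.support R N := by
    rw [Module.notMem_support_iff']
    exact h
  rw [Module.mem_support_iff_of_finite] at hns
  obtain ⟨s, hs, hsQ⟩ := SetLike.not_le_iff_exists.1 hns
  exact ⟨s, hsQ, Module.mem_annihilator.1 hs⟩

/-- If `H^c(N) = 0` with `c = dim R/Q` the top degree, `Q N = 0`, then `N_Q = 0`. -/
lemma kill_of_van {Q : Ideal R} (hQ : Q.IsPrime) {c : ℕ} (hV : Van l Q c)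
    (hd : Dlt Q (maximalIdeal R) (c + 1)) (hne : ∃ z : H l c (R ⧸ Q), z ≠ 0) (N : Type u) [AddCommGroup N] [Module R N]
    [Module.Finite R N] (hN : Q ≤ Module.annihilator R N) (h0 : ∀ z : H l c N, z = 0) :
    ∃ s ∉ Q, ∀ b : N, s • b = 0 := by
  by_contra hcon
  obtain ⟨N', hN', hmax⟩ := set_has_maximal_iff_noetherian.2 (inferInstance : IsNoetherian R N)
    {N' : Submodule R N | ¬ ∃ s ∉ Q, ∀ b : N, s • b ∈ N'} ⟨⊥, by simpa using hcon⟩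
  have hB0 : ∀ z : H l c (N ⧸ N'), z = 0 := by
    intro z
    obtain ⟨w, rfl⟩ := hV.surj hN N'.mkQ N'.mkQ_surjective c le_rfl z
    rw [h0 w, map_zero]
  obtain ⟨b, hb⟩ : ∃ b : N, ∀ s ∉ Q, s • b ∉ N' := by
    by_contra! hcon
    obtain ⟨s, hs, h1⟩ := ks (N := N ⧸ N') hQ (fun b => by
      obtain ⟨b, rfl⟩ := N'.mkQ_surjective b
      obtain ⟨s, hs, h1⟩ := hcon b
      exact ⟨s, hs, by rw [← map_smul]; exact (Submodule.Quotient.mk_eq_zero _).2 h1⟩)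
    exact hN' ⟨s, hs, fun b => (Submodule.Quotient.mk_eq_zero N').1 (h1 (Submodule.Quotient.mk b))⟩
  have hb' : b ∉ N' := fun h => hb 1 hQ.one_notMem (by rwa [one_smul])
  obtain ⟨s, hs, hsb⟩ : ∃ s ∉ Q, ∀ x : N, s • x ∈ N' ⊔ Submodule.span R {b} := by
    by_contra hcon
    refine hmax _ hcon (lt_of_le_of_ne le_sup_left fun h => hb' ?_)
    rw [h]; exact Submodule.mem_sup_right (Submodule.mem_span_singleton_self b)
  have hlift : Q ≤ LinearMap.ker (LinearMap.toSpanSingleton R (N ⧸ N') (N'.mkQ b)) := by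
    intro x hx
    rw [LinearMap.mem_ker, LinearMap.toSpanSingleton_apply, ← map_smul, Module.mem_annihilator.1 (hN hx), map_zero]
  let g : (R ⧸ Q) →ₗ[R] (N ⧸ N') := Submodule.liftQ Q (LinearMap.toSpanSingleton R (N ⧸ N') (N'.mkQ b)) hlift
  have hg : Function.Injective g := by
    rw [← LinearMap.ker_eq_bot, LinearMap.ker_eq_bot']
    intro x hx
    obtain ⟨x, rfl⟩ := Submodule.mkQ_surjective _ x
    have h1 : N'.mkQ (x • b) = 0 := by rw [map_smul]; exact hx
    by_contra hx0
    refine hb x (fun h => hx0 ?_) ((Submodule.Quotient.mk_eq_zero _).1 h1)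
    exact (Submodule.Quotient.mk_eq_zero Q).2 h
  obtain ⟨δ, hδ1, hδ2⟩ := H.exists_delta l (c - 1) hg (LinearMap.exact_map_mkQ_range g) (Submodule.mkQ_surjective _)
    c (by lia)
  obtain ⟨z, hz⟩ := hne
  have hann : Module.annihilator R (R ⧸ Q) = Q := Ideal.annihilator_quotient
  obtain ⟨w, rfl⟩ := divm l (n := c) (M := R ⧸ Q) s (by rwa [hann]) (by
    rw [hann]
    exact hd.of_lt hQ (lt_of_le_of_ne le_sup_left fun h => hs (by rw [h]; exact mem_sup_span))) le_rfl z
  obtain ⟨v, rfl⟩ := (hδ2 w).1 (hB0 _)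
  refine hz ?_
  rw [← map_smul, H.smul_zero_of, map_zero]
  intro m
  obtain ⟨m, rfl⟩ := Submodule.mkQ_surjective _ m
  obtain ⟨m, rfl⟩ := Submodule.mkQ_surjective _ m
  rw [← map_smul, ← map_smul]
  refine (Submodule.Quotient.mk_eq_zero _).2 ?_
  obtain ⟨u, hu, v, hv, huv⟩ := Submodule.mem_sup.1 (hsb m)
  obtain ⟨r, rfl⟩ := Submodule.mem_span_singleton.1 hv
  refine ⟨Submodule.Quotient.mk r, ?_⟩
  rw [← huv, map_add, show N'.mkQ u = 0 from (Submodule.Quotient.mk_eq_zero N').2 hu, zero_add, map_smul]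
  rfl

theorem T0 [IsDomain R] {Q : Ideal R} (hQ : Q.IsPrime) (hQ0 : Q ≠ ⊥) {c : ℕ} (hc : 1 ≤ c) (hV : Van l (⊥ : Ideal R) c)
    (hr : maximalIdeal R ≤ (sp l ⊔ Q).radical)
    (hd : Dlt Q (maximalIdeal R) (c + 1)) (hch : Ch c Q (maximalIdeal R)) (hne : ∃ z : H l c (R ⧸ Q), z ≠ 0)
    (hF : Module.Finite R (ann0 (sp l) (H l c (R ⧸ (⊥ : Ideal R)))))
    (hX : maximalIdeal R ≤ (Module.annihilator R (ann0 (sp l) (H l c (R ⧸ (⊥ : Ideal R))))).radical) : False := by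
  have hTm : Tor (maximalIdeal R) (ann0 (sp l) (H l c (R ⧸ (⊥ : Ideal R)))) :=
    Tor.of_rad ((tor_annX (H.torI l c (R ⧸ (⊥ : Ideal R)))).sub _) (hX.trans (Ideal.radical_mono le_sup_left))
  have hart : IsArtinian R (H l c (R ⧸ (⊥ : Ideal R))) := art_of_ann (sp l) (H.torI l c _) (art_of_fin hTm)
  let φ : ∀ n : ℕ, H l c (R ⧸ (⊥ : Ideal R)) →ₗ[R] H l c (R ⧸ Q ^ n) :=
    fun n => H.map l c (Submodule.factor bot_le)
  have hψ : ∀ n, ∀ z, H.map l c (Submodule.factor (Ideal.pow_le_pow_right (Nat.le_succ n) : Q ^ (n + 1) ≤ Q ^ n)) (φ (n + 1) z)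
      = φ n z := by
    intro n z
    rw [← H.map_comp_apply, Submodule.factor_comp]
  obtain ⟨N, hN⟩ := IsArtinian.monotone_stabilizes (R := R) (M := H l c (R ⧸ (⊥ : Ideal R)))
    ⟨fun n => OrderDual.toDual (LinearMap.ker (φ n)), monotone_nat_of_le_succ fun n => by
      change LinearMap.ker (φ (n + 1)) ≤ LinearMap.ker (φ n)
      intro z hz
      rw [LinearMap.mem_ker, ← hψ, LinearMap.mem_ker.1 hz, map_zero]⟩
  set n := N + 1 with hn
  have hker : ∀ z, φ n z = 0 → φ (n + 1) z = 0 := by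
    intro z hz
    have h1 : LinearMap.ker (φ N) = LinearMap.ker (φ n) := hN n (by lia)
    have h2 : LinearMap.ker (φ N) = LinearMap.ker (φ (n + 1)) := hN (n + 1) (by lia)
    have h3 : z ∈ LinearMap.ker (φ (n + 1)) := by rw [← h2, h1]; exact hz
    exact h3
  let π : (R ⧸ Q ^ (n + 1)) →ₗ[R] (R ⧸ Q ^ n) := Submodule.factor (Ideal.pow_le_pow_right (Nat.le_succ n))
  have hπ : Function.Surjective π := Submodule.factor_surjective _
  have hinj : ∀ z, H.map l c π z = 0 → z = 0 := by
    intro z hz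
    obtain ⟨w, rfl⟩ := hV.q_surj le_rfl (bot_le : ⊥ ≤ Q ^ (n + 1)) c le_rfl z
    exact hker w ((hψ n w).symm.trans hz)
  have hex := LinearMap.exact_subtype_ker_map π
  have hsi := (LinearMap.ker π).injective_subtype
  obtain ⟨δ, -, hδ2⟩ := H.exists_delta l (c - 1) hsi hex hπ c (by lia)
  have hδ : Function.Surjective δ := by
    intro w
    refine (hδ2 w).1 (hinj _ ?_)
    exact (H.exact_mid l c hsi hex hπ).apply_apply_eq_zero w
  obtain ⟨c, rfl⟩ : ∃ c', c = c' + 1 := ⟨c - 1, by lia⟩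
  have hannB : Module.annihilator R (R ⧸ Q ^ n) = Q ^ n := Ideal.annihilator_quotient
  have hC := (lemC l c (R ⧸ Q ^ n) (by
    rw [hannB]
    refine le_rad_of fun P hP hle => rad_le_of hP hr (sup_le (le_sup_left.trans hle) ?_)
    exact hP.pow_le_iff (by lia) |>.1 (le_sup_right.trans hle))).2
  have : ∃ x ∈ Module.annihilator R (H l c (R ⧸ Q ^ n)), x ∉ Q := SetLike.not_le_iff_exists.1 fun hle =>
    hC Q hQ hle hch
  obtain ⟨x, hx, hxQ⟩ := this
  have hQN : Q ≤ Module.annihilator R (LinearMap.ker π) := by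
    intro q hq
    rw [Module.mem_annihilator]
    rintro ⟨m, hm⟩
    obtain ⟨r, rfl⟩ := Submodule.mkQ_surjective _ m
    have hr : r ∈ Q ^ n := (Submodule.Quotient.mk_eq_zero (Q ^ n)).1 hm
    refine Subtype.ext ?_
    change q • Submodule.mkQ _ r = 0
    rw [← map_smul]
    refine (Submodule.Quotient.mk_eq_zero _).2 ?_
    rw [pow_succ']
    exact Ideal.mul_mem_mul hq hr
  have hz0 : ∀ z : H l (c + 1 : ℕ) (LinearMap.ker π), z = 0 := by
    intro z
    obtain ⟨w, rfl⟩ := divm l (n := c + 1) (M := LinearMap.ker π) x (hd.mono hQN le_rfl) (by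
      refine Dlt.mono (hd.of_lt hQ (J := Q ⊔ Ideal.span {x}) ?_) (sup_le_sup_right hQN _) le_rfl
      exact lt_of_le_of_ne le_sup_left fun h => hxQ (by rw [h]; exact mem_sup_span)) le_rfl z
    obtain ⟨v, rfl⟩ := hδ w
    rw [← map_smul]
    have : ∀ v : H l (((c + 1 : ℕ) : ℤ) - 1) (R ⧸ Q ^ n), x • v = 0 := by
      have h1 : (((c + 1 : ℕ) : ℤ) - 1) = (c : ℤ) := by push_cast; ring
      rw [h1]
      exact Module.mem_annihilator.1 hx
    rw [this, map_zero]
  obtain ⟨s, hs, hsN⟩ := kill_of_van hQ (hV.mono bot_le) hd hne _ hQN hz0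
  refine hs (sQ hQ hQ0 (n := n) fun r hr => ?_)
  have h1 := congrArg Subtype.val (hsN ⟨Submodule.mkQ _ r, (Submodule.Quotient.mk_eq_zero (Q ^ n)).2 hr⟩)
  exact (Submodule.Quotient.mk_eq_zero _).1 h1

end
end LCoh
end

section
open CategoryTheory
namespace LCoh
open IsLocalRing
section
variable {R : Type u} [CommRing R] [IsNoetherianRing R] {l : List R} [IsLocalRing R]

abbrev Vk (f : R) (k : ℕ) (U : Type u) [AddCommGroup U] [Module R U] : Submodule R U :=
  LinearMap.ker (f ^ k • LinearMap.id : U →ₗ[R] U)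

lemma mem_Vk {f : R} {k : ℕ} {U : Type u} [AddCommGroup U] [Module R U] {u : U} : u ∈ Vk f k U ↔ f ^ k • u = 0 := Iff.rfl

lemma ann0_fin_inj {J : Ideal R} {A B : Type u} [AddCommGroup A] [Module R A] [AddCommGroup B] [Module R B]
    (g : A →ₗ[R] B) (hg : Function.Injective g) (h : Module.Finite R (ann0 J B)) : Module.Finite R (ann0 J A) := by
  have h2 : ∀ a ∈ ann0 J A, g a ∈ ann0 J B := fun a ha => mem_ann0.2 fun x hx => by
    rw [← map_smul, mem_ann0.1 ha x hx, map_zero]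
  refine Module.Finite.of_injective (g.restrict h2) ?_
  intro a b hab
  exact Subtype.ext (hg (congrArg Subtype.val hab))

lemma wg_fin' {J : Ideal R} {A B C : Type u} [AddCommGroup A] [Module R A] [AddCommGroup B] [Module R B]
    [AddCommGroup C] [Module R C] (π : A →ₗ[R] B) (hπ : Function.Surjective π) (g : A →ₗ[R] C)
    (hg : Function.Surjective g) (hle : ∀ a, π a = 0 → g a = 0)
    (hk : ∀ a, g a = 0 → π a ∈ TS (maximalIdeal R) B) (hT : Tor J B) (hF : Module.Finite R (ann0 J B)) :
    Module.Finite R (ann0 J C) := by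
  let S : Submodule R B := (LinearMap.ker g).map π
  have hS : Tor (maximalIdeal R) S := by
    rintro x hx ⟨b, a, ha, rfl⟩
    obtain ⟨k, hk'⟩ := mem_TS.1 (hk a ha) x hx
    exact ⟨k, Subtype.ext hk'⟩
  have := wg_fin hT hF hS
  let φ : (A ⧸ LinearMap.ker g) →ₗ[R] B ⧸ S := (LinearMap.ker g).mapQ S π (Submodule.le_comap_map _ _)
  have hφ : Function.Injective φ := by
    rw [← LinearMap.ker_eq_bot, LinearMap.ker_eq_bot']
    intro x hx
    obtain ⟨x, rfl⟩ := Submodule.mkQ_surjective _ x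
    obtain ⟨a, ha, hax⟩ : π x ∈ S := (Submodule.Quotient.mk_eq_zero S).1 hx
    refine (Submodule.Quotient.mk_eq_zero _).2 ?_
    have h1 : g (x - a) = 0 := hle _ (by rw [map_sub, hax, sub_self])
    rw [map_sub, LinearMap.mem_ker.1 ha, sub_zero] at h1
    exact h1
  let e := LinearMap.quotKerEquivOfSurjective g hg
  exact ann0_fin_inj (φ.comp e.symm.toLinearMap) (hφ.comp e.symm.injective) this

variable [IsAdicComplete (maximalIdeal R) R]

theorem D1 {J : Ideal R} {U : Type u} [AddCommGroup U] [Module R U] (hT : Tor J U) {f : R} (hf : f ∈ maximalIdeal R)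
    (hTf : ∀ u : U, ∃ k : ℕ, f ^ k • u = 0) (hfin : ∀ k, Module.Finite R (ann0 J (Vk f k U)))
    (hdiv : ∀ f2 ∈ maximalIdeal R, ∀ (v : U) (K : ℕ), ∃ u : U, ∃ N : ℕ, f2 ^ N • (v - f2 ^ K • u) = 0)
    (v : U) (hv : f • v = 0) : v ∈ TS (maximalIdeal R) U := by
  have hfin' : Module.Finite R (ann0 (J ⊔ Ideal.span {f}) U) := by
    have := hfin 1
    have h1 : ∀ a : ann0 (J ⊔ Ideal.span {f}) U, a.1 ∈ Vk f 1 U := fun a => by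
      rw [mem_Vk, pow_one]; exact mem_ann0.1 a.2 f mem_sup_span
    let g : ann0 (J ⊔ Ideal.span {f}) U →ₗ[R] Vk f 1 U := (Submodule.subtype _).codRestrict _ h1
    have h2 : ∀ a, g a ∈ ann0 J (Vk f 1 U) := fun a => mem_ann0.2 fun x hx => Subtype.ext
      (mem_ann0.1 a.2 x (Ideal.mem_sup_left hx))
    refine Module.Finite.of_injective (g.codRestrict _ h2) ?_
    intro a b hab
    exact Subtype.ext (congrArg (fun t => t.1.1) hab)
  have hT' : Tor (J ⊔ Ideal.span {f}) U := by
    intro x hx u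
    have h1 : (J ⊔ Ideal.span {f}) ≤ (Ideal.torsionOf R U u).radical := by
      refine sup_le ?_ ((Ideal.span_singleton_le_iff_mem _).2 ?_)
      · exact fun y hy => hT y hy u
      · exact hTf u
    exact h1 hx
  have hΓart : IsArtinian R (TS (maximalIdeal R) U) := TS_art hT' hfin' (TS.tor _)
  obtain ⟨k, hk⟩ := IsArtinian.monotone_stabilizes (R := R) (M := TS (maximalIdeal R) U)
    ⟨fun n => OrderDual.toDual (LinearMap.range (f ^ n • LinearMap.id : TS (maximalIdeal R) U →ₗ[R] _)),
      monotone_nat_of_le_succ fun n => by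
      change LinearMap.range (f ^ (n + 1) • LinearMap.id : TS (maximalIdeal R) U →ₗ[R] _) ≤ LinearMap.range (f ^ n • LinearMap.id : TS (maximalIdeal R) U →ₗ[R] _)
      rintro _ ⟨z, rfl⟩
      exact ⟨f • z, show f ^ n • f • z = f ^ (n + 1) • z by rw [pow_succ, mul_smul]⟩⟩
  have hsplit : ∀ γ ∈ TS (maximalIdeal R) U, ∃ γ' ∈ TS (maximalIdeal R) U, f ^ k • (γ - f • γ') = 0 := by
    intro γ hγ
    have h1 : LinearMap.range (f ^ k • LinearMap.id : TS (maximalIdeal R) U →ₗ[R] _) = LinearMap.range (f ^ (k + 1) • LinearMap.id : TS (maximalIdeal R) U →ₗ[R] _) := hk (k + 1) (by lia)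
    have h2 : f ^ k • (⟨γ, hγ⟩ : TS (maximalIdeal R) U) ∈ LinearMap.range (f ^ k • LinearMap.id : TS (maximalIdeal R) U →ₗ[R] _) := ⟨⟨γ, hγ⟩, rfl⟩
    rw [h1] at h2
    obtain ⟨γ', h3⟩ := h2
    refine ⟨γ'.1, γ'.2, ?_⟩
    have h4 : f ^ (k + 1) • γ'.1 = f ^ k • γ := congrArg Subtype.val h3
    rw [smul_sub, ← mul_smul, ← pow_succ, h4, sub_self]
  obtain ⟨f2, hf2, -, hav⟩ := avoidm (hT.sub (Vk f 1 U)) (hfin 1)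
  have hΓ2 : ∀ (n : ℕ) (u : U), f ^ n • u = 0 → ∀ j, f2 ^ j • u = 0 → u ∈ TS (maximalIdeal R) U := by
    intro n
    induction n with
    | zero => intro u hu j _; rw [pow_zero, one_smul] at hu; rw [hu]; exact Submodule.zero_mem _
    | succ n ih =>
      intro u hu j hj
      have h1 : f ^ n • u ∈ Vk f 1 U := by rw [mem_Vk, pow_one, ← mul_smul, ← pow_succ', hu]
      have h2 := hav ⟨_, h1⟩ j (Subtype.ext (show f2 ^ j • f ^ n • u = 0 by rw [smul_comm, hj, smul_zero]))
      refine mem_TS.2 fun x hx => ?_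
      obtain ⟨i, hi⟩ := mem_TS.1 h2 x hx
      have hi' : x ^ i • f ^ n • u = 0 := congrArg Subtype.val hi
      obtain ⟨i', hi'⟩ := mem_TS.1 (ih (x ^ i • u) (by rw [smul_comm, hi']) j (by rw [smul_comm, hj, smul_zero])) x hx
      exact ⟨i' + i, by rw [pow_add, mul_smul, hi']⟩
  have hΓ3 : ∀ (n : ℕ) (u : U), f2 ^ n • u ∈ TS (maximalIdeal R) U → u ∈ TS (maximalIdeal R) U := by
    intro n u hu
    obtain ⟨j, hj⟩ := mem_TS.1 hu f2 hf2
    obtain ⟨i, hi⟩ := hTf u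
    exact hΓ2 i u hi (j + n) (by rw [pow_add, mul_smul, hj])
  -- the module Γ_k
  let G : Submodule R U := TS (maximalIdeal R) U ⊓ Vk f k U
  have hG : Tor (maximalIdeal R) G := fun x hx a => by
    obtain ⟨j, hj⟩ := mem_TS.1 a.2.1 x hx
    exact ⟨j, Subtype.ext hj⟩
  have hGf : Module.Finite R (ann0 J G) :=
    ann0_fin_inj (Submodule.inclusion inf_le_right) (Submodule.inclusion_injective _) (hfin k)
  obtain ⟨K, hK⟩ := prim_of_art G hG J hGf hf2
  obtain ⟨i, hi, a, ha, hia⟩ := Submodule.mem_sup.1 hK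
  have hfinY := wg_fin (hT.sub (Vk f 1 U)) (hfin 1) (TS.tor (A := Vk f 1 U) (maximalIdeal R))
  have hTm : ∀ z : Vk f 1 U, z ∈ TS (maximalIdeal R) (Vk f 1 U) ↔ z.1 ∈ TS (maximalIdeal R) U := by
    intro z
    simp only [mem_TS]
    refine forall₂_congr fun x hx => exists_congr fun j => ?_
    rw [← Submodule.coe_smul, Submodule.coe_eq_zero]
  have key : ∀ w : Vk f 1 U, (∀ x ∈ J, x • w.1 ∈ TS (maximalIdeal R) U) →
      ∃ w1 : Vk f 1 U, (∀ x ∈ J, x • w1.1 ∈ TS (maximalIdeal R) U) ∧ w.1 - f2 • w1.1 ∈ TS (maximalIdeal R) U := by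
    rintro ⟨w, hw⟩ hJw
    have hfw : f • w = 0 := by rw [mem_Vk, pow_one] at hw; exact hw
    obtain ⟨u, N, hu⟩ := hdiv f2 hf2 w (K + 1)
    have hu1 : w - f2 ^ (K + 1) • u ∈ TS (maximalIdeal R) U := hΓ3 N _ (by rw [hu]; exact Submodule.zero_mem _)
    have hfu : f • u ∈ TS (maximalIdeal R) U := by
      refine hΓ3 (K + 1) _ ?_
      have := Submodule.smul_mem _ f hu1
      rw [smul_sub, hfw, zero_sub, Submodule.neg_mem_iff, smul_comm] at this
      exact this
    have hxu : ∀ x ∈ J, x • u ∈ TS (maximalIdeal R) U := by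
      intro x hx
      refine hΓ3 (K + 1) _ ?_
      have := Submodule.sub_mem _ (hJw x hx) (Submodule.smul_mem _ x hu1)
      rw [smul_sub, sub_sub_cancel, smul_comm] at this
      exact this
    obtain ⟨γ', hγ', hγ⟩ := hsplit _ hfu
    have hxu' : ∀ x ∈ J, x • (u - γ') ∈ TS (maximalIdeal R) U := fun x hx => by
      rw [smul_sub]; exact Submodule.sub_mem _ (hxu x hx) (Submodule.smul_mem _ _ hγ')
    have hfa : f • a • (u - γ') = 0 := by
      have h1 := Module.mem_annihilator.1 ha (⟨f • u - f • γ', Submodule.sub_mem _ hfu (Submodule.smul_mem _ _ hγ'), hγ⟩ : G)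
      have h2 : a • (f • u - f • γ') = 0 := congrArg Subtype.val h1
      rw [smul_comm, smul_sub f, h2]
    refine ⟨⟨a • (u - γ'), by rw [mem_Vk, pow_one]; exact hfa⟩, fun x hx => ?_, ?_⟩
    · change x • a • (u - γ') ∈ _
      rw [smul_comm]; exact Submodule.smul_mem _ _ (hxu' x hx)
    · change w - f2 • a • (u - γ') ∈ _
      have h1 : w - f2 • a • (u - γ') = (w - f2 ^ (K + 1) • u) + f2 ^ (K + 1) • γ' + f2 • i • (u - γ') := by
        have : f2 ^ (K + 1) = f2 * (i + a) := by rw [hia, pow_succ']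
        rw [this]; module
      rw [h1]
      exact Submodule.add_mem _ (Submodule.add_mem _ hu1 (Submodule.smul_mem _ _ hγ')) (Submodule.smul_mem _ _ (hxu' i hi))
  have hJ' : ∀ w : Vk f 1 U, (TS (maximalIdeal R) (Vk f 1 U)).mkQ w ∈ ann0 J (Vk f 1 U ⧸ TS (maximalIdeal R) (Vk f 1 U)) ↔
      ∀ x ∈ J, x • w.1 ∈ TS (maximalIdeal R) U := by
    intro w
    rw [mem_ann0]
    refine forall₂_congr fun x hx => ?_
    rw [← map_smul]
    exact (Submodule.Quotient.mk_eq_zero _).trans (hTm _)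
  have hY : ∀ y ∈ ann0 J (Vk f 1 U ⧸ TS (maximalIdeal R) (Vk f 1 U)), y = 0 := by
    intro y hy
    have := nak (Y := ann0 J (Vk f 1 U ⧸ TS (maximalIdeal R) (Vk f 1 U))) hf2 (fun y => by
      obtain ⟨y, hy⟩ := y
      obtain ⟨w, rfl⟩ := Submodule.mkQ_surjective _ y
      obtain ⟨w1, h1, h2⟩ := key w ((hJ' w).1 hy)
      refine ⟨⟨_, (hJ' w1).2 h1⟩, Subtype.ext ?_⟩
      change Submodule.mkQ _ w = f2 • Submodule.mkQ _ w1
      rw [← map_smul, ← sub_eq_zero, ← map_sub]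
      exact (Submodule.Quotient.mk_eq_zero _).2 ((hTm _).2 h2)) ⟨y, hy⟩
    exact congrArg Subtype.val this
  have h0 := eq_zero_of_ann0 ((hT.sub (Vk f 1 U)).quot (TS (maximalIdeal R) (Vk f 1 U))) hY
    (Submodule.mkQ _ (⟨v, by rw [mem_Vk, pow_one]; exact hv⟩ : Vk f 1 U))
  exact (hTm _).1 ((Submodule.Quotient.mk_eq_zero _).1 h0)

end
end LCoh
end

section
open CategoryTheory
namespace LCoh
open IsLocalRing
section
variable {R : Type u} [CommRing R] [IsNoetherianRing R] {l : List R} [IsLocalRing R] [IsAdicComplete (maximalIdeal R) R]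
  [IsDomain R]

lemma ann_b : Module.annihilator R (R ⧸ (⊥ : Ideal R)) = ⊥ := Ideal.annihilator_quotient

lemma ch_of_ann {c : ℕ} (hF : Module.Finite R (ann0 (sp l) (H l c (R ⧸ (⊥ : Ideal R))))) {P : Ideal R} (hP : P.IsPrime)
    (h : Module.annihilator R (ann0 (sp l) (H l c (R ⧸ (⊥ : Ideal R)))) ≤ P) : Ch c ⊥ P := by
  by_contra hcon
  have hb : (⊥ : Ideal R).IsPrime := Ideal.isPrime_bot
  obtain ⟨s, hs, hs0⟩ := ks (N := ann0 (sp l) (H l c (R ⧸ (⊥ : Ideal R)))) hP (fun z => by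
    obtain ⟨s, hs, h0⟩ := van l P c (R ⧸ (⊥ : Ideal R)) (by rw [ann_b, dlt_iff hb]; exact hcon) c le_rfl z.1
    exact ⟨s, hs, Subtype.ext h0⟩)
  exact hs (h (Module.mem_annihilator.2 hs0))

lemma stepB {c : ℕ} (hF : Module.Finite R (ann0 (sp l) (H l c (R ⧸ (⊥ : Ideal R))))) {f : R} (hf : f ∈ maximalIdeal R)
    (hfP : ∀ P : Ideal R, P.IsPrime → Module.annihilator R (ann0 (sp l) (H l c (R ⧸ (⊥ : Ideal R)))) ≤ P → f ∈ P → P = maximalIdeal R)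
    (hdiv : ∀ w : H l c (R ⧸ (⊥ : Ideal R)), ∃ w' : H l c (R ⧸ (⊥ : Ideal R)), ∃ k : ℕ, f ^ k • (w - f • w') = 0) :
    maximalIdeal R ≤ (Module.annihilator R (ann0 (sp l) (H l c (R ⧸ (⊥ : Ideal R))))).radical := by
  refine le_rad_of fun P hP hle => ?_
  have := lemA (H.torI l c _) hF (maximalIdeal R) hf (fun P hP h1 h2 _ => hfP P hP h1 h2) (fun w => by
    obtain ⟨w', k, h⟩ := hdiv w
    exact ⟨1, (inferInstance : (maximalIdeal R).IsPrime).one_notMem, w', k, by rwa [one_smul]⟩) P hP hle (le_m hP)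
  rw [this]

lemma div_of_van {c : ℕ} {f : R} {M : Type u} [AddCommGroup M] [Module R M] (h : ∀ z : H (f :: l) ((c + 1 : ℕ) : ℤ) M, z = 0) (w : H l c M) (K : ℕ) :
    ∃ w' : H l c M, ∃ k : ℕ, f ^ k • (w - f ^ K • w') = 0 := by
  obtain ⟨L, _, _, ι, δ, a, hι, h1, h2, h3⟩ := H.exists_loc (M := M) l c f ((c + 1 : ℕ) : ℤ) (by push_cast; ring)
  obtain ⟨y, hy⟩ := (locunit (f := f) ι K).2 (ι w)
  obtain ⟨w', rfl⟩ := (h1 y).1 (h _)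
  obtain ⟨k, hk⟩ := (lockern (f := f) ι (w - f ^ K • w')).1 (by rw [map_sub, map_smul, ← hy]; simp)
  exact ⟨w', k, hk⟩

/-- case d = c+1 -/
lemma caseB1 {c : ℕ} (hd : Dlt (⊥ : Ideal R) (maximalIdeal R) (c + 2)) (hD : ¬ Dlt (sp l) (maximalIdeal R) 2)
    {f : R} (hf : f ∈ maximalIdeal R) (w : H l c (R ⧸ (⊥ : Ideal R))) :
    ∃ w' : H l c (R ⧸ (⊥ : Ideal R)), ∃ k : ℕ, f ^ k • (w - f • w') = 0 := by
  have := div_of_van (f := f) (HL_zero (f :: l) (c + 1) ⊥ Ideal.isPrime_bot hd (fun h => hD ?_)) w 1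
  · simpa using this
  · rw [sup_bot_eq, sp_cons] at h
    exact (dlt_one h).drop hf

lemma fzero {c : ℕ} (hc2 : 2 ≤ c) (hl : ∀ x ∈ l, x ∈ maximalIdeal R) (hV : Van l (⊥ : Ideal R) c)
    (hQ : ∀ Q : Ideal R, Q.IsPrime → Q ≠ ⊥ → Van l Q 1 ∨ Dlt (sp l ⊔ Q) (maximalIdeal R) 2)
    (hd : Dlt (⊥ : Ideal R) (maximalIdeal R) (c + 3)) (hch : Ch (c + 2) (⊥ : Ideal R) (maximalIdeal R))
    {f : R} (hf0 : f ≠ 0)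
    (hfP : ∀ P : Ideal R, P.IsPrime → Module.annihilator R (ann0 (sp l) (H l c (R ⧸ (⊥ : Ideal R)))) ≤ P → f ∈ P → P = maximalIdeal R)
    {p : Ideal R} (hp : p.IsPrime) (hfp : f ∈ p) (z : H l c (R ⧸ p)) : z = 0 := by
  by_contra hz
  obtain ⟨Q0, hQ0, hle, hfQ0, hcQ0⟩ := ht1 (d := c + 1) hp hf0 hfp hd hch
  have hbQ : ⊥ < Q0 := bot_lt_iff_ne_bot.2 fun h => hf0 (by rw [h] at hfQ0; exact hfQ0)
  have hdQ0 : Dlt Q0 (maximalIdeal R) (c + 1 + 1) := hd.of_lt Ideal.isPrime_bot hbQ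
  have hz0 : ∃ z : H l c (R ⧸ Q0), z ≠ 0 := by
    obtain ⟨w, rfl⟩ := hV.q_surj bot_le hle c le_rfl z
    exact ⟨w, fun h => hz (by rw [h, map_zero])⟩
  have hVQ : Van l Q0 c := hV.mono bot_le
  have hann : Module.annihilator R (R ⧸ Q0) = Q0 := Ideal.annihilator_quotient
  have hD2 : Dlt (sp l ⊔ Q0) (maximalIdeal R) 2 := (hQ Q0 hQ0 hbQ.ne').resolve_left fun h => by
    obtain ⟨z, hz⟩ := hz0
    exact hz (h (R ⧸ Q0) hann.ge c (by exact_mod_cast hc2) z)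
  obtain ⟨y, hy, hyav⟩ := avoid_top (n := 1) hD2 (a := maximalIdeal R) (dlt_mm le_rfl)
  have hr := m_le_rad_of_dlt (hD2.succ_of hyav)
  obtain ⟨z1, hz1⟩ := nonvan_prime (y :: l) (by simpa using ⟨hy, hl⟩) (c + 1) Q0 hQ0 (by
    rw [sp_cons, sup_right_comm]; exact hr) hdQ0 hcQ0
  obtain ⟨L, _, _, ι, δ, a, hι, h1, h2, h3⟩ := H.exists_loc (M := R ⧸ Q0) l c y ((c + 1 : ℕ) : ℤ) (by push_cast; ring)
  obtain ⟨t, rfl⟩ := (h2 z1).1 (hVQ (R ⧸ Q0) hann.ge _ (by push_cast; lia) _)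
  refine hz1 ?_
  have hTor : Tor (maximalIdeal R) (H l c (R ⧸ Q0)) := by
    refine Tor.of_rad ((tor_annX (H.torI l c (R ⧸ (⊥ : Ideal R)))).of_surj _ (hV.q_surj le_rfl (bot_le : ⊥ ≤ Q0) c le_rfl)) ?_
    refine le_rad_of fun P hP hPle => ?_
    rw [hfP P hP (le_sup_left.trans hPle) (hPle (Ideal.mem_sup_right (H.ann_le l c _ (by rw [hann]; exact hfQ0))))]
  rw [loc_sub (f := y) ι (fun a => hTor y hy a) t, map_zero]

lemma fzero_div {c : ℕ} {f : R} (hf0 : f ≠ 0) 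
    (h : ∀ p : Ideal R, p.IsPrime → f ∈ p → ∀ z : H l c (R ⧸ p), z = 0) (w : H l c (R ⧸ (⊥ : Ideal R))) :
    ∃ w' : H l c (R ⧸ (⊥ : Ideal R)), ∃ k : ℕ, f ^ k • (w - f • w') = 0 := by
  have hb : (⊥ : Ideal R).IsPrime := Ideal.isPrime_bot
  obtain ⟨w', hw'⟩ := (H.coker l f (R ⧸ (⊥ : Ideal R)) c (fun z => by
    have : Subsingleton (LinearMap.ker (f • LinearMap.id : (R ⧸ (⊥ : Ideal R)) →ₗ[R] (R ⧸ (⊥ : Ideal R)))) := by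
      refine subsingleton_of_forall_eq 0 ?_
      rintro ⟨x, hx⟩
      exact Subtype.ext (reg_of_prime (LinearEquiv.refl R (R ⧸ (⊥ : Ideal R))) (x := f) hf0 x hx)
    exact H.of_sub _ _ z) w).1 (dev l c _ (fun p hp hle => h p hp (hle (ann_quot (Ideal.mem_sup_right (Ideal.mem_span_singleton_self f))))) _)
  exact ⟨w', 0, by rw [hw', sub_self, smul_zero]⟩

end
end LCoh
end

section
open CategoryTheory
namespace LCoh
open IsLocalRing
section
variable {R : Type u} [CommRing R] [IsNoetherianRing R] {l : List R} [IsLocalRing R] [IsAdicComplete (maximalIdeal R) R]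
  [IsDomain R]

/-- finiteness of 0:_{V_k} I -/
lemma Vk_fin {c : ℕ} (hF : CFin l) (hV : Van l (⊥ : Ideal R) c) {f : R} (hf0 : f ≠ 0)
    (hft : ∀ (w : H l c (R ⧸ (⊥ : Ideal R))) (k : ℕ), f ^ k • w = 0 → w ∈ TS (maximalIdeal R) (H l c (R ⧸ (⊥ : Ideal R)))) (k : ℕ) :
    Module.Finite R (ann0 (sp l) (Vk f k (H (f :: l) ((c + 1 : ℕ) : ℤ) (R ⧸ (⊥ : Ideal R))))) := by
  have hb : (⊥ : Ideal R).IsPrime := Ideal.isPrime_bot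
  obtain ⟨L, _, _, ι, δ, a, hι, h1, h2, h3⟩ := H.exists_loc (M := R ⧸ (⊥ : Ideal R)) l c f ((c + 1 : ℕ) : ℤ) (by push_cast; ring)
  have hδ : Function.Surjective δ := fun z => (h2 z).1 (hV _ ann_b.ge _ (by push_cast; lia) _)
  have hbij := locunit (f := f) ι k
  let e : L ≃ₗ[R] L := LinearEquiv.ofBijective (f ^ k • LinearMap.id) hbij
  have he : ∀ y, f ^ k • e.symm y = y := fun y => e.apply_symm_apply y
  have hcod : ∀ w, δ (e.symm (ι w)) ∈ Vk f k (H (f :: l) ((c + 1 : ℕ) : ℤ) (R ⧸ (⊥ : Ideal R))) := fun w => by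
    rw [mem_Vk, ← map_smul, he, h1.apply_apply_eq_zero]
  let g := ((δ.comp e.symm.toLinearMap).comp ι).codRestrict _ hcod
  have hg : ∀ w, (g w).1 = δ (e.symm (ι w)) := fun w => rfl
  have hcok := H.coker l (f ^ k) (R ⧸ (⊥ : Ideal R)) c (fun z => by
    have : Subsingleton (LinearMap.ker (f ^ k • LinearMap.id : (R ⧸ (⊥ : Ideal R)) →ₗ[R] (R ⧸ (⊥ : Ideal R)))) := by
      refine subsingleton_of_forall_eq 0 ?_
      rintro ⟨x, hx⟩
      exact Subtype.ext (reg_of_prime (LinearEquiv.refl R (R ⧸ (⊥ : Ideal R))) (x := f ^ k) (pow_ne_zero k hf0) x hx)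
    exact H.of_sub _ _ z)
  refine wg_fin' (H.map l c (xM (f ^ k) (R ⧸ (⊥ : Ideal R))).mkQ) (hV.surj ann_b.ge _ (Submodule.mkQ_surjective _) c le_rfl)
    g ?_ ?_ ?_ (H.torI l c _) (hF _ _)
  · rintro ⟨z, hz⟩
    obtain ⟨y, rfl⟩ := hδ z
    rw [mem_Vk, ← map_smul] at hz
    obtain ⟨w, hw⟩ := (h1 _).1 hz
    refine ⟨w, Subtype.ext ?_⟩
    rw [hg, hw]
    congr 1
    exact hbij.1 (he _)
  · intro w hw
    obtain ⟨w', rfl⟩ := (hcok w).1 hw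
    refine Subtype.ext ?_
    rw [hg, map_smul, map_smul, he, h1.apply_apply_eq_zero]; rfl
  · intro w hw
    obtain ⟨w', hw'⟩ := (h1 _).1 (congrArg Subtype.val hw : δ (e.symm (ι w)) = 0)
    have h4 : ι (w - f ^ k • w') = 0 := by
      rw [map_sub, map_smul, hw']; exact sub_eq_zero.2 (he _).symm
    obtain ⟨n, hn⟩ := (lockern (f := f) ι _).1 h4
    have h5 := hft _ n hn
    have h6 : H.map l c (xM (f ^ k) (R ⧸ (⊥ : Ideal R))).mkQ w = H.map l c (xM (f ^ k) (R ⧸ (⊥ : Ideal R))).mkQ (w - f ^ k • w') := by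
      rw [map_sub, (hcok (f ^ k • w')).2 ⟨w', rfl⟩, sub_zero]
    rw [h6]
    refine mem_TS.2 fun x hx => ?_
    obtain ⟨j, hj⟩ := mem_TS.1 h5 x hx
    exact ⟨j, by rw [← map_smul, hj, map_zero]⟩

theorem caseD {c : ℕ} (hF : CFin l) (hV : Van l (⊥ : Ideal R) c)
    (hd : Dlt (⊥ : Ideal R) (maximalIdeal R) (c + 3)) (hD3 : ¬ Dlt (sp l) (maximalIdeal R) 3)
    (hX : ¬ Dlt (Module.annihilator R (ann0 (sp l) (H l c (R ⧸ (⊥ : Ideal R))))) (maximalIdeal R) 2) : False := by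
  have hF0 := hF (R ⧸ (⊥ : Ideal R)) c
  obtain ⟨f, hf, hfm, hft⟩ := avoidm (H.torI l c (R ⧸ (⊥ : Ideal R))) hF0
  obtain ⟨Q, hQ, haQ, hcQ⟩ : ∃ Q : Ideal R, Q.IsPrime ∧ Module.annihilator R (ann0 (sp l) (H l c (R ⧸ (⊥ : Ideal R)))) ≤ Q ∧ Ch 2 Q (maximalIdeal R) := by
    simpa [Dlt] using hX
  obtain ⟨Q1, hQ1, hQQ1, hfQ1, hcQ1⟩ := hcQ.drop hQ inferInstance hf
  obtain ⟨q, hq, hqle⟩ := Ideal.exists_minimalPrimes_le (I := Module.annihilator R (ann0 (sp l) (H l c (R ⧸ (⊥ : Ideal R)))) ⊔ Ideal.span {f}) (J := Q1)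
    (sup_span_le (haQ.trans hQQ1) hfQ1)
  have hqP : q.IsPrime := hq.1.1
  have hqm : q < maximalIdeal R := by
    obtain ⟨Q', hQ', hlt, hle⟩ := hcQ1
    exact (hqle.trans_lt hlt).trans_le hle
  have hfq : f ∈ q := hq.1.2 mem_sup_span
  obtain ⟨P, hP, hPq⟩ := Ideal.exists_minimalPrimes_le (I := Module.annihilator R (ann0 (sp l) (H l c (R ⧸ (⊥ : Ideal R))))) (J := q)
    (le_sup_left.trans hq.1.2)
  have hfP : f ∉ P := hfm P hP (hPq.trans_lt hqm).ne
  have hf0 : f ≠ 0 := fun h => hfP (h ▸ P.zero_mem)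
  refine hfP (?_ : f ∈ P)
  rw [lemA (H.torI l c (R ⧸ (⊥ : Ideal R))) hF0 q hfq (fun P hP h1 h2 h3 => le_antisymm h3 (hq.2 ⟨hP, sup_span_le h1 h2⟩ h3)) ?_ P hP.1.1 hP.1.2 hPq]
  · exact hfq
  · have hU := D1 (J := sp l) (U := H (f :: l) ((c + 1 : ℕ) : ℤ) (R ⧸ (⊥ : Ideal R)))
      ((H.torI (f :: l) _ _).mono (by rw [sp_cons]; exact le_sup_left)) hf (fun u => H.tors _ _ f (by simp) u)
      (Vk_fin hF hV hf0 hft) (fun f2 hf2 v K => by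
        refine div_of_van (c := c + 1) (f := f2) (HL_zero (f2 :: f :: l) (c + 2) ⊥ Ideal.isPrime_bot hd (fun h => hD3 ?_)) v K
        rw [sup_bot_eq, sp_cons, sp_cons] at h
        exact ((dlt_one h).drop hf2).drop hf)
    intro w
    obtain ⟨L, _, _, ι, δ, a, hι, h1, h2, h3⟩ := H.exists_loc (M := R ⧸ (⊥ : Ideal R)) l c f ((c + 1 : ℕ) : ℤ) (by push_cast; ring)
    obtain ⟨y, hy⟩ := (locunit (f := f) ι 1).2 (ι w)
    have hy' : f • y = ι w := by simpa using hy
    obtain ⟨s, hs, hsq⟩ := SetLike.exists_of_lt hqm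
    obtain ⟨k, hk⟩ := mem_TS.1 (hU (δ y) (by rw [← map_smul, hy', h1.apply_apply_eq_zero])) s hs
    rw [← map_smul] at hk
    obtain ⟨w', hw'⟩ := (h1 _).1 hk
    obtain ⟨n, hn⟩ := (lockern (f := f) ι (s ^ k • w - f • w')).1 (by
      rw [map_sub, map_smul, map_smul, hw', ← hy', smul_comm, sub_self])
    exact ⟨s ^ k, fun h => hsq (hqP.mem_of_pow_mem _ h), w', n, hn⟩

end
end LCoh
end

section
open CategoryTheory
namespace LCoh
open IsLocalRing
section
variable {R : Type u} [CommRing R] [IsNoetherianRing R] {l : List R} [IsLocalRing R] [IsAdicComplete (maximalIdeal R) R]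
  [IsDomain R]

theorem main2 (hl : ∀ x ∈ l, x ∈ maximalIdeal R) (hF : CFin l)
    (hQ : ∀ Q : Ideal R, Q.IsPrime → Q ≠ ⊥ → Van l Q 1 ∨ Dlt (sp l ⊔ Q) (maximalIdeal R) 2)
    (hD : ¬ Dlt (sp l) (maximalIdeal R) 2) (hne : ∃ i : ℕ, 2 ≤ i ∧ ∃ z : H l i (R ⧸ (⊥ : Ideal R)), z ≠ 0)
    {P1 : Ideal R} (hP1 : P1.IsPrime) (hlP1 : sp l ≤ P1) (hP12 : ¬ Ch 2 ⊥ P1) : False := by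
  classical
  have hb : (⊥ : Ideal R).IsPrime := Ideal.isPrime_bot
  obtain ⟨d, hd1, hd2⟩ := exists_dim_prime (⊥ : Ideal R) hb
  have hvan : ∀ i : ℕ, d + 1 ≤ i → ∀ z : H l i (R ⧸ (⊥ : Ideal R)), z = 0 := fun i hi z =>
    vanm l (n := d + 1) (by rw [ann_b]; exact hd1) (by exact_mod_cast hi) z
  obtain ⟨c, hc2, hcne, hctop⟩ : ∃ c : ℕ, 2 ≤ c ∧ (∃ z : H l c (R ⧸ (⊥ : Ideal R)), z ≠ 0) ∧
      ∀ i : ℕ, c < i → ∀ z : H l i (R ⧸ (⊥ : Ideal R)), z = 0 := by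
    obtain ⟨i, hi2, hi⟩ := hne
    have hid : i ≤ d := by
      by_contra hcon
      obtain ⟨z, hz⟩ := hi
      exact hz (hvan i (by lia) z)
    refine ⟨Nat.findGreatest (fun i => ∃ z : H l i (R ⧸ (⊥ : Ideal R)), z ≠ 0) d, hi2.trans (Nat.le_findGreatest hid hi),
      Nat.findGreatest_spec (P := fun i => ∃ z : H l i (R ⧸ (⊥ : Ideal R)), z ≠ 0) hid hi, fun j hj z => ?_⟩
    by_contra hz
    rcases le_or_gt j d with h | h
    · exact Nat.findGreatest_is_greatest hj h ⟨z, hz⟩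
    · exact hz (hvan j h z)
  have hV : Van l (⊥ : Ideal R) c := Van.of fun i hi => by
    obtain ⟨j, rfl⟩ := Int.eq_ofNat_of_zero_le (show 0 ≤ i by lia)
    exact hctop j (by exact_mod_cast hi)
  have hF0 := hF (R ⧸ (⊥ : Ideal R)) c
  obtain ⟨Q, ⟨hQp, hQne⟩, hQmax⟩ := set_has_maximal_iff_noetherian.2 (inferInstance : IsNoetherian R R)
    {Q : Ideal R | Q.IsPrime ∧ ∃ z : H l c (R ⧸ Q), z ≠ 0} ⟨⊥, hb, hcne⟩
  obtain ⟨hr, hdQ, hchQ⟩ := max_Q hl hF hQp (hV.mono bot_le) hQne (fun Q' hQ' hlt z => by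
    by_contra hz
    exact hQmax Q' ⟨hQ', z, hz⟩ hlt)
  have hQ0 : Q ≠ ⊥ := by
    rintro rfl
    rw [sup_bot_eq] at hr
    exact hD ((dlt_one hr).mono le_rfl (by lia))
  have hA : ¬ maximalIdeal R ≤ (Module.annihilator R (ann0 (sp l) (H l c (R ⧸ (⊥ : Ideal R))))).radical :=
    fun h => T0 hQp hQ0 (by lia) hV hr hdQ hchQ hQne hF0 h
  have hcd : c + 1 ≤ d := by
    by_contra hcon
    exact hd1.not_ch hb (((Ch.one hQp (bot_lt_iff_ne_bot.2 hQ0)).trans hchQ).mono (by lia))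
  obtain ⟨d, rfl⟩ : ∃ d', d = d' + 1 := ⟨d - 1, by lia⟩
  obtain ⟨x, hxQ, hx0⟩ := (Submodule.ne_bot_iff _).1 hQ0
  have hdc : d ≤ c + 1 := by
    obtain ⟨Q0, hQ0p, hle, hxQ0, hcQ0⟩ := ht1 hQp hx0 hxQ hd1 hd2
    have hbQ : Q0 ≠ ⊥ := fun h => hx0 (by rw [h] at hxQ0; exact hxQ0)
    have hD2 : Dlt (sp l ⊔ Q0) (maximalIdeal R) 2 := (hQ Q0 hQ0p hbQ).resolve_left fun h => by
      obtain ⟨z, hz⟩ := hQne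
      obtain ⟨w, rfl⟩ := hV.q_surj bot_le hle c le_rfl z
      exact hz (by rw [h (R ⧸ Q0) Ideal.annihilator_quotient.ge c (by exact_mod_cast hc2) w, map_zero])
    have h1 := cd_dim hl (t := c) (s := 1) (hV.mono bot_le) hD2
    by_contra hcon
    exact h1.not_ch hQ0p (hcQ0.mono (by lia))
  have hBgen : Dlt (Module.annihilator R (ann0 (sp l) (H l c (R ⧸ (⊥ : Ideal R))))) (maximalIdeal R) 2 →
      (∀ f : R, f ≠ 0 → f ∈ maximalIdeal R → (∀ P : Ideal R, P.IsPrime → Module.annihilator R (ann0 (sp l) (H l c (R ⧸ (⊥ : Ideal R)))) ≤ P → f ∈ P → P = maximalIdeal R) →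
        ∀ w : H l c (R ⧸ (⊥ : Ideal R)), ∃ w' : H l c (R ⧸ (⊥ : Ideal R)), ∃ k : ℕ, f ^ k • (w - f • w') = 0) → False := by
    intro h2 hdiv
    obtain ⟨f, hf, hav⟩ := avoid_top (n := 1) h2 (a := maximalIdeal R) (dlt_mm le_rfl)
    have hfP : ∀ P : Ideal R, P.IsPrime → Module.annihilator R (ann0 (sp l) (H l c (R ⧸ (⊥ : Ideal R)))) ≤ P → f ∈ P → P = maximalIdeal R := by
      intro P hP h1 h2
      by_contra hcon
      exact hav P hP h1 (Ch.one inferInstance (lt_m hP hcon)) h2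
    by_cases hf0 : f = 0
    · exact hA (le_rad_of fun P hP hle => by rw [hfP P hP hle (hf0 ▸ P.zero_mem)])
    · exact hA (stepB hF0 hf hfP (hdiv f hf0 hf hfP))
  obtain rfl | rfl : d = c ∨ d = c + 1 := by lia
  · refine hBgen ?_ fun f _ hf _ w => caseB1 hd1 hD hf w
    intro P hP hle hc
    exact hd1.not_ch hb (((ch_of_ann hF0 hP hle).trans hc).mono (by lia))
  · by_cases h2 : Dlt (Module.annihilator R (ann0 (sp l) (H l c (R ⧸ (⊥ : Ideal R))))) (maximalIdeal R) 2
    · exact hBgen h2 fun f hf0 hf hfP w => fzero_div hf0 (fun p hp hfp z => fzero hc2 hl hV hQ hd1 hd2 hf0 hfP hp hfp z) w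
    · refine caseD hF hV hd1 (fun h3 => ?_) h2
      have hP1b : P1 ≠ ⊥ := by
        rintro rfl
        obtain ⟨z, hz⟩ := hcne
        refine hz (H.of_tors l c (by lia) (fun m x hx => ⟨1, ?_⟩) z)
        have hx0 : x = 0 := hlP1 (mem_sp hx)
        rw [hx0, pow_one, zero_smul]
      have := cat2 hb hP1 (bot_lt_iff_ne_bot.2 hP1b) (fun P hP h1 h2 => hP12 ((Ch.one hP h1).trans (Ch.one hP1 h2))) hd1 hd2
      exact h3 P1 hP1 hlP1 (this.mono (by lia))

theorem main3 (hl : ∀ x ∈ l, x ∈ maximalIdeal R) (hF : CFin l)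
    (hQ : ∀ Q : Ideal R, Q.IsPrime → Q ≠ ⊥ → Van l Q 1 ∨ Dlt (sp l ⊔ Q) (maximalIdeal R) 2)
    (hD : ¬ Dlt (sp l) (maximalIdeal R) 2) (hne : ¬ Van l (⊥ : Ideal R) 1) :
    Dlt (⊥ : Ideal R) (maximalIdeal R) 5 ∧ Ch 4 (⊥ : Ideal R) (maximalIdeal R) ∧
      (∀ P : Ideal R, P.IsPrime → sp l ≤ P → Ch 2 ⊥ P) ∧
      ∃ P : Ideal R, P.IsPrime ∧ sp l ≤ P ∧ ¬ Ch 3 ⊥ P := by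
  have h2 : ∀ P : Ideal R, P.IsPrime → sp l ≤ P → Ch 2 ⊥ P := by
    intro P hP hle
    by_contra hcon
    refine main2 hl hF hQ hD ?_ hP hle hcon
    by_contra! h
    refine hne (Van.of fun i hi => ?_)
    obtain ⟨j, rfl⟩ := Int.eq_ofNat_of_zero_le (show 0 ≤ i by lia)
    exact h j (by lia)
  obtain ⟨h3, h4, h5⟩ := main1 hl hQ hD h2
  exact ⟨h3, h4, h2, h5⟩

end
end LCoh
end

section
open CategoryTheory Opposite
namespace LCoh
section
variable {R : Type u} [CommRing R]

noncomputable def ylmap {P P' : ChainComplex (ModuleCat.{u} R) ℕ} (φ : P' ⟶ P) (Y : ModuleCat.{u} R) :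
   P.linearYonedaObj R Y ⟶ P'.linearYonedaObj R Y :=
  (HomologicalComplex.unopFunctor _ _).map
    ((((linearYoneda R (ModuleCat.{u} R)).obj Y).rightOp.mapHomologicalComplex _).map φ).op

lemma ylmap_f {P P' : ChainComplex (ModuleCat.{u} R) ℕ} (φ : P' ⟶ P) (Y : ModuleCat.{u} R) (n : ℕ) (z : P.X n ⟶ Y) :
   ((ylmap φ Y).f n).hom z = φ.f n ≫ z := rfl

lemma homologyUnop_nat {K L : HomologicalComplex (ModuleCat.{u} R)ᵒᵖ (ComplexShape.down ℕ)} (φ : K ⟶ L) (n : ℕ) :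
   HomologicalComplex.homologyMap ((HomologicalComplex.unopFunctor _ _).map φ.op) n ≫ (K.homologyUnop n).hom
     = (L.homologyUnop n).hom ≫ (HomologicalComplex.homologyMap φ n).unop := by
  apply Quiver.Hom.op_inj
  have := HomologicalComplex.homologyOp_hom_naturality ((HomologicalComplex.unopFunctor _ _).map φ.op) n
  exact this.symm

lemma abs_sq {C : Type*} [Category* C] {a b c a' b' c' : C} {u : a ⟶ b} {v : b ⟶ c} {m : c ⟶ c'} {h : a ⟶ a'} {u' : a' ⟶ b'}
  {v' : b' ⟶ c'} {m' : b ⟶ b'} (h3 : v ≫ m = m' ≫ v') (h2 : h ≫ u' = u ≫ m') : (u ≫ v) ≫ m = h ≫ (u' ≫ v') := by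
  rw [Category.assoc, h3, reassoc_of% h2]

lemma ext_nat {X X' : ModuleCat.{u} R} (P : ProjectiveResolution X) (P' : ProjectiveResolution X') (g : X' ⟶ X)
   (φ : P'.complex ⟶ P.complex) (comm : φ.f 0 ≫ P.π.f 0 = P'.π.f 0 ≫ g) (Y : ModuleCat.{u} R) (n : ℕ) :
   ((Ext R (ModuleCat.{u} R) n).map g.op).app Y ≫ (P'.isoExt n Y).hom
    = (P.isoExt n Y).hom ≫ HomologicalComplex.homologyMap (ylmap φ Y) n := by
  rw [← Iso.inv_comp_eq, ← Category.assoc, ← Iso.eq_comp_inv]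
  have h1 := ProjectiveResolution.isoLeftDerivedObj_hom_naturality g P' P φ comm ((linearYoneda R (ModuleCat.{u} R)).obj Y).rightOp n
  have h2 := homologyUnop_nat ((((linearYoneda R (ModuleCat.{u} R)).obj Y).rightOp.mapHomologicalComplex _).map φ) n
  have h3 := congrArg Quiver.Hom.unop h1
  simp only [unop_comp] at h3
  exact abs_sq h3 h2


lemma homfact (K : CochainComplex (ModuleCat.{u} R) ℕ) (n : ℕ) :
  (∀ c, (K.d n (n+1)).hom ((K.iCycles n).hom c) = 0) ∧ (∀ x : K.X n, (K.d n (n+1)).hom x = 0 → ∃ c, (K.iCycles n).hom c = x) ∧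
  Function.Surjective (K.homologyπ n).hom ∧ (∀ p, p + 1 = n → ∀ c, (K.homologyπ n).hom c = 0 ↔ ∃ w : K.X p, (K.d p n).hom w = (K.iCycles n).hom c)
  ∧ (n = 0 → ∀ c, (K.homologyπ n).hom c = 0 ↔ (K.iCycles n).hom c = 0) := by
  have hinj : Function.Injective (K.iCycles n).hom := (ModuleCat.mono_iff_injective _).1 inferInstance
  have hcok : ∀ p, (ComplexShape.up ℕ).prev n = p → ∀ c, (K.homologyπ n).hom c = 0 ↔ ∃ w : K.X p, (K.d p n).hom w = (K.iCycles n).hom c := by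
    intro p hp c
    have h1 := ShortComplex.exact_of_g_is_cokernel (ShortComplex.mk (K.toCycles p n) (K.homologyπ n) (K.toCycles_comp_homologyπ p n)) (K.homologyIsCokernel p n hp)
    have h2 := (ShortComplex.moduleCat_exact_iff _).1 h1
    constructor
    · intro h
      obtain ⟨w, hw⟩ := h2 c h
      refine ⟨w, ?_⟩
      rw [← K.toCycles_i p n]
      exact congrArg _ hw
    · rintro ⟨w, hw⟩
      have : (K.toCycles p n).hom w = c := by
        apply hinj
        rw [← hw, ← K.toCycles_i p n]
        rfl
      rw [← this]
      exact congrArg (fun f => f.hom w) (K.toCycles_comp_homologyπ p n)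
  refine ⟨?_, ?_, (ModuleCat.epi_iff_surjective _).1 inferInstance, ?_, ?_⟩
  · intro c
    exact congrArg (fun f => f.hom c) (K.iCycles_d n (n+1))
  · intro x hx
    have h1 := ShortComplex.exact_of_f_is_kernel (ShortComplex.mk (K.iCycles n) (K.d n (n+1)) (K.iCycles_d n (n+1))) (K.cyclesIsKernel n (n+1) (by simp))
    exact (ShortComplex.moduleCat_exact_iff _).1 h1 x hx
  · intro p hp
    exact hcok p (by subst hp; simp)
  · rintro rfl c
    rw [hcok 0 (by simp)]
    have : K.d 0 0 = 0 := K.shape _ _ (by simp)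
    rw [this]
    constructor
    · rintro ⟨w, hw⟩; rw [← hw]; rfl
    · intro h; exact ⟨0, by rw [h]; rfl⟩

lemma extMk_zero_deg {X Y : ModuleCat.{u} R} (P : ProjectiveResolution X) (f : P.complex.X 0 ⟶ Y) (hf : P.complex.d 1 0 ≫ f = 0)
   (h : P.extMk f 1 rfl hf = (0 : Abelian.Ext.{u} X Y 0)) : f = 0 := by
  rw [← P.extEquivCohomologyClass.apply_eq_iff_eq, P.extEquivCohomologyClass_extMk, P.extEquivCohomologyClass_zero,
    CochainComplex.HomComplex.CohomologyClass.mk_eq_zero_iff, CochainComplex.HomComplex.Cocycle.toSingleMk_mem_coboundaries_iff _ _ _ _ _ (1) (by simp)] at h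
  obtain ⟨g, hg⟩ := h
  have hz : Limits.IsZero (P.cochainComplex.X 1) := by
    exact P.cochainComplex.isZero_of_isStrictlyLE 0 1 (by simp)
  have : P.cochainComplex.d (-((0:ℕ):ℤ)) 1 = 0 := hz.eq_of_tgt _ _
  rw [this, Limits.zero_comp] at hg
  rw [← cancel_epi (P.cochainComplexXIso (-((0:ℕ):ℤ)) 0 rfl).hom, ← hg, Limits.comp_zero]

lemma exists_beta {X : ModuleCat.{u} R} (P : ProjectiveResolution X) (Y : ModuleCat.{u} R) (K : CochainComplex (ModuleCat.{u} R) ℕ)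
   (t : ∀ n, K.X n ≃ₗ[R] (P.complex.X n ⟶ Y)) (htd : ∀ i j x, t j ((K.d i j).hom x) = P.complex.d j i ≫ t i x) (n : ℕ) :
   ∃ β : K.homology n ≃ₗ[R] Abelian.Ext.{u} X Y n,
    ∀ (c : K.cycles n) (hf : P.complex.d (n+1) n ≫ t n ((K.iCycles n).hom c) = 0),
      β ((K.homologyπ n).hom c) = P.extMk (t n ((K.iCycles n).hom c)) (n+1) rfl hf := by
  obtain ⟨ha, hb, hπ, hp, h0⟩ := homfact K n
  have hcyc : ∀ c : K.cycles n, P.complex.d (n+1) n ≫ (t n ((K.iCycles n).hom c)) = 0 := by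
    intro c
    rw [← htd, ha, map_zero]
  let κ : K.cycles n →ₗ[R] Abelian.Ext.{u} X Y n :=
    { toFun := fun c => P.extMk (t n ((K.iCycles n).hom c)) (n+1) rfl (hcyc c)
      map_add' := by
        intro c c'
        rw [P.add_extMk]
        congr 1
        rw [map_add, map_add]
      map_smul' := by
        intro r c
        rw [RingHom.id_apply, Abelian.Ext.smul_eq_comp_mk₀, P.extMk_comp_mk₀]
        congr 1
        rw [map_smul, map_smul]
        simp }
  have hlift : ∀ f : P.complex.X n ⟶ Y, P.complex.d (n+1) n ≫ f = 0 → ∃ c : K.cycles n, t n ((K.iCycles n).hom c) = f := by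
    intro f hf
    obtain ⟨c, hc⟩ := hb ((t n).symm f) (by
      apply (t (n+1)).injective
      rw [htd, map_zero, LinearEquiv.apply_symm_apply, hf])
    exact ⟨c, by rw [hc, LinearEquiv.apply_symm_apply]⟩
  have hsurj : Function.Surjective κ := by
    intro x
    obtain ⟨f, hf, rfl⟩ := P.extMk_surjective x (n+1) rfl
    obtain ⟨c, hc⟩ := hlift f hf
    refine ⟨c, ?_⟩
    show P.extMk (t n ((K.iCycles n).hom c)) (n+1) rfl (hcyc c) = _
    congr 1
  have hker : LinearMap.ker κ = LinearMap.ker (K.homologyπ n).hom := by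
    ext c
    rw [LinearMap.mem_ker, LinearMap.mem_ker]
    show P.extMk (t n ((K.iCycles n).hom c)) (n+1) rfl (hcyc c) = 0 ↔ _
    rcases Nat.eq_zero_or_pos n with hn | hn
    · rw [h0 hn]
      subst hn
      constructor
      · intro h
        have := extMk_zero_deg P _ _ h
        exact (t 0).injective (by rw [this, map_zero])
      · intro h
        have : t 0 ((K.iCycles 0).hom c) = 0 := by rw [h, map_zero]
        simp only [this, ProjectiveResolution.extMk_zero]
    · obtain ⟨p, rfl⟩ : ∃ p, n = p + 1 := ⟨n-1, by omega⟩
      rw [hp p rfl, P.extMk_eq_zero_iff _ _ _ _ p rfl]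
      constructor
      · rintro ⟨g, hg⟩
        refine ⟨(t p).symm g, (t (p+1)).injective ?_⟩
        rw [htd, LinearEquiv.apply_symm_apply, hg]
      · rintro ⟨w, hw⟩
        exact ⟨t p w, by rw [← htd, hw]⟩
  let β := ((LinearMap.quotKerEquivOfSurjective _ hπ).symm.trans (Submodule.quotEquivOfEq _ _ hker.symm)).trans
    (LinearMap.quotKerEquivOfSurjective κ hsurj)
  refine ⟨β, ?_⟩
  intro c hf
  have h1 : (LinearMap.quotKerEquivOfSurjective _ hπ).symm ((K.homologyπ n).hom c) = Submodule.Quotient.mk c := by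
    rw [LinearEquiv.symm_apply_eq]; rfl
  show (LinearMap.quotKerEquivOfSurjective κ hsurj) (Submodule.quotEquivOfEq _ _ hker.symm ((LinearMap.quotKerEquivOfSurjective _ hπ).symm ((K.homologyπ n).hom c))) = _
  rw [h1]
  rfl


noncomputable def yt (P : ChainComplex (ModuleCat.{u} R) ℕ) (Y : ModuleCat.{u} R) (n : ℕ) :
   (P.linearYonedaObj R Y).X n ≃ₗ[R] (P.X n ⟶ Y) := LinearEquiv.refl _ _

lemma yt_d (P : ChainComplex (ModuleCat.{u} R) ℕ) (Y : ModuleCat.{u} R) (i j : ℕ) (x) :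
   yt P Y j (((P.linearYonedaObj R Y).d i j).hom x) = P.d j i ≫ yt P Y i x := rfl

lemma yt_map {P P' : ChainComplex (ModuleCat.{u} R) ℕ} (φ : P' ⟶ P) (Y : ModuleCat.{u} R) (n : ℕ) (z) :
   yt P' Y n (((ylmap φ Y).f n).hom z) = φ.f n ≫ yt P Y n z := rfl

noncomputable def beta {X : ModuleCat.{u} R} (P : ProjectiveResolution X) (Y : ModuleCat.{u} R) (n : ℕ) :
   (P.complex.linearYonedaObj R Y).homology n ≃ₗ[R] Abelian.Ext.{u} X Y n :=
  (exists_beta P Y _ (yt P.complex Y) (yt_d P.complex Y) n).choose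

lemma beta_pi {X : ModuleCat.{u} R} (P : ProjectiveResolution X) (Y : ModuleCat.{u} R) (n : ℕ) (c) (hf) :
   beta P Y n (((P.complex.linearYonedaObj R Y).homologyπ n).hom c) =
     P.extMk (yt P.complex Y n (((P.complex.linearYonedaObj R Y).iCycles n).hom c)) (n+1) rfl hf :=
  (exists_beta P Y _ (yt P.complex Y) (yt_d P.complex Y) n).choose_spec c hf

lemma beta_nat {X X' : ModuleCat.{u} R} (P : ProjectiveResolution X) (P' : ProjectiveResolution X') (g : X' ⟶ X)
   (φ : P'.Hom P g) (Y : ModuleCat.{u} R) (n : ℕ) (x) :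
   beta P' Y n ((HomologicalComplex.homologyMap (ylmap φ.hom Y) n).hom x) = (Abelian.Ext.mk₀ g).comp (beta P Y n x) (zero_add _) := by
  obtain ⟨ha, hb, hπ, -, -⟩ := homfact (P.complex.linearYonedaObj R Y) n
  obtain ⟨c, rfl⟩ := hπ x
  have hf : P.complex.d (n+1) n ≫ yt P.complex Y n (((P.complex.linearYonedaObj R Y).iCycles n).hom c) = 0 := by
    rw [← yt_d, ha, map_zero]
  rw [beta_pi P Y n c hf, ProjectiveResolution.mk₀_comp_extMk _ _ _ _ φ]
  have h1 : (HomologicalComplex.homologyMap (ylmap φ.hom Y) n).hom (((P.complex.linearYonedaObj R Y).homologyπ n).hom c) =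
     ((P'.complex.linearYonedaObj R Y).homologyπ n).hom ((HomologicalComplex.cyclesMap (ylmap φ.hom Y) n).hom c) :=
    congrArg (fun f => f.hom c) (HomologicalComplex.homologyπ_naturality (ylmap φ.hom Y) n)
  have h2 : ((P'.complex.linearYonedaObj R Y).iCycles n).hom ((HomologicalComplex.cyclesMap (ylmap φ.hom Y) n).hom c) =
      ((ylmap φ.hom Y).f n).hom (((P.complex.linearYonedaObj R Y).iCycles n).hom c) :=
    congrArg (fun f => f.hom c) (HomologicalComplex.cyclesMap_i (ylmap φ.hom Y) n)
  have h3 : yt P'.complex Y n (((P'.complex.linearYonedaObj R Y).iCycles n).hom ((HomologicalComplex.cyclesMap (ylmap φ.hom Y) n).hom c)) =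
     φ.hom.f n ≫ yt P.complex Y n (((P.complex.linearYonedaObj R Y).iCycles n).hom c) := by
    rw [h2, yt_map]
  rw [h1, beta_pi]
  · congr 1
  · rw [h3, ← φ.hom.comm_assoc, hf, Limits.comp_zero]

/-- old Ext ≃ new Ext -/
noncomputable def br (X Y : ModuleCat.{u} R) (n : ℕ) :
   ((Ext R (ModuleCat.{u} R) n).obj (op X)).obj Y ≃ₗ[R] Abelian.Ext.{u} X Y n :=
  ((projectiveResolution X).isoExt n Y).toLinearEquiv.trans (beta (projectiveResolution X) Y n)

lemma br_nat {X X' : ModuleCat.{u} R} (g : X' ⟶ X) (Y : ModuleCat.{u} R) (n : ℕ) (x) :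
   br X' Y n ((((Ext R (ModuleCat.{u} R) n).map g.op).app Y).hom x) = (Abelian.Ext.mk₀ g).comp (br X Y n x) (zero_add _) := by
  let φ : (projectiveResolution X').Hom (projectiveResolution X) g := ProjectiveResolution.Hom.mk (ProjectiveResolution.lift g _ _) (by
    have := ProjectiveResolution.lift_commutes g (projectiveResolution X') (projectiveResolution X)
    exact congrArg (fun f => f.f 0) this)
  have h := ext_nat (projectiveResolution X) (projectiveResolution X') g φ.hom (by
    simpa using φ.hom_f_zero_comp_π_f_zero) Y n
  have h2 := congrArg (fun f => f.hom x) h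
  show beta _ Y n (((projectiveResolution X').isoExt n Y).hom.hom _) = _
  refine (congrArg (beta (projectiveResolution X') Y n) h2).trans ?_
  exact beta_nat _ _ g φ Y n _

end
end LCoh
end

section
open CategoryTheory Opposite
namespace LCoh
section
variable {R : Type u} [CommRing R]

/-- transition map -/
noncomputable def trm (J : Ideal R) {n m : ℕ} (h : n ≤ m) : ModuleCat.of R (R ⧸ J ^ m) ⟶ ModuleCat.of R (R ⧸ J ^ n) :=
  ModuleCat.ofHom <| Submodule.mapQ _ _ LinearMap.id (Ideal.pow_le_pow_right h)

lemma lc_rep (J : Ideal R) (i : ℕ) (M : ModuleCat.{u} R) :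
   ∃ rep : ∀ n, Abelian.Ext.{u} (ModuleCat.of R (R ⧸ J ^ n)) M i →ₗ[R] (localCohomology J i).obj M,
    (∀ x, ∃ n a, rep n a = x) ∧
    (∀ n m (h : n ≤ m) a, rep m ((Abelian.Ext.mk₀ (trm J h)).comp a (zero_add _)) = rep n a) ∧
    (∀ n a, rep n a = 0 → ∃ m, ∃ h : n ≤ m, (Abelian.Ext.mk₀ (trm J h)).comp a (zero_add _) = 0) := by
  let D := localCohomology.diagram (localCohomology.idealPowersDiagram J) i
  have := localCohomology.hasColimitDiagram.{u, 0} (localCohomology.idealPowersDiagram J) i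
  let F := D ⋙ (evaluation (ModuleCat.{u} R) (ModuleCat.{u} R)).obj M
  let co : Limits.Cocone F := ((evaluation (ModuleCat.{u} R) (ModuleCat.{u} R)).obj M).mapCocone (Limits.colimit.cocone D)
  have hco : Limits.IsColimit co := Limits.isColimitOfPreserves _ (Limits.colimit.isColimit D)
  have hpt : co.pt = (localCohomology J i).obj M := rfl
  have hpf : Limits.PreservesFilteredColimitsOfSize.{0, 0} (forget (ModuleCat.{u} R)) :=
    Limits.preservesFilteredColimitsOfSize_of_univLE.{u, u, 0, 0} _
  have hpc : Limits.PreservesColimit F (forget (ModuleCat.{u} R)) := (hpf.preserves_filtered_colimits (ℕᵒᵖ)ᵒᵖ).preservesColimit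
  let ix : ℕ → (ℕᵒᵖ)ᵒᵖ := fun n => op (op n)
  have hnat : ∀ n m (h : n ≤ m) (a : Abelian.Ext.{u} (ModuleCat.of R (R ⧸ J ^ n)) M i),
     br (ModuleCat.of R (R ⧸ J ^ m)) M i ((F.map (Quiver.Hom.op (Quiver.Hom.op (homOfLE h)) : ix n ⟶ ix m)).hom ((br (ModuleCat.of R (R ⧸ J ^ n)) M i).symm a)) =
       (Abelian.Ext.mk₀ (trm J h)).comp a (zero_add _) := by
    intro n m h a
    have := br_nat (trm J h) M i ((br (ModuleCat.of R (R ⧸ J ^ n)) M i).symm a)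
    rw [LinearEquiv.apply_symm_apply] at this
    exact this
  refine ⟨fun n => (co.ι.app (ix n)).hom ∘ₗ (br (ModuleCat.of R (R ⧸ J ^ n)) M i).symm.toLinearMap, ?_, ?_, ?_⟩
  · intro x
    obtain ⟨j, y, hy⟩ := Limits.Concrete.isColimit_exists_rep F hco x
    obtain ⟨n, rfl⟩ : ∃ n, j = ix n := ⟨j.unop.unop, rfl⟩
    refine ⟨n, br (ModuleCat.of R (R ⧸ J ^ n)) M i y, ?_⟩
    show (co.ι.app (ix n)).hom ((br (ModuleCat.of R (R ⧸ J ^ n)) M i).symm _) = x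
    exact (congrArg (co.ι.app (ix n)).hom ((br (ModuleCat.of R (R ⧸ J ^ n)) M i).symm_apply_apply y)).trans hy
  · intro n m h a
    show (co.ι.app (ix m)).hom ((br (ModuleCat.of R (R ⧸ J ^ m)) M i).symm _) = (co.ι.app (ix n)).hom ((br (ModuleCat.of R (R ⧸ J ^ n)) M i).symm _)
    rw [← hnat n m h a]
    refine (congrArg (co.ι.app (ix m)).hom ((br (ModuleCat.of R (R ⧸ J ^ m)) M i).symm_apply_apply _)).trans ?_
    exact congrArg (fun f => f.hom ((br _ M i).symm a)) (co.w (Quiver.Hom.op (Quiver.Hom.op (homOfLE h)) : ix n ⟶ ix m))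
  · intro n a ha
    have h0 : (co.ι.app (ix n)) ((br (ModuleCat.of R (R ⧸ J ^ n)) M i).symm a) = (co.ι.app (ix n)) 0 := by
      rw [map_zero]; exact ha
    obtain ⟨k, f, g, hfg⟩ := Limits.Concrete.isColimit_exists_of_rep_eq F hco _ _ h0
    obtain ⟨m, rfl⟩ : ∃ m, k = ix m := ⟨k.unop.unop, rfl⟩
    refine ⟨m, leOfHom f.unop.unop, ?_⟩
    rw [← hnat]
    have hf : f = Quiver.Hom.op (Quiver.Hom.op (homOfLE (leOfHom f.unop.unop))) := Subsingleton.elim _ _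
    rw [map_zero] at hfg
    rw [← hf]
    refine (congrArg (br _ M i) hfg).trans (map_zero _)
end
end LCoh
end

section
open CategoryTheory Opposite
namespace LCoh
section
variable {A : Type u} [CommRing A]

lemma rep_lift {X : ℕ → Type u} [∀ n, AddCommGroup (X n)] [∀ n, Module A (X n)] {L P : Type u}
    [AddCommGroup L] [Module A L] [AddCommGroup P] [Module A P]
    (t : ∀ n m, n ≤ m → X n → X m) (rep : ∀ n, X n →ₗ[A] L) (f : ∀ n, X n →ₗ[A] P)
    (h1 : ∀ x, ∃ n a, rep n a = x) (h2 : ∀ n m h a, rep m (t n m h a) = rep n a)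
    (h3 : ∀ n a, rep n a = 0 → ∃ m, ∃ h : n ≤ m, t n m h a = 0)
    (h4 : ∀ n m h a, f m (t n m h a) = f n a) :
    ∃ v : L →ₗ[A] P, ∀ n a, v (rep n a) = f n a := by
  have key : ∀ n a m b, rep n a = rep m b → f n a = f m b := by
    intro n a m b h
    have hz : rep (max n m) (t n _ (le_max_left _ _) a - t m _ (le_max_right _ _) b) = 0 := by
      rw [map_sub, h2, h2, h, sub_self]
    obtain ⟨k, hk, hk0⟩ := h3 _ _ hz
    have := h4 _ k hk (t n _ (le_max_left n m) a - t m _ (le_max_right n m) b)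
    rw [hk0, map_zero, map_sub, h4, h4] at this
    exact (sub_eq_zero.1 this.symm)
  choose N a ha using h1
  refine ⟨{ toFun := fun x => f (N x) (a x), map_add' := fun x y => ?_, map_smul' := fun r x => ?_ }, fun n b => key _ _ _ _ (ha _)⟩
  · rw [← h4 (N x) (max (N x) (N y)) (le_max_left _ _), ← h4 (N y) (max (N x) (N y)) (le_max_right _ _), ← map_add]
    apply key
    rw [map_add, h2, h2, ha, ha, ha]
  · rw [RingHom.id_apply, ← map_smul]
    apply key
    rw [map_smul, ha, ha]

lemma ses {M E N : Type u} [AddCommGroup M] [Module A M] [AddCommGroup E] [Module A E] [AddCommGroup N] [Module A N]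
    {a : M →ₗ[A] E} {b : E →ₗ[A] N} (ha : Function.Injective a) (hab : Function.Exact a b) (hb : Function.Surjective b) :
    ∃ w, (ShortComplex.mk (ModuleCat.ofHom a) (ModuleCat.ofHom b) w).ShortExact := by
  refine ⟨by ext x; exact (hab _).2 ⟨x, rfl⟩, ?_⟩
  have : Mono (ModuleCat.ofHom a) := (ModuleCat.mono_iff_injective _).2 ha
  have : Epi (ModuleCat.ofHom b) := (ModuleCat.epi_iff_surjective _).2 hb
  refine ⟨?_⟩
  rw [ShortComplex.ShortExact.moduleCat_exact_iff_function_exact] <;> exact hab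

lemma Inj.injective {E : Type u} [AddCommGroup E] [Module A E] (h : Inj A E) : Injective (ModuleCat.of A E) := by
  refine ⟨fun {X Y} g f hf => ?_⟩
  obtain ⟨k, hk⟩ := h X Y f.hom ((ModuleCat.mono_iff_injective _).1 hf) g.hom
  exact ⟨ModuleCat.ofHom k, by ext x; exact hk x⟩

/-- element of Hom out of a cyclic module -/
noncomputable def ev (J : Ideal A) (n : ℕ) (M : Type u) [AddCommGroup M] [Module A M] :
    Abelian.Ext.{u} (ModuleCat.of A (A ⧸ J ^ n)) (ModuleCat.of A M) 0 →ₗ[A] M where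
  toFun a := (Abelian.Ext.addEquiv₀ a).hom (Ideal.Quotient.mk _ 1)
  map_add' a b := by rw [map_add]; rfl
  map_smul' r a := by
    obtain ⟨f, rfl⟩ := (Abelian.Ext.mk₀_bijective _ _).2 a
    rw [← Abelian.Ext.mk₀_smul]
    show (Abelian.Ext.addEquiv₀ (Abelian.Ext.addEquiv₀.symm (r • f))).hom _ = r • (Abelian.Ext.addEquiv₀ (Abelian.Ext.addEquiv₀.symm f)).hom _
    rw [AddEquiv.apply_symm_apply, AddEquiv.apply_symm_apply]
    rfl

lemma ev_mk (J : Ideal A) (n : ℕ) {M : Type u} [AddCommGroup M] [Module A M] (f : ModuleCat.of A (A ⧸ J ^ n) ⟶ ModuleCat.of A M) :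
    ev J n M (Abelian.Ext.mk₀ f) = f.hom (Ideal.Quotient.mk _ 1) := by
  show (Abelian.Ext.addEquiv₀ (Abelian.Ext.addEquiv₀.symm f)).hom _ = _
  rw [AddEquiv.apply_symm_apply]

lemma ev_inj (J : Ideal A) (n : ℕ) {M : Type u} [AddCommGroup M] [Module A M] (a) (h : ev J n M a = 0) : a = 0 := by
  obtain ⟨f, rfl⟩ := (Abelian.Ext.mk₀_bijective _ _).2 a
  rw [ev_mk] at h
  rw [Abelian.Ext.mk₀_eq_zero_iff]
  refine ModuleCat.hom_ext (LinearMap.ext fun x => ?_)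
  obtain ⟨x, rfl⟩ := Ideal.Quotient.mk_surjective x
  have : (Ideal.Quotient.mk (J ^ n) x) = x • (Ideal.Quotient.mk (J ^ n) 1) := by
    rw [← mul_one x, map_mul, mul_one]; rfl
  show f.hom (Ideal.Quotient.mk _ x) = 0
  rw [this, map_smul, h, smul_zero]

lemma ev_range (J : Ideal A) (n : ℕ) {M : Type u} [AddCommGroup M] [Module A M] (m : M) :
    (∃ a, ev J n M a = m) ↔ ∀ x ∈ J ^ n, x • m = 0 := by
  constructor
  · rintro ⟨a, rfl⟩ x hx
    obtain ⟨f, rfl⟩ := (Abelian.Ext.mk₀_bijective _ _).2 a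
    rw [ev_mk, ← map_smul]
    have : x • (Ideal.Quotient.mk (J ^ n) 1) = 0 := by
      rw [← Ideal.Quotient.eq_zero_iff_mem.2 hx, ← mul_one x, map_mul, mul_one]; rfl
    erw [this, map_zero]
  · intro h
    refine ⟨Abelian.Ext.mk₀ (ModuleCat.ofHom (Submodule.liftQ _ (LinearMap.toSpanSingleton A M m) (fun x hx => h x hx))), ?_⟩
    rw [ev_mk]
    show LinearMap.toSpanSingleton A M m 1 = m
    simp

lemma ev_post (J : Ideal A) (n : ℕ) {M N : Type u} [AddCommGroup M] [Module A M] [AddCommGroup N] [Module A N]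
    (g : M →ₗ[A] N) (a) : ev J n N (a.comp (Abelian.Ext.mk₀ (ModuleCat.ofHom g)) (add_zero _)) = g (ev J n M a) := by
  obtain ⟨f, rfl⟩ := (Abelian.Ext.mk₀_bijective _ _).2 a
  rw [Abelian.Ext.mk₀_comp_mk₀, ev_mk, ev_mk]
  rfl

lemma ev_trm (J : Ideal A) {n m : ℕ} (h : n ≤ m) {M : Type u} [AddCommGroup M] [Module A M] (a) :
    ev J m M ((Abelian.Ext.mk₀ (trm J h)).comp a (zero_add _)) = ev J n M a := by
  obtain ⟨f, rfl⟩ := (Abelian.Ext.mk₀_bijective _ _).2 a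
  rw [Abelian.Ext.mk₀_comp_mk₀, ev_mk, ev_mk]
  rfl


/-- chosen representatives -/
noncomputable def lrep (J : Ideal A) (i : ℕ) (M : Type u) [AddCommGroup M] [Module A M] (n : ℕ) :
    Abelian.Ext.{u} (ModuleCat.of A (A ⧸ J ^ n)) (ModuleCat.of A M) i →ₗ[A] (localCohomology J i).obj (ModuleCat.of A M) :=
  (lc_rep J i (ModuleCat.of A M)).choose n

variable (J : Ideal A) (i : ℕ) {M E N : Type u} [AddCommGroup M] [Module A M] [AddCommGroup E] [Module A E] [AddCommGroup N] [Module A N]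

lemma lrep_surj (x : (localCohomology J i).obj (ModuleCat.of A M)) : ∃ n a, lrep J i M n a = x :=
  (lc_rep J i (ModuleCat.of A M)).choose_spec.1 x

lemma lrep_trm (n m : ℕ) (h : n ≤ m) (a) : lrep J i M m ((Abelian.Ext.mk₀ (trm J h)).comp a (zero_add _)) = lrep J i M n a :=
  (lc_rep J i (ModuleCat.of A M)).choose_spec.2.1 n m h a

lemma lrep_zero (n : ℕ) (a) (h : lrep J i M n a = 0) : ∃ m, ∃ h : n ≤ m, (Abelian.Ext.mk₀ (trm J h)).comp a (zero_add _) = 0 :=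
  (lc_rep J i (ModuleCat.of A M)).choose_spec.2.2 n a h

lemma lc_inj (hi : 0 < i) (hE : Inj A E)
    (z : (localCohomology J i).obj (ModuleCat.of A E)) : z = 0 := by
  obtain ⟨n, a, rfl⟩ := lrep_surj J i z
  obtain ⟨i, rfl⟩ : ∃ j, i = j + 1 := ⟨i - 1, by lia⟩
  have := hE.injective
  rw [Abelian.Ext.eq_zero_of_injective a, map_zero]

lemma lc_val : ∃ v : (localCohomology J 0).obj (ModuleCat.of A M) →ₗ[A] M, ∀ n a, v (lrep J 0 M n a) = ev J n M a :=
  rep_lift (fun n m h a => (Abelian.Ext.mk₀ (trm J h)).comp a (zero_add _)) (lrep J 0 M) (ev J · M)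
    (lrep_surj J 0) (lrep_trm J 0) (lrep_zero J 0) (fun n m h a => ev_trm J h a)

/-- value of a degree zero class -/
noncomputable def lv (M : Type u) [AddCommGroup M] [Module A M] : (localCohomology J 0).obj (ModuleCat.of A M) →ₗ[A] M := (lc_val J).choose

lemma lv_rep (n a) : lv J M (lrep J 0 M n a) = ev J n M a := (lc_val J).choose_spec n a

lemma lv_inj : Function.Injective (lv J M) := by
  rw [injective_iff_map_eq_zero]
  intro z hz
  obtain ⟨n, a, rfl⟩ := lrep_surj J 0 z
  rw [lv_rep] at hz
  rw [ev_inj J n a hz, map_zero]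

lemma lv_range (m : M) : (∃ z, lv J M z = m) ↔ ∃ n, ∀ x ∈ J ^ n, x • m = 0 := by
  constructor
  · rintro ⟨z, rfl⟩
    obtain ⟨n, a, rfl⟩ := lrep_surj J 0 z
    refine ⟨n, (ev_range J n _).1 ⟨a, (lv_rep J n a).symm⟩⟩
  · rintro ⟨n, h⟩
    obtain ⟨a, ha⟩ := (ev_range J n _).2 h
    exact ⟨lrep J 0 M n a, by rw [lv_rep, ha]⟩

lemma lc_delta {a : M →ₗ[A] E} {b : E →ₗ[A] N} (ha : Function.Injective a) (hab : Function.Exact a b) (hb : Function.Surjective b)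
    (hE : Inj A E) :
    ∃ δ : (localCohomology J i).obj (ModuleCat.of A N) →ₗ[A] (localCohomology J (i + 1)).obj (ModuleCat.of A M),
      Function.Surjective δ ∧ ∀ z, δ z = 0 ↔ ∃ n c, z = lrep J i N n (Abelian.Ext.comp c (Abelian.Ext.mk₀ (ModuleCat.ofHom b)) (add_zero _)) := by
  obtain ⟨w, hS⟩ := ses ha hab hb
  have := hE.injective
  obtain ⟨δ, hδ⟩ := rep_lift (fun n m h a => (Abelian.Ext.mk₀ (trm J h)).comp a (zero_add _)) (lrep J i N)
    (fun n => lrep J (i + 1) M n ∘ₗ { toFun := fun c => c.comp hS.extClass rfl, map_add' := fun c d => by rw [Abelian.Ext.add_comp], map_smul' := fun r c => by rw [Abelian.Ext.smul_comp]; rfl })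
    (lrep_surj J i) (lrep_trm J i) (lrep_zero J i) (fun n m h c => by
      show lrep J (i + 1) M m (Abelian.Ext.comp _ hS.extClass rfl) = lrep J (i + 1) M n (Abelian.Ext.comp _ hS.extClass rfl)
      rw [← lrep_trm J (i + 1) n m h]
      congr 1
      rw [Abelian.Ext.comp_assoc]
      lia)
  replace hδ : ∀ n c, δ (lrep J i N n c) = lrep J (i + 1) M n (c.comp hS.extClass rfl) := hδ
  refine ⟨δ, fun x => ?_, fun z => ⟨fun hz => ?_, ?_⟩⟩
  · obtain ⟨n, c, rfl⟩ := lrep_surj J _ x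
    obtain ⟨d, hd⟩ := Abelian.Ext.covariant_sequence_exact₁ _ hS c (Abelian.Ext.eq_zero_of_injective _) rfl
    exact ⟨lrep J i N n d, by rw [hδ, hd]⟩
  · obtain ⟨n, c, rfl⟩ := lrep_surj J _ z
    rw [hδ] at hz
    obtain ⟨m, h, hm⟩ := lrep_zero J _ n _ hz
    obtain ⟨d, hd⟩ := Abelian.Ext.covariant_sequence_exact₃ _ hS ((Abelian.Ext.mk₀ (trm J h)).comp c (zero_add _)) rfl (by
      rw [← hm, Abelian.Ext.comp_assoc]
      lia)
    refine ⟨m, d, ?_⟩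
    rw [← lrep_trm J i n m h]
    exact congrArg _ hd.symm
  · rintro ⟨n, c, rfl⟩
    rw [hδ, Abelian.Ext.comp_assoc (a₂₃ := 1) _ _ _ (add_zero _) (zero_add _) (by lia)]
    have := hS.comp_extClass
    dsimp only at this
    rw [this, Abelian.Ext.comp_zero, map_zero]

/-- Degree-shifting for local cohomology. -/
lemma lc_delta_pos {a : M →ₗ[A] E} {b : E →ₗ[A] N} (ha : Function.Injective a) (hab : Function.Exact a b) (hb : Function.Surjective b)
    (hE : Inj A E) (hi : 0 < i) :
    ∃ δ : (localCohomology J i).obj (ModuleCat.of A N) →ₗ[A] (localCohomology J (i + 1)).obj (ModuleCat.of A M),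
      Function.Bijective δ := by
  obtain ⟨δ, h1, h2⟩ := lc_delta J i ha hab hb hE
  refine ⟨δ, ?_, h1⟩
  rw [injective_iff_map_eq_zero]
  intro z hz
  obtain ⟨n, c, rfl⟩ := (h2 z).1 hz
  obtain ⟨i, rfl⟩ : ∃ j, i = j + 1 := ⟨i - 1, by lia⟩
  have := hE.injective
  rw [Abelian.Ext.eq_zero_of_injective c, Abelian.Ext.zero_comp, map_zero]

lemma lc_delta_zero {a : M →ₗ[A] E} {b : E →ₗ[A] N} (ha : Function.Injective a) (hab : Function.Exact a b) (hb : Function.Surjective b)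
    (hE : Inj A E) :
    ∃ δ : (localCohomology J 0).obj (ModuleCat.of A N) →ₗ[A] (localCohomology J 1).obj (ModuleCat.of A M),
      Function.Surjective δ ∧ ∀ z, δ z = 0 ↔ ∃ y : E, (∃ n, ∀ x ∈ J ^ n, x • y = 0) ∧ b y = lv J N z := by
  obtain ⟨δ, h1, h2⟩ := lc_delta J 0 ha hab hb hE
  refine ⟨δ, h1, fun z => (h2 z).trans ⟨?_, ?_⟩⟩
  · rintro ⟨n, c, rfl⟩
    refine ⟨ev J n E c, ⟨n, (ev_range J n _).1 ⟨c, rfl⟩⟩, ?_⟩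
    rw [lv_rep, ev_post]
  · rintro ⟨y, ⟨n, hn⟩, hy⟩
    obtain ⟨c, rfl⟩ := (ev_range J n _).2 hn
    refine ⟨n, c, lv_inj J ?_⟩
    rw [lv_rep, ev_post, hy]
end
end LCoh
end

section
open CategoryTheory Opposite
namespace LCoh
section
variable {R A : Type u} [CommRing R] [CommRing A] [IsNoetherianRing A]

lemma baer_step (J : Ideal A) {E : Type u} [AddCommGroup E] [Module A E] (hE : Inj A E) (f : A) (k s : ℕ) (n : E)
    (hn : ∀ x ∈ J ^ s, x • n = 0) : ∃ t, ∃ n' : E, (∃ c, ∀ x ∈ J ^ c, x • n' = 0) ∧ f ^ (t + k) • n' = f ^ t • n := by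
  obtain ⟨t, ht⟩ : ∃ t, ∀ a : A, a * f ^ (t + k) = 0 → a * f ^ t = 0 := by
    let ch : ℕ →o Submodule A A := ⟨fun m => LinearMap.ker (LinearMap.mulRight A (f ^ m)), by
      intro m m' h a ha
      obtain ⟨d, rfl⟩ := Nat.exists_eq_add_of_le h
      simp only [LinearMap.mem_ker, LinearMap.mulRight_apply] at ha ⊢
      rw [pow_add, ← mul_assoc, ha, zero_mul]⟩
    obtain ⟨t, ht⟩ := monotone_stabilizes_iff_noetherian.2 (inferInstanceAs (IsNoetherian A A)) ch
    refine ⟨t, fun a ha => ?_⟩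
    have : a ∈ ch (t + k) := by
      show a ∈ LinearMap.ker (LinearMap.mulRight A (f ^ (t + k)))
      simpa using ha
    rw [← ht (t + k) (by lia)] at this
    have h2 : a ∈ LinearMap.ker (LinearMap.mulRight A (f ^ t)) := this
    simpa using h2
  set g := f ^ (t + k) with hg
  obtain ⟨c0, hc⟩ := Ideal.exists_pow_inf_eq_pow_smul J (Ideal.span {g} : Submodule A A)
  obtain ⟨c, hc⟩ : ∃ c, ∀ a : A, a * g ∈ J ^ c → ∃ j ∈ J ^ s, a * g = j * g := by
    refine ⟨s + c0, fun a ha => ?_⟩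
    have h1 : a * g ∈ J ^ (s + c0) • (⊤ : Submodule A A) ⊓ Ideal.span {g} :=
      ⟨by simpa using ha, Ideal.mul_mem_left _ _ (Ideal.mem_span_singleton_self g)⟩
    rw [hc (s + c0) (by lia), Nat.add_sub_cancel] at h1
    have h2 : a * g ∈ J ^ s * Ideal.span {g} := by
      have := Submodule.smul_mono (le_refl (J ^ s)) (show J ^ c0 • (⊤ : Submodule A A) ⊓ Ideal.span {g} ≤ Ideal.span {g} from inf_le_right) h1
      simpa using this
    obtain ⟨j, hj, h⟩ := Ideal.mem_mul_span_singleton.1 h2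
    exact ⟨j, hj, h.symm⟩
  let π : (A × (J ^ c : Ideal A)) →ₗ[A] A := (LinearMap.mulRight A g).coprod (Submodule.subtype _)
  let ψ : (A × (J ^ c : Ideal A)) →ₗ[A] E := (LinearMap.toSpanSingleton A E (f ^ t • n)).coprod 0
  have hle : LinearMap.ker π ≤ LinearMap.ker ψ := by
    rintro ⟨a, b⟩ h
    simp only [π, ψ, LinearMap.mem_ker, LinearMap.coprod_apply, LinearMap.mulRight_apply, Submodule.subtype_apply, LinearMap.toSpanSingleton_apply, LinearMap.zero_apply, add_zero] at h ⊢
    obtain ⟨j, hj, hh⟩ := hc a (by rw [eq_neg_of_add_eq_zero_left h]; exact neg_mem b.2)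
    have h0 := ht (a - j) (by rw [sub_mul, hh, sub_self])
    rw [sub_mul, sub_eq_zero] at h0
    rw [smul_smul, h0, mul_comm, mul_smul, hn j hj, smul_zero]
  obtain ⟨h, hh⟩ := hE _ A ((LinearMap.ker π).liftQ π le_rfl) (LinearMap.ker_eq_bot.1 (Submodule.ker_liftQ_eq_bot _ _ _ le_rfl)) ((LinearMap.ker π).liftQ ψ hle)
  have hh' : ∀ a b, h (a * g + (b : (J ^ c : Ideal A)).1) = a • f ^ t • n := by
    intro a b
    have := hh (Submodule.Quotient.mk (a, b))
    simpa [π, ψ] using this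
  refine ⟨t, h 1, ⟨c, fun x hx => ?_⟩, ?_⟩
  · rw [← map_smul, smul_eq_mul, mul_one]
    simpa using hh' 0 ⟨x, hx⟩
  · rw [← map_smul, smul_eq_mul, mul_one]
    simpa [hg] using hh' 1 0

variable [Algebra R A]

/-- extension of the list ideal -/
def spm (A : Type u) [CommRing A] [Algebra R A] (l : List R) : Ideal A := Ideal.span {x | x ∈ l.map (algebraMap R A)}

lemma gam_iff (l : List R) {E : Type u} [AddCommGroup E] [Module R E] [Module A E] [IsScalarTower R A E] (n : E) :
    (∀ x ∈ l, ∃ k : ℕ, x ^ k • n = 0) ↔ ∃ s, ∀ x ∈ (spm A l) ^ s, x • n = 0 := by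
  constructor
  · intro h
    have h1 : spm A l ≤ Ideal.radical (LinearMap.ker (LinearMap.toSpanSingleton A E n)) := by
      rw [spm, Ideal.span_le]
      intro y hy
      obtain ⟨x, hx, rfl⟩ := List.mem_map.1 hy
      obtain ⟨k, hk⟩ := h x hx
      refine ⟨k, ?_⟩
      rw [LinearMap.mem_ker, LinearMap.toSpanSingleton_apply, ← map_pow, algebraMap_smul, hk]
    obtain ⟨s, hs⟩ := Ideal.exists_pow_le_of_le_radical_of_fg h1 (IsNoetherian.noetherian _)
    exact ⟨s, fun x hx => by simpa using hs hx⟩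
  · rintro ⟨s, hs⟩ x hx
    refine ⟨s, ?_⟩
    rw [← algebraMap_smul A, map_pow]
    exact hs _ (Ideal.pow_mem_pow (I := spm A l) (Ideal.subset_span (List.mem_map_of_mem (f := algebraMap R A) hx)) _)

lemma H.inj_zero (l : List R) {E : Type u} [AddCommGroup E] [Module R E] [Module A E] [IsScalarTower R A E] (hE : Inj A E)
    (i : ℤ) (hi : 0 < i) (z : H l i E) : z = 0 := by
  induction l generalizing i with
  | nil => have := H.nil_subsingleton (R := R) (M := E) i (by lia); exact Subsingleton.elim _ _
  | cons f l ih =>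
    obtain ⟨L, _, _, ι, δ, a, h1, h2, h3, -⟩ := H.exists_loc l (M := E) (i - 1) f i (by lia)
    obtain ⟨y, rfl⟩ := (h3 z).1 (ih i hi _)
    refine (h2 y).2 ?_
    by_cases h : i = 1
    · subst h
      change H l 0 E →ₗ[R] L at ι
      obtain ⟨e, he⟩ := H.zero (R := R) l
      obtain ⟨k, n, hn⟩ := locsurj (f := f) ι y
      obtain ⟨-, hei, her⟩ := he E E LinearMap.id
      obtain ⟨s, hs⟩ := (gam_iff (A := A) l (e E n)).1 ((her _).1 ⟨n, rfl⟩)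
      obtain ⟨t, n', hn', hfn⟩ := baer_step (spm A l) hE (algebraMap R A f) k s (e E n) hs
      obtain ⟨w, rfl⟩ := (her n').2 ((gam_iff (A := A) l n').2 hn')
      refine ⟨w, (locunit (f := f) ι (t + k)).1 ?_⟩
      show f ^ (t + k) • ι w = f ^ (t + k) • y
      rw [pow_add, mul_smul _ _ y, hn, ← map_smul, ← map_smul]
      congr 1
      apply hei
      rw [← map_pow, ← map_pow, algebraMap_smul, algebraMap_smul] at hfn
      rw [map_smul, map_smul, ← pow_add, hfn]
    · refine ⟨0, ?_⟩
      rw [map_zero]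
      exact (loc_sub (f := f) ι (fun a => ⟨0, by rw [ih _ (by lia) a, smul_zero]⟩) y).symm

lemma quot_equiv {X Y P Q : Type u} [AddCommGroup X] [AddCommGroup Y] [AddCommGroup P] [AddCommGroup Q]
    (e : X ≃+ Y) (d : X →+ P) (d' : Y →+ Q) (hd : Function.Surjective d) (hd' : Function.Surjective d')
    (h : ∀ x, d x = 0 ↔ d' (e x) = 0) : ∃ e' : P ≃+ Q, ∀ x, e' (d x) = d' (e x) := by
  have hk : ∀ x y, d x = d y ↔ d' (e x) = d' (e y) := by
    intro x y
    rw [← sub_eq_zero, ← map_sub, h, map_sub, map_sub, sub_eq_zero]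
  choose σ hσ using hd
  choose τ hτ using hd'
  have h1 : ∀ x, d' (e (σ (d x))) = d' (e x) := fun x => (hk _ _).1 (hσ _)
  refine ⟨{ toFun := fun p => d' (e (σ p)), invFun := fun q => d (e.symm (τ q)), left_inv := fun p => ?_, right_inv := fun q => ?_, map_add' := fun p q => ?_ }, h1⟩
  · show d (e.symm (τ (d' (e (σ p))))) = p
    refine Eq.trans ((hk _ _).2 ?_) (hσ p)
    simp [hτ]
  · show d' (e (σ (d (e.symm (τ q))))) = q
    rw [h1]; simp [hτ]
  · have : p + q = d (σ p + σ q) := by rw [map_add, hσ, hσ]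
    rw [this, h1, map_add, map_add]

theorem compare (l : List R) (i : ℕ) (M : Type u) [AddCommGroup M] [Module R M] [Module A M] [IsScalarTower R A M] :
    ∃ e : H l (i : ℤ) M ≃+ (localCohomology (spm A l) i).obj (ModuleCat.of A M), ∀ (r : R) x, e (r • x) = algebraMap R A r • e x := by
  have h0 : ∀ (M : Type u) [AddCommGroup M] [Module R M] [Module A M] [IsScalarTower R A M] (v : H l 0 M →ₗ[R] M), Function.Injective v → 
      (∀ m : M, m ∈ LinearMap.range v ↔ ∀ x ∈ l, ∃ k : ℕ, x ^ k • m = 0) → 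
       ∃ e : H l 0 M ≃+ (localCohomology (spm A l) 0).obj (ModuleCat.of A M), (∀ x, lv (spm A l) M (e x) = v x) ∧ ∀ (r : R) x, e (r • x) = algebraMap R A r • e x := by
    intro M _ _ _ _ v hv hr
    have hx : ∀ x, ∃ y, lv (spm A l) M y = v x := fun x =>
      (lv_range _ _).2 ((gam_iff l _).1 ((hr _).1 ⟨x, rfl⟩))
    have hy : ∀ y, ∃ x, v x = lv (spm A l) M y := fun y =>
      (hr _).2 ((gam_iff l _).2 ((lv_range _ _).1 ⟨y, rfl⟩))
    choose a ha using hx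
    choose b hb using hy
    refine ⟨{ toFun := a, invFun := b, left_inv := fun x => hv (by rw [hb, ha]), right_inv := fun x => lv_inj _ (by rw [ha, hb]), map_add' := fun x y => lv_inj _ ?_ }, ha, fun r x => lv_inj _ ?_⟩
    · rw [ha, map_add, map_add, ha, ha]
    · show lv _ M (a _) = lv _ M (algebraMap R A r • a x)
      rw [ha, map_smul, map_smul, ha, algebraMap_smul]
  obtain ⟨v, hv⟩ := H.zero (R := R) l
  obtain _ | i := i
  · obtain ⟨e, -, he⟩ := h0 M (v M) (hv M M LinearMap.id).2.1 (hv M M LinearMap.id).2.2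
    exact ⟨e, he⟩
  induction i generalizing M with
  | zero =>
    obtain ⟨E, _, _, hE, a, ha⟩ := exists_inj (R := A) M
    let N := E ⧸ LinearMap.range a
    let b : E →ₗ[A] N := Submodule.mkQ _
    have hb : Function.Surjective b := Submodule.mkQ_surjective _
    have hab : Function.Exact a b := LinearMap.exact_map_mkQ_range a
    letI : Module R E := Module.compHom E (algebraMap R A)
    have : IsScalarTower R A E := IsScalarTower.of_algebraMap_smul (fun r x => rfl)
    letI : Module R N := Module.compHom N (algebraMap R A)
    have : IsScalarTower R A N := IsScalarTower.of_algebraMap_smul (fun r x => rfl)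
    let a' : M →ₗ[R] E := a.restrictScalars R
    let b' : E →ₗ[R] N := b.restrictScalars R
    obtain ⟨δ, d1, d2⟩ := H.exists_delta (R := R) l 0 (a := a') (b := b') ha hab hb 1 (by lia)
    obtain ⟨δ', d1', d2'⟩ := lc_delta_zero (spm A l) ha hab hb hE
    obtain ⟨e, he, her⟩ := h0 N (v N) (hv N N LinearMap.id).2.1 (hv N N LinearMap.id).2.2
    have hs : Function.Surjective δ := fun x => (d2 x).1 (H.inj_zero (A := A) l hE _ (by lia) _)
    obtain ⟨e', he'⟩ := quot_equiv e δ.toAddMonoidHom δ'.toAddMonoidHom hs d1' (by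
      intro x
      show δ x = 0 ↔ δ' (e x) = 0
      rw [d2', d1, he]
      constructor
      · rintro ⟨w, rfl⟩
        exact ⟨v E w, (gam_iff l _).1 (((hv E E LinearMap.id).2.2 _).1 ⟨w, rfl⟩), ((hv E N b').1 w).symm⟩
      · rintro ⟨y, hy, hyb⟩
        obtain ⟨w, rfl⟩ := ((hv E E LinearMap.id).2.2 y).2 ((gam_iff l _).2 hy)
        exact ⟨w, (hv N N LinearMap.id).2.1 (((hv E N b').1 w).trans hyb)⟩)
    refine ⟨e', fun r x => ?_⟩
    obtain ⟨x, rfl⟩ := hs x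
    rw [← map_smul]
    refine (he' _).trans ?_
    refine Eq.trans ?_ (congrArg _ (he' _).symm)
    show δ' (e _) = _ • δ' (e _)
    rw [her, map_smul]
  | succ i ih =>
    obtain ⟨E, _, _, hE, a, ha⟩ := exists_inj (R := A) M
    let N := E ⧸ LinearMap.range a
    let b : E →ₗ[A] N := Submodule.mkQ _
    have hb : Function.Surjective b := Submodule.mkQ_surjective _
    have hab : Function.Exact a b := LinearMap.exact_map_mkQ_range a
    letI : Module R E := Module.compHom E (algebraMap R A)
    have : IsScalarTower R A E := IsScalarTower.of_algebraMap_smul (fun r x => rfl)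
    letI : Module R N := Module.compHom N (algebraMap R A)
    have : IsScalarTower R A N := IsScalarTower.of_algebraMap_smul (fun r x => rfl)
    let a' : M →ₗ[R] E := a.restrictScalars R
    let b' : E →ₗ[R] N := b.restrictScalars R
    obtain ⟨δ, d1, d2⟩ := H.exists_delta (R := R) l ((i + 1 : ℕ) : ℤ) (a := a') (b := b') ha hab hb ((i + 1 + 1 : ℕ) : ℤ) (by push_cast; lia)
    obtain ⟨δ', d1', d2'⟩ := lc_delta_pos (spm A l) (i + 1) ha hab hb hE (by lia)
    obtain ⟨e, her⟩ := ih N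
    have hs : Function.Surjective δ := fun x => (d2 x).1 (H.inj_zero (A := A) l hE _ (by lia) _)
    obtain ⟨e', he'⟩ := quot_equiv e δ.toAddMonoidHom δ'.toAddMonoidHom hs d2' (by
      intro x
      show δ x = 0 ↔ δ' (e x) = 0
      rw [d1, map_eq_zero_iff _ d1', map_eq_zero_iff _ e.injective]
      constructor
      · rintro ⟨w, rfl⟩
        rw [H.inj_zero (A := A) l hE _ (by lia) w, map_zero]
      · rintro rfl
        exact ⟨0, map_zero _⟩)
    refine ⟨e', fun r x => ?_⟩
    obtain ⟨x, rfl⟩ := hs x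
    rw [← map_smul]
    refine (he' _).trans ?_
    refine Eq.trans ?_ (congrArg _ (he' _).symm)
    show δ' (e _) = _ • δ' (e _)
    rw [her, map_smul]
end
end LCoh
end

section
open CategoryTheory Opposite
namespace LCoh
section
variable {B : Type u} [CommRing B]

/-- finiteness of an Ext module -/
def FE (B : Type u) [CommRing B] (X L : Type u) [AddCommGroup X] [Module B X] [AddCommGroup L] [Module B L] (i : ℕ) : Prop :=
  Module.Finite B (Abelian.Ext.{u} (ModuleCat.of B X) (ModuleCat.of B L) i)

variable [IsNoetherianRing B] 

lemma fin_mid {P Q S : Type u} [AddCommGroup P] [Module B P] [AddCommGroup Q] [Module B Q] [AddCommGroup S] [Module B S]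
    (f : P →ₗ[B] Q) (g : Q →ₗ[B] S) (h : ∀ q, g q = 0 → ∃ p, f p = q) (hP : Module.Finite B P) (hS : Module.Finite B S) :
    Module.Finite B Q := by
  have hN : IsNoetherian B P := isNoetherian_of_isNoetherianRing_of_finite B P
  have hN : IsNoetherian B S := isNoetherian_of_isNoetherianRing_of_finite B S
  let f' := f.domRestrict (Submodule.comap f (LinearMap.ker g))
  have : LinearMap.range f' = LinearMap.ker g := by
    ext q
    constructor
    · rintro ⟨⟨p, hp⟩, rfl⟩
      exact hp
    · intro hq
      obtain ⟨p, rfl⟩ := h q hq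
      exact ⟨⟨p, hq⟩, rfl⟩
  have := isNoetherian_of_range_eq_ker f' g this
  infer_instance

variable {X Y Z L : Type u} [AddCommGroup X] [Module B X] [AddCommGroup Y] [Module B Y] [AddCommGroup Z] [Module B Z]
  [AddCommGroup L] [Module B L] {a : X →ₗ[B] Y} {b : Y →ₗ[B] Z}

lemma FE.mid (ha : Function.Injective a) (hab : Function.Exact a b) (hb : Function.Surjective b) {i : ℕ}
    (hX : FE B X L i) (hZ : FE B Z L i) : FE B Y L i := by
  obtain ⟨w, hS⟩ := ses ha hab hb
  refine fin_mid (S := Abelian.Ext.{u} (ModuleCat.of B X) (ModuleCat.of B L) i) (P := Abelian.Ext.{u} (ModuleCat.of B Z) (ModuleCat.of B L) i)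
    ((Abelian.Ext.mk₀ (ModuleCat.ofHom b)).precompOfLinear B _ (zero_add _)) ((Abelian.Ext.mk₀ (ModuleCat.ofHom a)).precompOfLinear B _ (zero_add _)) (fun q hq => ?_) hZ hX
  exact Abelian.Ext.contravariant_sequence_exact₂ hS _ q hq

lemma FE.left (ha : Function.Injective a) (hab : Function.Exact a b) (hb : Function.Surjective b) {i : ℕ}
    (hY : FE B Y L i) (hZ : FE B Z L (i + 1)) : FE B X L i := by
  obtain ⟨w, hS⟩ := ses ha hab hb
  refine fin_mid (S := Abelian.Ext.{u} (ModuleCat.of B Z) (ModuleCat.of B L) (i + 1)) (P := Abelian.Ext.{u} (ModuleCat.of B Y) (ModuleCat.of B L) i)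
    ((Abelian.Ext.mk₀ (ModuleCat.ofHom a)).precompOfLinear B _ (zero_add _)) (hS.extClass.precompOfLinear B _ (by lia)) (fun q hq => ?_) hY hZ
  exact Abelian.Ext.contravariant_sequence_exact₁ hS _ q (by lia) hq

lemma FE.right (ha : Function.Injective a) (hab : Function.Exact a b) (hb : Function.Surjective b) {i : ℕ}
    (hX : FE B X L i) (hY : FE B Y L (i + 1)) : FE B Z L (i + 1) := by
  obtain ⟨w, hS⟩ := ses ha hab hb
  refine fin_mid (S := Abelian.Ext.{u} (ModuleCat.of B Y) (ModuleCat.of B L) (i + 1)) (P := Abelian.Ext.{u} (ModuleCat.of B X) (ModuleCat.of B L) i)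
    (hS.extClass.precompOfLinear B _ (by lia)) ((Abelian.Ext.mk₀ (ModuleCat.ofHom b)).precompOfLinear B _ (zero_add _))  (fun q hq => ?_) hX hY
  exact Abelian.Ext.contravariant_sequence_exact₃ hS _ q hq (by lia)

lemma FE.right0 (hb : Function.Surjective b)
    (hY : FE B Y L 0) : FE B Z L 0 := by
  refine fin_mid (S := Abelian.Ext.{u} (ModuleCat.of B Y) (ModuleCat.of B L) 0) (P := PUnit.{u+1})
    0 ((Abelian.Ext.mk₀ (ModuleCat.ofHom b)).precompOfLinear B _ (zero_add _))  (fun q hq => ⟨0, ?_⟩) inferInstance hY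
  have : Epi (ModuleCat.ofHom b) := (ModuleCat.epi_iff_surjective _).2 hb
  have := Abelian.Ext.precomp_mk₀_injective_of_epi (ModuleCat.of B L) (ModuleCat.ofHom b)
  rw [map_zero]
  exact ((injective_iff_map_eq_zero _).1 this q hq).symm

lemma FE.proj [Module.Projective B X] (i : ℕ) : FE B X L (i + 1) := by
  have : Projective (ModuleCat.of B X) := inferInstance
  have := Abelian.Ext.subsingleton_of_projective (ModuleCat.of B X) (ModuleCat.of B L) i
  unfold FE
  infer_instance

lemma FE.of_sub [Subsingleton X] (i : ℕ) : FE B X L i := by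
  have : Subsingleton (Abelian.Ext.{u} (ModuleCat.of B X) (ModuleCat.of B L) i) := by
    refine subsingleton_of_forall_eq 0 fun a => ?_
    have h0 : 𝟙 (ModuleCat.of B X) = 0 := by
      ext x; exact Subsingleton.elim (α := X) _ _
    rw [← Abelian.Ext.mk₀_id_comp a, h0, Abelian.Ext.mk₀_zero, Abelian.Ext.zero_comp]
  unfold FE
  infer_instance

lemma FE.pow {i : ℕ} (h : FE B X L i) (n : ℕ) : FE B (Fin n → X) L i := by
  induction n with
  | zero => exact FE.of_sub i
  | succ n ih =>
    refine FE.mid (a := LinearMap.single B (fun _ : Fin (n + 1) => X) 0) (b := LinearMap.funLeft B X (Fin.succ (n := n))) ?_ ?_ ?_ h ih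
    · intro x y hxy; simpa using congrFun hxy 0
    · intro v
      constructor
      · intro hv
        refine ⟨v 0, funext fun k => ?_⟩
        refine Fin.cases ?_ (fun k => ?_) k
        · simp
        · have := congrFun hv k
          simpa [LinearMap.funLeft_apply] using this.symm
      · rintro ⟨x, rfl⟩
        ext k
        simp [LinearMap.funLeft_apply]
    · exact LinearMap.funLeft_surjective_of_injective _ _ _ (Fin.succ_injective n)
end

section
variable {R A : Type u} [CommRing R] [CommRing A] [IsNoetherianRing A] [IsNoetherianRing R] [Algebra R A]
open TensorProduct

lemma fin_semi {X Y Z : Type u} [AddCommGroup X] [Module R X] [Module A X] [IsScalarTower R A X] [AddCommGroup Y] [Module A Y]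
    [AddCommGroup Z] [Module R Z] (f : X →ₗ[A] Y) (hf : Function.Surjective f) (g : X →ₗ[R] Z) (h : ∀ x, g x = 0 → f x = 0)
    (hZ : Module.Finite R Z) : Module.Finite A Y := by
  letI : Module R Y := Module.compHom Y (algebraMap R A)
  have : IsScalarTower R A Y := IsScalarTower.of_algebraMap_smul (fun r x => rfl)
  have hN : IsNoetherian R Z := isNoetherian_of_isNoetherianRing_of_finite R Z
  have : Module.Finite R (X ⧸ LinearMap.ker g) := Module.Finite.equiv g.quotKerEquivRange.symm
  have : Module.Finite R Y := Module.Finite.of_surjective ((LinearMap.ker g).liftQ (f.restrictScalars R) (fun x hx => h x hx)) (by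
    intro y
    obtain ⟨x, rfl⟩ := hf y
    exact ⟨Submodule.Quotient.mk x, rfl⟩)
  exact Module.Finite.of_restrictScalars_finite R A Y

variable {L : Type u} [AddCommGroup L] [Module R L] [Module A L] [IsScalarTower R A L]
  {N : Type u} [AddCommGroup N] [Module R N]

/-- Hom as Ext -/
noncomputable def h0 (B : Type u) [CommRing B] (X L : Type u) [AddCommGroup X] [Module B X] [AddCommGroup L] [Module B L] :
    (X →ₗ[B] L) ≃ₗ[B] Abelian.Ext.{u} (ModuleCat.of B X) (ModuleCat.of B L) 0 where
  toFun f := Abelian.Ext.mk₀ (ModuleCat.ofHom f)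
  invFun c := (Abelian.Ext.addEquiv₀ c).hom
  map_add' f g := by rw [← Abelian.Ext.mk₀_add]; rfl
  map_smul' r f := by rw [RingHom.id_apply, ← Abelian.Ext.mk₀_smul]; rfl
  left_inv f := by
    show (Abelian.Ext.addEquiv₀ (Abelian.Ext.addEquiv₀.symm (ModuleCat.ofHom f))).hom = _
    rw [AddEquiv.apply_symm_apply]
    rfl
  right_inv c := by
    show Abelian.Ext.mk₀ (Abelian.Ext.addEquiv₀ c) = _
    rw [Abelian.Ext.mk₀_addEquiv₀_apply]

lemma FE.base0 (h : FE R N L 0) : FE A (A ⊗[R] N) L 0 := by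
  refine fin_semi (R := R) (A := A) (X := N →ₗ[R] L) (Z := Abelian.Ext.{u} (ModuleCat.of R N) (ModuleCat.of R L) 0)
    ((LinearMap.liftBaseChangeEquiv A).trans (h0 A _ L)).toLinearMap (LinearEquiv.surjective _) (h0 R N L).toLinearMap ?_ h
  intro x hx
  rw [(map_eq_zero_iff _ (LinearEquiv.injective (h0 R N L))).1 hx, map_zero]

/-- Homothety by elements of `I` factors through a free module. -/
def SF (I : Ideal R) (N : Type u) [AddCommGroup N] [Module R N] : Prop :=
  ∀ x ∈ I, ∃ (k : ℕ) (α : N →ₗ[R] (Fin k → R)) (β : (Fin k → R) →ₗ[R] N), ∀ n, β (α n) = x • n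

lemma SF.quot (I : Ideal R) : SF I (R ⧸ I) := by
  intro x hx
  refine ⟨0, 0, 0, fun n => ?_⟩
  obtain ⟨n, rfl⟩ := Ideal.Quotient.mk_surjective n
  have : x • Ideal.Quotient.mk I n = Ideal.Quotient.mk I (x * n) := rfl
  rw [this, Ideal.Quotient.eq_zero_iff_mem.2 (I.mul_mem_right _ hx)]
  simp

lemma SF.syz {I : Ideal R} (h : SF I N) {k : ℕ} (π : (Fin k → R) →ₗ[R] N) (hπ : Function.Surjective π) (x : R) (hx : x ∈ I) :
    ∃ γ : (Fin k → R) →ₗ[R] LinearMap.ker π, ∀ n : LinearMap.ker π, γ n.1 = x • n := by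
  obtain ⟨m, α, β, h⟩ := h x hx
  obtain ⟨β', hβ⟩ := Module.projective_lifting_property π β hπ
  refine ⟨LinearMap.codRestrict _ (x • LinearMap.id - β' ∘ₗ α ∘ₗ π) (fun v => ?_), fun n => ?_⟩
  · have := congrArg (fun f => f (α (π v))) hβ
    simp only [LinearMap.comp_apply] at this
    simp [this, h]
  · ext1
    simp [LinearMap.mem_ker.1 n.2]

lemma SF.ker {I : Ideal R} (h : SF I N) {k : ℕ} (π : (Fin k → R) →ₗ[R] N) (hπ : Function.Surjective π) : SF I (LinearMap.ker π) := by
  intro x hx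
  obtain ⟨γ, hγ⟩ := h.syz π hπ x hx
  exact ⟨k, (LinearMap.ker π).subtype, γ, hγ⟩
end
end LCoh
end

section
open CategoryTheory Opposite
namespace LCoh
section
variable {R A : Type u} [CommRing R] [CommRing A] [IsNoetherianRing A] [IsNoetherianRing R] [Algebra R A]
open TensorProduct
variable {L : Type u} [AddCommGroup L] [Module R L] [Module A L] [IsScalarTower R A L]
  {N : Type u} [AddCommGroup N] [Module R N]

lemma ext1 {B : Type u} [CommRing B] {X Y Z L : Type u} [AddCommGroup X] [Module B X] [AddCommGroup Y] [Module B Y] [AddCommGroup Z] [Module B Z]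
  [AddCommGroup L] [Module B L] {a : X →ₗ[B] Y} {b : Y →ₗ[B] Z} (ha : Function.Injective a) (hab : Function.Exact a b) (hb : Function.Surjective b) :
    ∃ Δ : (X →ₗ[B] L) →ₗ[B] Abelian.Ext.{u} (ModuleCat.of B Z) (ModuleCat.of B L) 1,
     (Module.Projective B Y → Function.Surjective Δ) ∧ ∀ φ, Δ φ = 0 ↔ ∃ θ : Y →ₗ[B] L, φ = θ ∘ₗ a := by
  obtain ⟨w, hS⟩ := ses ha hab hb
  refine ⟨hS.extClass.precompOfLinear B (ModuleCat.of B L) (add_zero 1) ∘ₗ (h0 B X L).toLinearMap, fun hp => ?_, fun φ => ⟨fun hφ => ?_, ?_⟩⟩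
  · intro c
    have : Projective (ModuleCat.of B Y) := inferInstance
    obtain ⟨d, hd⟩ := Abelian.Ext.contravariant_sequence_exact₃ hS _ c (Abelian.Ext.eq_zero_of_projective _) (add_zero 1)
    obtain ⟨d, rfl⟩ := (h0 B X L).surjective d
    exact ⟨d, hd⟩
  · obtain ⟨d, hd⟩ := Abelian.Ext.contravariant_sequence_exact₁ hS _ (h0 B _ L φ) (add_zero 1) hφ
    obtain ⟨θ, rfl⟩ := (h0 B Y L).surjective d
    refine ⟨θ, (h0 B _ L).injective ?_⟩
    rw [← hd]
    exact (Abelian.Ext.mk₀_comp_mk₀ _ _)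
  · rintro ⟨θ, rfl⟩
    show hS.extClass.comp (Abelian.Ext.mk₀ (ModuleCat.ofHom (θ ∘ₗ a))) (add_zero 1) = 0
    rw [ModuleCat.ofHom_comp, ← Abelian.Ext.mk₀_comp_mk₀]
    exact hS.extClass_comp_assoc _

lemma range_exact {k : ℕ} (π : (Fin k → R) →ₗ[R] N) (hπ : Function.Surjective π) :
    Function.Exact (LinearMap.range ((LinearMap.ker π).subtype.baseChange A)).subtype (π.baseChange A) := by
  have h := lTensor_exact A (LinearMap.exact_subtype_ker_map π) hπ
  intro y
  rw [LinearMap.baseChange_eq_ltensor, h y]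
  constructor
  · rintro ⟨x, rfl⟩
    exact ⟨⟨_, ⟨x, rfl⟩⟩, rfl⟩
  · rintro ⟨⟨_, ⟨x, rfl⟩⟩, rfl⟩
    exact ⟨x, rfl⟩

lemma FE.base1 {k : ℕ} (π : (Fin k → R) →ₗ[R] N) (hπ : Function.Surjective π) (h : FE R N L 1) : FE A (A ⊗[R] N) L 1 := by
  let ι := (LinearMap.ker π).subtype
  let B := LinearMap.range (ι.baseChange A)
  obtain ⟨Δ, h1, h2⟩ := ext1 (B := A) (X := B) (L := L) (a := B.subtype) (b := π.baseChange A) (Submodule.injective_subtype _) (range_exact (A := A) π hπ) (LinearMap.baseChange_surjective A hπ)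
  obtain ⟨Δ', h1', h2'⟩ := ext1 (B := R) (L := L) (a := ι) (b := π) (Submodule.injective_subtype _) (LinearMap.exact_subtype_ker_map π) hπ
  let p : A ⊗[R] (LinearMap.ker π) →ₗ[A] B := (ι.baseChange A).rangeRestrict
  let q : LinearMap.ker π →ₗ[R] B := (p.restrictScalars R) ∘ₗ (TensorProduct.mk R A (LinearMap.ker π) 1)
  let pull : (B →ₗ[A] L) →ₗ[R] (LinearMap.ker π →ₗ[R] L) :=
    { toFun := fun φ => φ.restrictScalars R ∘ₗ q, map_add' := fun _ _ => rfl, map_smul' := fun r φ => rfl }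
  refine fin_semi (R := R) (A := A) (X := B →ₗ[A] L) (Z := Abelian.Ext.{u} (ModuleCat.of R N) (ModuleCat.of R L) 1)
    Δ (h1 inferInstance) (Δ' ∘ₗ pull) ?_ h
  intro φ hφ
  obtain ⟨θ, hθ⟩ := (h2' _).1 hφ
  refine (h2 φ).2 ⟨θ.liftBaseChange A, ?_⟩
  have : φ ∘ₗ p = (θ.liftBaseChange A ∘ₗ B.subtype) ∘ₗ p := by
    apply (LinearMap.liftBaseChangeEquiv A).symm.injective
    ext x
    have := congrArg (fun f => f x) hθ
    simp only [LinearMap.liftBaseChangeEquiv_symm_apply]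
    show φ (q x) = θ.liftBaseChange A ((ι.baseChange A) (1 ⊗ₜ x))
    rw [LinearMap.baseChange_tmul, LinearMap.liftBaseChange_tmul, one_smul]
    exact this
  ext y
  obtain ⟨y, rfl⟩ := LinearMap.surjective_rangeRestrict _ y
  exact congrArg (fun f => f y) this

lemma FE.rng {B : Type u} [CommRing B] [IsNoetherianRing B] {X Y L : Type u} [AddCommGroup X] [Module B X] [AddCommGroup Y] [Module B Y]
  [AddCommGroup L] [Module B L] (f : X →ₗ[B] Y) (i : ℕ) (h1 : FE B (LinearMap.ker f) L i) (h2 : FE B X L (i + 1)) :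
    FE B (LinearMap.range f) L (i + 1) := by
  refine FE.right (X := LinearMap.ker f) (Y := X) (Z := LinearMap.range f) (a := (LinearMap.ker f).subtype) (b := f.rangeRestrict) (Submodule.injective_subtype _) ?_ (LinearMap.surjective_rangeRestrict f) h1 h2
  intro y
  constructor
  · intro h
    exact ⟨⟨y, congrArg Subtype.val h⟩, rfl⟩
  · rintro ⟨⟨y, h⟩, rfl⟩
    exact Subtype.ext h

lemma FE.baseC (I : Ideal R) (i : ℕ)
    (K : ∀ j, j < i → ∀ (M : Type u) [AddCommGroup M] [Module A M], Module.Finite A M → (∀ x ∈ I, ∀ m : M, algebraMap R A x • m = 0) → FE A M L j)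
    (hN : Module.Finite R N) (hS : SF I N) (hE : ∀ j, FE R N L (j + 1)) : FE A (A ⊗[R] N) L (i + 1) := by
  induction i generalizing N with
  | zero =>
    obtain ⟨k, π, hπ⟩ := Module.Finite.exists_fin' R N
    exact FE.base1 π hπ (hE 0)
  | succ i ih =>
    obtain ⟨k, π, hπ⟩ := Module.Finite.exists_fin' R N
    let ι := (LinearMap.ker π).subtype
    let B := LinearMap.range (ι.baseChange A)
    refine FE.right (X := B) (a := B.subtype) (b := π.baseChange A) (Submodule.injective_subtype _) (range_exact (A := A) π hπ) (LinearMap.baseChange_surjective A hπ) ?_ (FE.proj _)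
    have hf : Module.Finite R (LinearMap.ker π) := inferInstance
    refine FE.rng (ι.baseChange A) i ?_ ?_
    · refine K i (by lia) _ inferInstance ?_
      rintro x hx ⟨m, hm⟩
      obtain ⟨γ, hγ⟩ := hS.syz π hπ x hx
      have h1 : ∀ m, (γ.baseChange A) ((ι.baseChange A) m) = algebraMap R A x • m := by
        intro m
        rw [← LinearMap.comp_apply, ← LinearMap.baseChange_comp]
        have : γ ∘ₗ ι = x • LinearMap.id := LinearMap.ext hγ
        rw [this, LinearMap.baseChange_smul, LinearMap.baseChange_id, algebraMap_smul]
        rfl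
      ext1
      show algebraMap R A x • m = 0
      rw [← h1, show ι.baseChange A m = 0 from hm, map_zero]
    · refine ih (fun j hj => K j (by lia)) hf (hS.ker π hπ) (fun j => ?_)
      exact FE.left (a := ι) (b := π) (Submodule.injective_subtype _) (LinearMap.exact_subtype_ker_map π) hπ (FE.proj _) (hE _)

theorem FE.base (I : Ideal R) (hE : ∀ j, FE R (R ⧸ I) L j) (i : ℕ) (M : Type u) [AddCommGroup M] [Module A M]
    (hM : Module.Finite A M) (hI : ∀ x ∈ I, ∀ m : M, algebraMap R A x • m = 0) : FE A M L i := by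
  induction i using Nat.strong_induction_on generalizing M with
  | _ i ih =>
    have h1 : FE A (A ⊗[R] (R ⧸ I)) L i := by
      obtain _ | i := i
      · exact FE.base0 (hE 0)
      · exact FE.baseC I i (fun j hj M _ _ hM hI => ih j (by lia) M hM hI) inferInstance (SF.quot I) (fun j => hE _)
    obtain ⟨n, s, hs⟩ := Module.Finite.exists_fin (R := A) (M := M)
    letI : Module R M := Module.compHom M (algebraMap R A)
    have : IsScalarTower R A M := IsScalarTower.of_algebraMap_smul (fun r x => rfl)
    let t : Fin n → (R ⧸ I) →ₗ[R] M := fun k => Submodule.liftQ I (LinearMap.toSpanSingleton R M (s k)) (fun x hx => hI x hx _)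
    let b : (Fin n → A ⊗[R] (R ⧸ I)) →ₗ[A] M := LinearMap.lsum A _ A (fun k => (t k).liftBaseChange A)
    have hb : Function.Surjective b := by
      rw [← LinearMap.range_eq_top, eq_top_iff, ← hs, Submodule.span_le]
      rintro _ ⟨k, rfl⟩
      refine ⟨Pi.single k (1 ⊗ₜ Ideal.Quotient.mk I 1), ?_⟩
      rw [LinearMap.lsum_piSingle, LinearMap.liftBaseChange_tmul, one_smul]
      show (1 : R) • s k = s k
      rw [one_smul]
    have h2 := h1.pow n
    obtain _ | i := i
    · exact FE.right0 hb h2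
    · refine FE.right (X := LinearMap.ker b) (a := (LinearMap.ker b).subtype) (b := b) (Submodule.injective_subtype _) (LinearMap.exact_subtype_ker_map b) hb (ih i (by lia) _ inferInstance ?_) h2
      rintro x hx ⟨v, hv⟩
      ext1
      funext k
      show algebraMap R A x • v k = 0
      generalize v k = y
      induction y with
      | zero => rw [smul_zero]
      | add a b ha hb => rw [smul_add, ha, hb, add_zero]
      | tmul a c =>
        obtain ⟨c, rfl⟩ := Ideal.Quotient.mk_surjective c
        rw [algebraMap_smul, ← TensorProduct.tmul_smul]
        have : x • Ideal.Quotient.mk I c = Ideal.Quotient.mk I (x * c) := rfl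
        rw [this, Ideal.Quotient.eq_zero_iff_mem.2 (I.mul_mem_right _ hx), TensorProduct.tmul_zero]
end
end LCoh
end

section
open CategoryTheory Opposite
namespace LCoh
section
variable {R A : Type u} [CommRing R] [CommRing A] [IsNoetherianRing A] [IsNoetherianRing R] [Algebra R A]

lemma spm_self (l : List R) : spm R l = sp l := by
  simp [spm, sp]

lemma comp_self (l : List R) (i : ℕ) (M : Type u) [AddCommGroup M] [Module R M] :
    Nonempty (H l (i : ℤ) M ≃ₗ[R] (localCohomology (sp l) i).obj (ModuleCat.of R M)) := by
  have := compare (A := R) l i M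
  rw [spm_self] at this
  obtain ⟨e, he⟩ := this
  exact ⟨{ e with map_smul' := he }⟩

lemma supp_of_tor {J : Ideal R} {L : Type u} [AddCommGroup L] [Module R L] (h : Tor J L) :
    Module.support R L ⊆ PrimeSpectrum.zeroLocus (J : Set R) := by
  intro p hp x hx
  obtain ⟨m, hm⟩ := Module.mem_support_iff_exists_annihilator.1 hp
  obtain ⟨k, hk⟩ := h x hx m
  exact p.2.mem_of_pow_mem k (hm ((Submodule.mem_annihilator_span_singleton _ _).2 hk))

lemma lc_sub_iff (l : List R) (i : ℕ) (M : Type u) [AddCommGroup M] [Module R M] :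
    Nontrivial ((localCohomology (sp l) i).obj (ModuleCat.of R M)) ↔ ∃ z : H l (i : ℤ) M, z ≠ 0 := by
  obtain ⟨e⟩ := comp_self l i M
  rw [← e.toEquiv.nontrivial_congr]
  exact nontrivial_iff_exists_ne 0

lemma HH (l : List R) (i : ℕ) (M : Type u) [AddCommGroup M] [Module R M] [Module A M] [IsScalarTower R A M] :
    Nonempty (H l (i : ℤ) M ≃+ H (l.map (algebraMap R A)) (i : ℤ) M) := by
  obtain ⟨e, he⟩ := compare (A := A) l i M
  obtain ⟨e'⟩ := comp_self (l.map (algebraMap R A)) i M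
  exact ⟨e.trans e'.symm.toAddEquiv⟩

lemma cfin_of_mem (l : List R) (h : MemCofiniteClass R (sp l)) : CFin l := by
  intro M _ _ _ i
  obtain ⟨n, rfl⟩ | hi := (le_or_gt 0 i).imp_left Int.eq_ofNat_of_zero_le
  · obtain ⟨e⟩ := comp_self l n M
    have h0' := (h (ModuleCat.of R M) inferInstance n).2 0
    generalize (localCohomology (sp l) n).obj (ModuleCat.of R M) = L at e h0'
    have h1 : Module.Finite R (Abelian.Ext.{u} (ModuleCat.of R (R ⧸ sp l)) (ModuleCat.of R L) 0) :=
      Module.Finite.equiv (br (ModuleCat.of R (R ⧸ sp l)) L 0)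
    have h2 : Module.Finite R ((R ⧸ sp l) →ₗ[R] L) := Module.Finite.equiv (h0 R (R ⧸ sp l) L).symm
    let f : ((R ⧸ sp l) →ₗ[R] L) →ₗ[R] ann0 (sp l) (H l n M) :=
      LinearMap.codRestrict _ (e.symm.toLinearMap ∘ₗ LinearMap.applyₗ (Ideal.Quotient.mk (sp l) 1)) (by
        intro φ
        rw [mem_ann0]
        intro x hx
        show x • e.symm (φ _) = 0
        rw [← map_smul, ← map_smul]
        have : x • Ideal.Quotient.mk (sp l) 1 = Ideal.Quotient.mk (sp l) (x * 1) := rfl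
        rw [this, Ideal.Quotient.eq_zero_iff_mem.2 (Ideal.mul_mem_right _ _ hx), map_zero, map_zero])
    refine Module.Finite.of_surjective f ?_
    rintro ⟨a, ha⟩
    rw [mem_ann0] at ha
    refine ⟨Submodule.liftQ (sp l) (LinearMap.toSpanSingleton R L (e a)) (fun x hx => ?_), ?_⟩
    · show x • e a = 0
      rw [← map_smul, ha x hx, map_zero]
    · ext1
      show e.symm ((1 : R) • e a) = a
      rw [one_smul, e.symm_apply_apply]
  · have : Subsingleton (ann0 (sp l) (H l i M)) := ⟨fun a b => Subtype.ext ((H.neg l i hi _).trans (H.neg l i hi _).symm)⟩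
    infer_instance

lemma mem_quot (l : List R) (h : MemCofiniteClass R (sp l)) (hs : Function.Surjective (algebraMap R A)) :
    MemCofiniteClass A (sp (l.map (algebraMap R A))) := by
  intro M hM i
  letI : Module R M := Module.compHom M (algebraMap R A)
  have : IsScalarTower R A M := IsScalarTower.of_algebraMap_smul (fun r x => rfl)
  have hRA : Module.Finite R A := Module.Finite.of_surjective (Algebra.linearMap R A) hs
  have hRM : Module.Finite R M := Module.Finite.trans A M
  have hc := (h (ModuleCat.of R M) hRM i).2
  obtain ⟨e1⟩ := comp_self l i M
  obtain ⟨e2, he2⟩ : ∃ e2 : H l (i : ℤ) M ≃+ (localCohomology (sp (l.map (algebraMap R A))) i).obj M,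
    ∀ (r : R) x, e2 (r • x) = algebraMap R A r • e2 x := compare (A := A) l i M
  obtain ⟨e3⟩ : Nonempty (H (l.map (algebraMap R A)) (i : ℤ) M ≃ₗ[A] (localCohomology (sp (l.map (algebraMap R A))) i).obj M) :=
    comp_self (l.map (algebraMap R A)) i M
  have hT : Tor (sp (l.map (algebraMap R A))) ((localCohomology (sp (l.map (algebraMap R A))) i).obj M) :=
    (H.torI _ _ _).of_surj e3.toLinearMap e3.surjective
  refine ⟨supp_of_tor hT, fun j => ?_⟩
  generalize (localCohomology (sp (l.map (algebraMap R A))) i).obj M = L at *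
  letI : Module R L := Module.compHom L (algebraMap R A)
  have : IsScalarTower R A L := IsScalarTower.of_algebraMap_smul (fun r x => rfl)
  let e4 : H l (i : ℤ) M ≃ₗ[R] L := { e2 with map_smul' := fun r x => he2 r x }
  let e5 := (e1.symm.trans e4).toModuleIso
  have hE : ∀ j, FE R (R ⧸ sp l) L j := by
    intro j
    have := hc j
    have h1 : Module.Finite R (((Ext R (ModuleCat.{u} R) j).obj (op (ModuleCat.of R (R ⧸ sp l)))).obj (ModuleCat.of R L)) :=
      Module.Finite.equiv ((((Ext R (ModuleCat.{u} R) j).obj (op (ModuleCat.of R (R ⧸ sp l)))).mapIso e5).toLinearEquiv)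
    exact Module.Finite.equiv (br (ModuleCat.of R (R ⧸ sp l)) (ModuleCat.of R L) j)
  have hF : FE A (A ⧸ sp (l.map (algebraMap R A))) L j := by
    refine FE.base (sp l) hE j _ inferInstance ?_
    intro x hx m
    obtain ⟨c, rfl⟩ := Ideal.Quotient.mk_surjective m
    have h1 : algebraMap R A x • Ideal.Quotient.mk (sp (l.map (algebraMap R A))) c = Ideal.Quotient.mk _ (algebraMap R A x * c) := rfl
    rw [h1, Ideal.Quotient.eq_zero_iff_mem]
    refine Ideal.mul_mem_right _ _ ?_
    have : sp l ≤ (sp (l.map (algebraMap R A))).comap (algebraMap R A) := by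
      rw [Ideal.span_le]
      intro y hy
      exact mem_sp (List.mem_map_of_mem hy)
    exact this hx
  have hF' : Module.Finite A (Abelian.Ext.{u} (ModuleCat.of A (A ⧸ sp (l.map (algebraMap R A)))) L j) := hF
  exact Module.Finite.equiv (br _ L j).symm
end
end LCoh
end

section
open CategoryTheory Opposite
namespace LCoh
open IsLocalRing
section
variable {R A : Type u} [CommRing R] [CommRing A] [IsNoetherianRing A] [IsNoetherianRing R] [Algebra R A] [IsLocalRing R] [IsLocalRing A]

lemma comap_m (hs : Function.Surjective (algebraMap R A)) : (maximalIdeal A).comap (algebraMap R A) = maximalIdeal R := by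
  have : ((maximalIdeal A).comap (algebraMap R A)).IsMaximal := Ideal.comap_isMaximal_of_surjective _ hs
  exact IsLocalRing.eq_maximalIdeal this

lemma map_m (hs : Function.Surjective (algebraMap R A)) : (maximalIdeal R).map (algebraMap R A) = maximalIdeal A := by
  rw [← comap_m hs, Ideal.map_comap_of_surjective _ hs]

lemma complete_quot (hs : Function.Surjective (algebraMap R A)) [IsAdicComplete (maximalIdeal R) R] :
    IsAdicComplete (maximalIdeal A) A := by
  have hH : IsHausdorff (maximalIdeal A) A := by
    refine ⟨fun x hx => ?_⟩
    have h1 : x ∈ (⨅ i : ℕ, maximalIdeal A ^ i : Ideal A) := by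
      rw [Ideal.mem_iInf]
      intro n
      have := hx n
      rwa [SModEq.zero, smul_eq_mul, Ideal.mul_top] at this
    rw [Ideal.iInf_pow_eq_bot_of_isLocalRing _ (Ideal.IsPrime.ne_top inferInstance)] at h1
    exact h1
  have hP : IsPrecomplete (maximalIdeal A) A := by
    refine ⟨fun f hf => ?_⟩
    have hf1 : ∀ n, ∃ d ∈ maximalIdeal R ^ n, algebraMap R A d = f (n + 1) - f n := by
      intro n
      have h1 := (hf (Nat.le_succ n)).symm
      rw [SModEq.sub_mem, smul_eq_mul, Ideal.mul_top, ← map_m hs, ← Ideal.map_pow,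
        Ideal.mem_map_iff_of_surjective _ hs] at h1
      exact h1
    choose d hd hd' using hf1
    obtain ⟨g0, hg0⟩ := hs (f 0)
    let g : ℕ → R := fun n => g0 + ∑ k ∈ Finset.range n, d k
    have hg : ∀ n, algebraMap R A (g n) = f n := by
      intro n
      simp only [g, map_add, map_sum, hg0, hd']
      rw [Finset.sum_range_sub]
      abel
    have hc : ∀ {m n}, m ≤ n → g m ≡ g n [SMOD (maximalIdeal R ^ m • ⊤ : Submodule R R)] := by
      intro m n hmn
      refine SModEq.symm ?_
      rw [SModEq.sub_mem, smul_eq_mul, Ideal.mul_top]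
      have : g n - g m = ∑ k ∈ Finset.Ico m n, d k := by
        rw [Finset.sum_Ico_eq_sub _ hmn]
        simp only [g]
        abel
      rw [this]
      refine Ideal.sum_mem _ fun k hk => ?_
      exact Ideal.pow_le_pow_right (Finset.mem_Ico.1 hk).1 (hd k)
    obtain ⟨L, hL⟩ := IsPrecomplete.prec (inferInstance : IsPrecomplete (maximalIdeal R) R) hc
    refine ⟨algebraMap R A L, fun n => ?_⟩
    have h1 := hL n
    rw [SModEq.sub_mem, smul_eq_mul, Ideal.mul_top] at h1 ⊢
    rw [← hg, ← map_sub, ← map_m hs, ← Ideal.map_pow]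
    exact Ideal.mem_map_of_mem _ h1
  exact { hH, hP with }

lemma dlt_tr (hs : Function.Surjective (algebraMap R A)) (J : Ideal A) (n : ℕ) :
    Dlt J (maximalIdeal A) n ↔ Dlt (J.comap (algebraMap R A)) (maximalIdeal R) n := by
  rw [dlt_iff_dim, dlt_iff_dim]
  let f : R →+* A ⧸ J := (Ideal.Quotient.mk J).comp (algebraMap R A)
  have hf : Function.Surjective f := Ideal.Quotient.mk_surjective.comp hs
  have hk : RingHom.ker f = J.comap (algebraMap R A) := by
    rw [RingHom.ker_eq_comap_bot, ← Ideal.comap_comap, ← RingHom.ker_eq_comap_bot, Ideal.mk_ker]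
  rw [← hk, ringKrullDim_eq_of_ringEquiv (RingHom.quotientKerEquivOfSurjective hf)]

lemma sp_map (l : List R) : sp (l.map (algebraMap R A)) = (sp l).map (algebraMap R A) := by
  rw [Ideal.map_span]
  have : {x | x ∈ l.map (algebraMap R A)} = algebraMap R A '' {x | x ∈ l} := by
    ext x
    simp [List.mem_map]
  rw [sp, this]

lemma comap_sup (hs : Function.Surjective (algebraMap R A)) (l : List R) (J : Ideal A) :
    (sp (l.map (algebraMap R A)) ⊔ J).comap (algebraMap R A) = sp l ⊔ J.comap (algebraMap R A) := by
  have h1 : sp (l.map (algebraMap R A)) ⊔ J = (sp l ⊔ J.comap (algebraMap R A)).map (algebraMap R A) := by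
    rw [Ideal.map_sup, Ideal.map_comap_of_surjective _ hs, sp_map]
  rw [h1, Ideal.comap_map_of_surjective _ hs, sup_assoc, sup_eq_left.2 (show (⊥ : Ideal A).comap (algebraMap R A) ≤ J.comap (algebraMap R A) from Ideal.comap_mono bot_le)]

lemma van_down (hs : Function.Surjective (algebraMap R A)) (l : List R) (J : Ideal A) (t : ℤ) (ht : 0 ≤ t)
    (h : Van l (J.comap (algebraMap R A)) t) : Van (l.map (algebraMap R A)) J t := by
  intro M _ _ hM hJ i hi z
  letI : Module R M := Module.compHom M (algebraMap R A)
  have : IsScalarTower R A M := IsScalarTower.of_algebraMap_smul (fun r x => rfl)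
  have hRA : Module.Finite R A := Module.Finite.of_surjective (Algebra.linearMap R A) hs
  have hRM : Module.Finite R M := Module.Finite.trans A M
  obtain ⟨n, rfl⟩ := Int.eq_ofNat_of_zero_le (ht.trans hi.le)
  obtain ⟨e⟩ := HH (A := A) l n M
  rw [← e.symm.map_eq_zero_iff]
  refine h M ?_ _ hi _
  intro x hx
  rw [Module.mem_annihilator]
  intro m
  exact Module.mem_annihilator.1 (hJ hx) m

lemma van_up (Q : Ideal R) (l : List R) (t : ℤ) (ht : 0 ≤ t)
    (h : Van (l.map (algebraMap R (R ⧸ Q))) ⊥ t) : Van l Q t := by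
  refine Van.of fun i hi z => ?_
  obtain ⟨n, rfl⟩ := Int.eq_ofNat_of_zero_le (ht.trans hi.le)
  obtain ⟨e⟩ := HH (A := R ⧸ Q) l n (R ⧸ Q)
  rw [← e.map_eq_zero_iff]
  exact h (R ⧸ Q) bot_le _ hi _
end
section
variable {R : Type u} [CommRing R]

lemma ch_height [IsDomain R] (n : ℕ) (P : PrimeSpectrum R) : Ch n ⊥ P.asIdeal ↔ (n : ℕ∞) ≤ Order.height P := by
  constructor
  · intro h
    obtain ⟨s, h1, h2, h3⟩ := (ch_iff_series (Q := ⟨⊥, Ideal.isPrime_bot⟩)).1 h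
    rw [← h1]
    exact Order.length_le_height h3
  · intro h
    obtain ⟨s, h1, h2⟩ := Order.exists_series_of_le_height P h
    exact (ch_iff_series.2 ⟨s, h2, rfl, h1.le⟩).left bot_le

lemma bot_mAss [IsDomain R] [IsNoetherianRing R] : (⊥ : Ideal R) ∈ minimalAssociatedPrimes R := by
  refine ⟨?_, fun q _ h => le_bot_iff.1 h⟩
  refine isAssociatedPrime_iff.2 ⟨Ideal.isPrime_bot, 1, ?_⟩
  ext x
  simp [Submodule.mem_colon_singleton]

lemma dim_iff [IsLocalRing R] (n : ℕ) : Dlt (⊥ : Ideal R) (maximalIdeal R) n ↔ ringKrullDim R < n := by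
  rw [dlt_iff_dim, ringKrullDim_eq_of_ringEquiv (RingEquiv.quotientBot R)]

lemma wb_eq (d : WithBot ℕ∞) (n : ℕ) (h1 : ¬ d < n) (h2 : d < (n + 1 : ℕ)) : d = n := by
  refine le_antisymm ?_ (not_lt.1 h1)
  induction d with
  | bot => exact bot_le
  | coe d =>
    induction d with
    | top => exact absurd h2 (by simp)
    | coe d => 
      have : d < n + 1 := by exact_mod_cast h2
      have : d ≤ n := by lia
      exact_mod_cast this

lemma wb_eq' (d : WithBot ℕ∞) (n : ℕ) (h1 : ¬ d ≤ n) : ¬ d < (n + 1 : ℕ) := by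
  intro h2
  refine h1 ?_
  by_cases h : d < n
  · exact h.le
  · exact (wb_eq d n h h2).le

lemma cd_le {l : List R} [IsNoetherianRing R] (M : Type u) [AddCommGroup M] [Module R M] (n : ℕ) :
    cohomologicalDim (sp l) (ModuleCat.of R M) ≤ (n : ℕ) ↔ ∀ i : ℕ, n < i → ∀ z : H l (i : ℤ) M, z = 0 := by
  rw [cohomologicalDim, sSup_le_iff]
  constructor
  · intro h i hi z
    by_contra hz
    have : (((i : ℕ∞)) : WithBot ℕ∞) ≤ n := h _ ⟨i, (lc_sub_iff l i M).2 ⟨z, hz⟩, rfl⟩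
    have : i ≤ n := by exact_mod_cast this
    lia
  · rintro h _ ⟨i, hi, rfl⟩
    obtain ⟨z, hz⟩ := (lc_sub_iff l i M).1 hi
    have : i ≤ n := by
      by_contra hc
      exact hz (h i (by lia) z)
    show (((i : ℕ∞)) : WithBot ℕ∞) ≤ n
    exact_mod_cast this

lemma le_cd {l : List R} [IsNoetherianRing R] (M : Type u) [AddCommGroup M] [Module R M] (n : ℕ) (z : H l (n : ℤ) M) (hz : z ≠ 0) :
    ((n : ℕ) : WithBot ℕ∞) ≤ cohomologicalDim (sp l) (ModuleCat.of R M) :=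
  le_sSup ⟨n, (lc_sub_iff l n M).2 ⟨z, hz⟩, rfl⟩

lemma van_of_cd [IsLocalRing R] {l : List R} [IsNoetherianRing R] (p : Ideal R) (n : ℕ) 
    (h : ∀ i : ℕ, n < i → ∀ z : H l (i : ℤ) (R ⧸ p), z = 0) : Van l p n := by
  refine Van.of fun i hi => ?_
  obtain ⟨i, rfl⟩ := Int.eq_ofNat_of_zero_le (show 0 ≤ i by lia)
  exact h i (by lia)

theorem one_two [IsLocalRing R] [IsNoetherianRing R] [IsDomain R] [IsAdicComplete (maximalIdeal R) R]
    (hd : ringKrullDim R = 4) (I : Ideal R) (hI : idealHeight I = 2)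
    (h : (⊥ : Ideal R) ∈ frakA I ∪ frakB I ∪ frakD I) : False := by
  obtain ⟨l, rfl⟩ := exists_list I
  have hb : (⊥ : Ideal R).IsPrime := Ideal.isPrime_bot
  have h5 : Dlt (⊥ : Ideal R) (maximalIdeal R) (4 + 1) := by
    rw [dim_iff, hd]
    exact_mod_cast (by norm_num : (4 : ℕ) < 5)
  have h4 : Ch 4 (⊥ : Ideal R) (maximalIdeal R) := by
    by_contra hc
    rw [← dlt_iff hb, dim_iff, hd] at hc
    exact lt_irrefl _ hc
  have hge : ∀ P : Ideal R, P.IsPrime → sp l ≤ P → Ch 2 ⊥ P := by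
    intro P hP hle
    refine (ch_height 2 ⟨P, hP⟩).2 ?_
    have : idealHeight (sp l) ≤ Order.height (⟨P, hP⟩ : PrimeSpectrum R) := iInf₂_le (⟨P, hP⟩ : PrimeSpectrum R) hle
    rw [hI] at this
    exact this
  obtain ⟨P, hP, hlP, hP3⟩ : ∃ P : Ideal R, P.IsPrime ∧ sp l ≤ P ∧ ¬ Ch 3 ⊥ P := by
    have : idealHeight (sp l) < 3 := by
      rw [hI]
      exact_mod_cast (by norm_num : (2 : ℕ) < 3)
    rw [idealHeight] at this
    simp only [iInf_lt_iff] at this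
    obtain ⟨P, hlP, hP⟩ := this
    exact ⟨P.1, P.2, hlP, fun hc => absurd ((ch_height 3 P).1 hc) (not_le.2 hP)⟩
  have hlm : ∀ x ∈ l, x ∈ maximalIdeal R := fun x hx => le_m hP (hlP (mem_sp hx))
  rcases h with (⟨-, h | h⟩ | ⟨-, h⟩) | ⟨-, -, h⟩
  · rw [Ideal.add_eq_sup, sup_bot_eq] at h
    exact hP.ne_top (top_le_iff.1 (h ▸ hlP))
  · obtain ⟨Q, hQ, hlt, hc⟩ := hge ⊥ hb h
    exact absurd hc.le (not_le_of_gt hlt)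
  · have h1 := (cd_le (l := l) (R ⧸ (⊥ : Ideal R)) 1).1 (by rw [h]; rfl)
    have hV : Van l (⊥ : Ideal R) (1 : ℕ) := van_of_cd ⊥ 1 h1
    have h3 : Dlt (sp l ⊔ ⊥) (maximalIdeal R) (2 + 1) := by
      rw [sup_bot_eq]
      intro Q hQ hle hc
      exact h5.not_ch hb ((hge Q hQ hle).trans hc)
    exact (cd_dim hlm hV h3).not_ch hb h4
  · rw [Ideal.add_eq_sup, sup_bot_eq] at h
    have h2 : Dlt (sp l) (maximalIdeal R) 2 := by
      rw [dlt_iff_dim]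
      refine lt_of_le_of_lt h ?_
      exact_mod_cast (by norm_num : (1 : ℕ) < 2)
    obtain ⟨a, b, hab, ha, hc⟩ := cat3 hb hP bot_le h5 h4
    have : a ≤ 2 := by
      by_contra hcon
      exact hP3 (ha.mono (by lia))
    exact h2 P hP hlP (hc.mono (by lia))

theorem two_one [IsLocalRing R] [IsNoetherianRing R] [IsAdicComplete (maximalIdeal R) R]
    (H2 : ∀ (R : Type u) (_ : CommRing R) (_ : IsNoetherianRing R) (_ : IsLocalRing R)
          (_ : IsDomain R) (_ : IsAdicComplete (IsLocalRing.maximalIdeal R) R),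
        ringKrullDim R = 4 →
          ∀ I : Ideal R, idealHeight I = 2 → ¬ MemCofiniteClass R I) (I : Ideal R) (hI : MemCofiniteClass R I)
    (p : Ideal R) (hp : p ∈ minimalAssociatedPrimes R) : p ∈ frakA I ∪ frakB I ∪ frakD I := by
  obtain ⟨l, rfl⟩ := exists_list I
  by_contra hcon
  simp only [Set.mem_union, not_or] at hcon
  obtain ⟨⟨hA, hB⟩, hD⟩ := hcon
  have hpp : p.IsPrime := hp.1.isPrime
  have hA1 : sp l ⊔ p ≠ ⊤ := fun h => hA ⟨hp, Or.inl h⟩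
  have hA2 : ¬ sp l ≤ p := fun h => hA ⟨hp, Or.inr h⟩
  have hlpm : sp l ⊔ p ≤ maximalIdeal R := IsLocalRing.le_maximalIdeal hA1
  have hlm : ∀ x ∈ l, x ∈ maximalIdeal R := fun x hx => hlpm (Ideal.mem_sup_left (mem_sp hx))
  have hpD : ¬ Dlt (sp l ⊔ p) (maximalIdeal R) 2 := by
    intro h
    rw [dlt_iff_dim] at h
    have : Nontrivial (R ⧸ (sp l ⊔ p)) := Ideal.Quotient.nontrivial_iff.2 hA1
    refine hD ⟨hp, ringKrullDim_nonneg_of_nontrivial, ?_⟩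
    by_contra hc
    have h1 := wb_eq' _ 1 hc
    exact h1 h
  have hpV : ¬ Van l p 1 := by
    intro hV
    have h1 : cohomologicalDim (sp l) (ModuleCat.of R (R ⧸ p)) ≤ (1 : ℕ) := by
      rw [cd_le]
      intro i hi z
      exact hV (R ⧸ p) (by rw [Ideal.annihilator_quotient]) i (by exact_mod_cast hi) z
    have hV0 : Van l p (0 : ℕ) := by
      refine van_of_cd p 0 fun i hi z => ?_
      by_cases hi1 : i = 1
      · subst hi1
        by_contra hz
        exact hB ⟨hp, le_antisymm h1 (le_cd (R ⧸ p) 1 z hz)⟩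
      · exact (cd_le _ _).1 h1 i (by lia) z
    obtain ⟨s, hs, Q, hQ, hle, hc⟩ := exists_dim (sp l ⊔ p) hlpm
    have := cd_dim hlm hV0 hs
    refine this.not_ch hpp ?_
    rw [zero_add]
    refine ⟨Q, hQ, lt_of_le_of_ne (le_sup_right.trans hle) ?_, hc⟩
    rintro rfl
    exact hA2 (le_sup_left.trans hle)
  obtain ⟨Q, ⟨hQp, hQV, hQD⟩, hQmax⟩ := set_has_maximal_iff_noetherian.2 (inferInstance : IsNoetherian R R)
    {Q : Ideal R | Q.IsPrime ∧ ¬ Van l Q 1 ∧ ¬ Dlt (sp l ⊔ Q) (maximalIdeal R) 2} ⟨p, hpp, hpV, hpD⟩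
  have hs : Function.Surjective (algebraMap R (R ⧸ Q)) := Ideal.Quotient.mk_surjective
  have : IsLocalRing (R ⧸ Q) := IsLocalRing.of_surjective' _ hs
  have := complete_quot hs
  have hcb : (⊥ : Ideal (R ⧸ Q)).comap (algebraMap R (R ⧸ Q)) = Q := Ideal.mk_ker
  have hmem := mem_quot l hI hs
  obtain ⟨h5, h4, hge, P, hP, hlP, hP3⟩ := main3 (R := R ⧸ Q) (l := l.map (algebraMap R (R ⧸ Q)))
    (by
      intro x hx
      obtain ⟨y, hy, rfl⟩ := List.mem_map.1 hx
      have := hlm y hy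
      rw [← comap_m hs] at this
      exact this)
    (cfin_of_mem _ hmem)
    (by
      intro Q' hQ' hne
      have hlt : Q < Q'.comap (algebraMap R (R ⧸ Q)) := by
        refine lt_of_le_of_ne ?_ ?_
        · exact hcb.symm.le.trans (Ideal.comap_mono bot_le)
        · intro h
          apply hne
          have h1 := Ideal.map_comap_of_surjective _ hs Q'
          have h2 := Ideal.map_comap_of_surjective _ hs ⊥
          rw [hcb] at h2
          rw [← h, h2] at h1
          exact h1.symm
      by_contra hc
      rw [not_or, dlt_tr hs, comap_sup hs] at hc
      exact hQmax _ ⟨Ideal.comap_isPrime _ _, fun h => hc.1 (van_down hs l Q' 1 (by norm_num) h), hc.2⟩ hlt)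
    (by
      rw [dlt_tr hs, ← sup_bot_eq (sp _), comap_sup hs, hcb]
      exact hQD)
    (fun h => hQV (van_up Q l 1 (by norm_num) h))
  have hb : (⊥ : Ideal (R ⧸ Q)).IsPrime := Ideal.isPrime_bot
  refine H2 (R ⧸ Q) _ inferInstance inferInstance inferInstance inferInstance ?_ _ ?_ hmem
  · refine wb_eq _ 4 ?_ ((dim_iff 5).1 h5)
    rw [← dim_iff, dlt_iff hb, not_not]
    exact h4
  · refine le_antisymm ?_ (le_iInf₂ fun P hP => (ch_height 2 P).1 (hge _ P.2 hP))
    refine (iInf₂_le (⟨P, hP⟩ : PrimeSpectrum (R ⧸ Q)) hlP).trans ?_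
    by_contra hc
    refine hP3 ((ch_height 3 ⟨P, hP⟩).2 ?_)
    have := Order.add_one_le_of_lt (not_le.1 hc)
    exact_mod_cast this
end
end LCoh
end

/-- The following are equivalent:
(i) for every Noetherian complete local ring `(R, m)` and every `I ∈ 𝓘(R)`, one has
`mAss_R R = 𝔄(I,R) ∪ 𝔅(I,R) ∪ 𝔇(I,R)`;
(ii) for every Noetherian complete local domain `(R, m)` of dimension 4 and every ideal `I` of
`R` with `height I = 2`, one has `I ∉ 𝓘(R)`. -/
theorem question_A_iff_question_B :
    (∀ (R : Type u) (_ : CommRing R) (_ : IsNoetherianRing R) (_ : IsLocalRing R)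
        (_ : IsAdicComplete (IsLocalRing.maximalIdeal R) R) (I : Ideal R),
        MemCofiniteClass R I →
          minimalAssociatedPrimes R = frakA I ∪ frakB I ∪ frakD I) ↔
      (∀ (R : Type u) (_ : CommRing R) (_ : IsNoetherianRing R) (_ : IsLocalRing R)
          (_ : IsDomain R) (_ : IsAdicComplete (IsLocalRing.maximalIdeal R) R),
        ringKrullDim R = 4 →
          ∀ I : Ideal R, idealHeight I = 2 → ¬ MemCofiniteClass R I) := by
  constructor
  · intro h R _ _ _ _ _ hd I hI hmem
    exact LCoh.one_two hd I hI (h R _ inferInstance inferInstance inferInstance I hmem ▸ LCoh.bot_mAss)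
  · intro h R _ _ _ _ I hI
    refine Set.Subset.antisymm (fun p hp => LCoh.two_one h I hI p hp) ?_
    rintro p ((hp | hp) | hp) <;> exact hp.1
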